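/- arXiv:1005.3107 — 3 statements merged into one kernel-verified Lean document; each statement's English description precedes it below -/
import Mathlib

section
/- Let (a_k)_{k∈ℤ} be a sequence of positive real numbers such that Σ_{k∈ℤ} a_k^m < ∞ for some positive integer m. Then for every integer e with 1 ≤ e ≤ m−1, one has n^{−1+e/m} Σ_{|k|≤n} a_k^e → 0 as n → ∞. -/
open Filter
open scoped BigOperators Topology

theorem key_bound (m e : ℕ) (hem : e < m) (he1 : 1 ≤ e) (t x : ℝ) (n : ℕ) (hn : 1 ≤ n)
    (ht : 0 < t) (ht1 : t ≤ 1) (hx : 0 < x) :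
    (n : ℝ) ^ (-1 + (e : ℝ) / m) * x ^ e ≤
      min ((n : ℝ) ^ (-1 + (e : ℝ) / m) * x ^ e) ((t ^ (m - e))⁻¹ * x ^ m) + t / n := by
  have hn0 : (0 : ℝ) < n := by exact_mod_cast hn
  have hm0 : (m : ℝ) ≠ 0 := by
    have : 0 < m := by omega
    positivity
  obtain ⟨s, hs, hsm⟩ : ∃ s : ℝ, 0 < s ∧ s ^ m = n := by
    refine ⟨(n : ℝ) ^ ((1 : ℝ) / m), by positivity, ?_⟩
    rw [← Real.rpow_natCast, ← Real.rpow_mul hn0.le]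
    simp [hm0]
  have hc : (n : ℝ) ^ (-1 + (e : ℝ) / m) = (n : ℝ)⁻¹ * s ^ e := by
    rw [Real.rpow_add hn0, Real.rpow_neg_one, ← hsm, ← Real.rpow_natCast s m,
      ← Real.rpow_mul hs.le, mul_div_cancel₀ _ hm0, Real.rpow_natCast, Real.rpow_natCast]
  rw [hc]
  have htn : 0 < t / n := by positivity
  rcases le_total (s * x) t with h | h
  · have h1 : (n : ℝ)⁻¹ * s ^ e * x ^ e ≤ t / n := by
      rw [mul_assoc, ← mul_pow, div_eq_inv_mul]
      gcongr
      calc (s * x) ^ e ≤ t ^ e := by gcongr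
        _ ≤ t ^ 1 := pow_le_pow_of_le_one ht.le ht1 he1
        _ = t := pow_one t
    have : 0 ≤ min ((n : ℝ)⁻¹ * s ^ e * x ^ e) ((t ^ (m - e))⁻¹ * x ^ m) := by
      apply le_min <;> positivity
    linarith
  · have h1 : (n : ℝ)⁻¹ * s ^ e * x ^ e ≤ (t ^ (m - e))⁻¹ * x ^ m := by
      have h2 : t ^ (m - e) ≤ (s * x) ^ (m - e) := by gcongr
      have h3 : (s * x) ^ m = (s * x) ^ e * (s * x) ^ (m - e) := by
        rw [← pow_add]; congr 1; omega
      rw [mul_assoc, ← mul_pow, inv_mul_le_iff₀ hn0, ← mul_assoc, mul_comm (n : ℝ), mul_assoc,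
        le_inv_mul_iff₀ (by positivity), ← hsm, ← mul_pow, h3, mul_comm]
      gcongr
    rw [min_eq_left h1]
    linarith

/-- if `(a_k)_{k ∈ ℤ}` are positive reals with `∑_{k∈ℤ} a_k^m < ∞`, then for every
`1 ≤ e ≤ m - 1` one has `n^{-1 + e/m} ∑_{|k| ≤ n} a_k^e → 0` as `n → ∞`. -/
theorem stmt6 (a : ℤ → ℝ) (ha : ∀ k, 0 < a k) (m : ℕ) (hm : 1 ≤ m)
    (hsum : Summable fun k : ℤ => a k ^ m) (e : ℕ) (he1 : 1 ≤ e) (he2 : e ≤ m - 1) :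
    Tendsto (fun n : ℕ => (n : ℝ) ^ (-1 + (e : ℝ) / m) *
      ∑ k ∈ Finset.Icc (-(n : ℤ)) n, a k ^ e) atTop (𝓝 0) := by
  have hem : e < m := by omega
  have hnn : ∀ (n : ℕ) k, 0 ≤ (n : ℝ) ^ (-1 + (e : ℝ) / m) * a k ^ e := fun n k =>
    mul_nonneg (by positivity) (pow_nonneg (ha k).le _)
  have hc : Tendsto (fun n : ℕ => (n : ℝ) ^ (-1 + (e : ℝ) / m)) atTop (𝓝 0) := by
    have hlt : (e : ℝ) / m < 1 := by
      rw [div_lt_one (by exact_mod_cast hm)]; exact_mod_cast hem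
    have := (tendsto_rpow_neg_atTop (y := 1 - (e : ℝ) / m) (by linarith)).comp
      (tendsto_natCast_atTop_atTop (R := ℝ))
    refine this.congr fun n => ?_
    simp only [Function.comp]
    congr 1; ring
  rw [Metric.tendsto_atTop]
  intro ε hε
  obtain ⟨t, ht, ht1, hte⟩ : ∃ t : ℝ, 0 < t ∧ t ≤ 1 ∧ 3 * t ≤ ε / 2 :=
    ⟨min 1 (ε / 6), by positivity, min_le_left _ _, by linarith [min_le_right 1 (ε / 6)]⟩
  set C : ℝ := (t ^ (m - e))⁻¹ with hC
  have hC0 : 0 < C := by positivity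
  let g : ℕ → ℤ → ℝ := fun n k => min ((n : ℝ) ^ (-1 + (e : ℝ) / m) * a k ^ e) (C * a k ^ m)
  have hCa : ∀ k, 0 ≤ C * a k ^ m := fun k => mul_nonneg hC0.le (pow_nonneg (ha k).le _)
  have hg0 : ∀ n k, 0 ≤ g n k := fun n k => le_min (hnn n k) (hCa k)
  have hCs : Summable fun k => C * a k ^ m := hsum.mul_left C
  have hgs : ∀ n, Summable (g n) := fun n =>
    Summable.of_nonneg_of_le (hg0 n) (fun k => min_le_right _ _) hCs
  have hlim : Tendsto (fun n => ∑' k, g n k) atTop (𝓝 (∑' _ : ℤ, (0 : ℝ))) := by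
    refine tendsto_tsum_of_dominated_convergence hCs (fun k => ?_) (Eventually.of_forall
      fun n k => ?_)
    · refine squeeze_zero (fun n => hg0 n k) (fun n => min_le_left _ _) ?_
      simpa using hc.mul_const (a k ^ e)
    · rw [Real.norm_of_nonneg (hg0 n k)]
      exact min_le_right _ _
  rw [tsum_zero] at hlim
  obtain ⟨N, hN⟩ := eventually_atTop.1 (hlim.eventually (gt_mem_nhds (half_pos hε)))
  refine ⟨max N 1, fun n hn => ?_⟩
  have hn1 : 1 ≤ n := le_trans (le_max_right _ _) hn
  have hn1' : (1 : ℝ) ≤ n := by exact_mod_cast hn1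
  have hNn := hN n (le_trans (le_max_left _ _) hn)
  rw [Finset.mul_sum, Real.dist_eq, sub_zero, abs_of_nonneg (Finset.sum_nonneg fun k _ => hnn n k)]
  have hcard : ((Finset.Icc (-(n : ℤ)) n).card : ℝ) = 2 * n + 1 := by
    have : (Finset.Icc (-(n : ℤ)) n).card = 2 * n + 1 := by
      rw [Int.card_Icc]; omega
    rw [this]; push_cast; ring
  have h3 : (2 * (n : ℝ) + 1) * (t / n) ≤ 3 * t := by
    rw [← mul_div_assoc, div_le_iff₀ (by linarith)]
    nlinarith
  calc _ ≤ ∑ k ∈ Finset.Icc (-(n : ℤ)) n, (g n k + t / n) :=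
        Finset.sum_le_sum fun k _ => key_bound m e hem he1 t (a k) n hn1 ht ht1 (ha k)
    _ = ∑ k ∈ Finset.Icc (-(n : ℤ)) n, g n k + (2 * n + 1) * (t / n) := by
        rw [Finset.sum_add_distrib, Finset.sum_const, nsmul_eq_mul, hcard]
    _ ≤ ∑' k, g n k + 3 * t :=
        add_le_add ((hgs n).sum_le_tsum _ fun k _ => hg0 n k) h3
    _ < ε := by linarith
end

section
/- For every function h : ℝ → ℝ that is twice continuously differentiable with bounded second derivative and every n ≥ 1, one has |E[h(S_n)] − E[h(S)]| ≤ ‖h''‖_∞ (A_{1,n} + A_{3,n}), where S ~ N(0,σ²). -/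
open MeasureTheory ProbabilityTheory Filter
open scoped BigOperators NNReal Topology

noncomputable section

/-- The `n`-th (probabilists') Hermite polynomial, evaluated at `x`. -/
def Hev (n : ℕ) (x : ℝ) : ℝ := Polynomial.aeval x (Polynomial.hermite n)

/-- `θ = ∑_{j ∈ ℤ} |r(j)|^q`. -/
def theta1 (q : ℕ) (r : ℤ → ℝ) : ℝ := ∑' j : ℤ, |r j| ^ q

/-- `γ_{n,q,l} = (2 θ n⁻¹ (∑_{|j|≤n} |r(j)|^l) (∑_{|j|≤n} |r(j)|^{q-l}))^{1/2}`. -/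
def gamma1 (q : ℕ) (r : ℤ → ℝ) (n l : ℕ) : ℝ :=
  Real.sqrt (2 * theta1 q r * (n : ℝ)⁻¹ *
    (∑ j ∈ Finset.Icc (-(n : ℤ)) n, |r j| ^ l) *
    (∑ j ∈ Finset.Icc (-(n : ℤ)) n, |r j| ^ (q - l)))

/-- `A_{1,n} = (q!/2) θ (∑_{|j|≤n} |r(j)|^q |j|/n + ∑_{|j|>n} |r(j)|^q)`. -/
def A1one (q : ℕ) (r : ℤ → ℝ) (n : ℕ) : ℝ :=
  (q.factorial : ℝ) / 2 * theta1 q r *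
    ((∑ j ∈ Finset.Icc (-(n : ℤ)) n, |r j| ^ q * |(j : ℝ)| / n) +
     ∑' j : {j : ℤ // (n : ℤ) < |j|}, |r (j : ℤ)| ^ q)

/-- `A_{3,n} = (1/(2q)) ∑_{l=1}^{q-1} l·l!·binom(q,l)²·((2q-2l)!)^{1/2}·γ_{n,q,l}`. -/
def A3one (q : ℕ) (r : ℤ → ℝ) (n : ℕ) : ℝ :=
  1 / (2 * (q : ℝ)) * ∑ l ∈ Finset.Icc 1 (q - 1),
    (l : ℝ) * (l.factorial : ℝ) * (q.choose l : ℝ) ^ 2 *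
      Real.sqrt ((2 * q - 2 * l).factorial) * gamma1 q r n l

/-- `S_n = n^{-1/2} ∑_{k=1}^n H_q(X_k)`. -/
def S1 {Ω : Type} [MeasureSpace Ω] (q : ℕ) (X : ℤ → Ω → ℝ) (n : ℕ) (ω : Ω) : ℝ :=
  (Real.sqrt n)⁻¹ * ∑ k ∈ Finset.Icc (1 : ℤ) n, Hev q (X k ω)

/-- `σ² = q! ∑_{j ∈ ℤ} r(j)^q`. -/
def sig1 (q : ℕ) (r : ℤ → ℝ) : ℝ := (q.factorial : ℝ) * ∑' j : ℤ, r j ^ q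

end

namespace HermSub

open MvPolynomial in
/-- Directional derivation `D_k` with `D_k X_m = R k m`. -/
noncomputable def DD (R : ℤ → ℤ → ℝ) (k : ℤ) :
    Derivation ℝ (MvPolynomial ℤ ℝ) (MvPolynomial ℤ ℝ) :=
  MvPolynomial.mkDerivation ℝ (fun m => MvPolynomial.C (R k m))

/-- Raising operator (divergence). -/
noncomputable def dl (R : ℤ → ℤ → ℝ) (k : ℤ) (F : MvPolynomial ℤ ℝ) : MvPolynomial ℤ ℝ :=
  MvPolynomial.X k * F - DD R k F

/-- Wick products. -/
noncomputable def WW (R : ℤ → ℤ → ℝ) (k m : ℤ) (a b : ℕ) : MvPolynomial ℤ ℝ :=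
  (dl R k)^[a] ((dl R m)^[b] 1)

section alg
variable (R : ℤ → ℤ → ℝ)

lemma DD_X (k m : ℤ) : DD R k (MvPolynomial.X m) = MvPolynomial.C (R k m) := by
  simp [DD, MvPolynomial.mkDerivation_X]

lemma DD_comm (k m : ℤ) (F : MvPolynomial ℤ ℝ) : DD R k (DD R m F) = DD R m (DD R k F) := by
  have h : ⁅DD R k, DD R m⁆ = 0 := by
    apply MvPolynomial.derivation_ext
    intro i
    rw [Derivation.commutator_apply, DD_X, DD_X]
    simp [MvPolynomial.derivation_C]
  have := congrArg (fun D => D F) h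
  simp only [Derivation.commutator_apply, Derivation.coe_zero, Pi.zero_apply] at this
  exact sub_eq_zero.1 this

lemma dl_mul (k : ℤ) (F G : MvPolynomial ℤ ℝ) :
    dl R k F * G = dl R k (F * G) + F * DD R k G := by
  simp only [dl, Derivation.leibniz, smul_eq_mul]; ring

lemma dl_add (k : ℤ) (F G : MvPolynomial ℤ ℝ) : dl R k (F + G) = dl R k F + dl R k G := by
  simp only [dl, map_add]; ring

lemma dl_C_mul (k : ℤ) (c : ℝ) (F : MvPolynomial ℤ ℝ) :
    dl R k (MvPolynomial.C c * F) = MvPolynomial.C c * dl R k F := by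
  simp only [dl, Derivation.leibniz, smul_eq_mul, DD, MvPolynomial.derivation_C]; ring

lemma dl_zero (k : ℤ) : dl R k 0 = 0 := by simp [dl]

lemma dl_sum (k : ℤ) {ι : Type*} (s : Finset ι) (f : ι → MvPolynomial ℤ ℝ) :
    dl R k (∑ i ∈ s, f i) = ∑ i ∈ s, dl R k (f i) := by
  classical
  induction s using Finset.induction_on with
  | empty => simp [dl_zero]
  | insert a s ha ih => rw [Finset.sum_insert ha, Finset.sum_insert ha, dl_add, ih]

lemma DD_dl (k j : ℤ) (F : MvPolynomial ℤ ℝ) :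
    DD R k (dl R j F) = MvPolynomial.C (R k j) * F + dl R j (DD R k F) := by
  simp only [dl, map_sub, Derivation.leibniz, smul_eq_mul, DD_X]
  rw [DD_comm]; ring

lemma DD_W1 (k j : ℤ) (d : ℕ) :
    DD R k ((dl R j)^[d] 1) = MvPolynomial.C (d * R k j) * ((dl R j)^[d-1] 1) := by
  induction d with
  | zero => simp
  | succ d ih =>
    rw [Function.iterate_succ_apply', DD_dl, ih, dl_C_mul, ← Function.iterate_succ_apply' (dl R j)]
    rcases d with _ | d
    · simp
    · simp; ring

lemma DD_W (k i j : ℤ) (c d : ℕ) :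
    DD R k (WW R i j c d) = MvPolynomial.C (c * R k i) * WW R i j (c-1) d +
      MvPolynomial.C (d * R k j) * WW R i j c (d-1) := by
  induction c with
  | zero => simp [WW, DD_W1]
  | succ c ih =>
    have h1 : WW R i j (c+1) d = dl R i (WW R i j c d) := by
      simp only [WW, Function.iterate_succ_apply']
    have h2 : WW R i j (c+1) (d-1) = dl R i (WW R i j c (d-1)) := by
      simp only [WW, Function.iterate_succ_apply']
    rw [h1, DD_dl, ih, dl_add, dl_C_mul, dl_C_mul, h2]
    rcases c with _ | c
    · simp
    · have h3 : WW R i j (c+1) d = dl R i (WW R i j c d) := by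
        simp only [WW, Function.iterate_succ_apply']
      simp [← h3]; ring

lemma prod_formula (k m : ℤ) (a b : ℕ) :
    (dl R k)^[a] 1 * (dl R m)^[b] 1 = ∑ l ∈ Finset.range (a+1),
      MvPolynomial.C ((l.factorial : ℝ) * a.choose l * b.choose l * R k m ^ l) *
        WW R k m (a-l) (b-l) := by
  induction a generalizing b with
  | zero => simp [WW]
  | succ a ih =>
    rw [Function.iterate_succ_apply', dl_mul, DD_W1, mul_left_comm, ih, ih (b-1), dl_sum,
      Finset.sum_range_succ' _ (a+1), Finset.mul_sum]
    have e1 : ∑ i ∈ Finset.range (a+1), dl R k (MvPolynomial.C ((i.factorial : ℝ) * a.choose i * b.choose i * R k m ^ i) * WW R k m (a-i) (b-i))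
       = ∑ i ∈ Finset.range (a+1), MvPolynomial.C (((i+1).factorial : ℝ) * a.choose (i+1) * b.choose (i+1) * R k m ^ (i+1)) * WW R k m (a+1-(i+1)) (b-(i+1)) + MvPolynomial.C ((Nat.factorial 0 : ℝ) * a.choose 0 * b.choose 0 * R k m ^ 0) * WW R k m (a+1-0) (b-0) := by
      rw [← Finset.sum_range_succ' (fun i => MvPolynomial.C ((i.factorial : ℝ) * a.choose i * b.choose i * R k m ^ i) * WW R k m (a+1-i) (b-i)), Finset.sum_range_succ _ (a+1)]
      simp only [Nat.choose_succ_self, Nat.cast_zero, mul_zero, zero_mul, map_zero, add_zero]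
      refine Finset.sum_congr rfl fun i hi => ?_
      rw [dl_C_mul]
      congr 1
      have : a + 1 - i = (a - i) + 1 := by have := Finset.mem_range.1 hi; omega
      rw [this]
      simp only [WW, Function.iterate_succ_apply']
    rw [e1, add_right_comm, ← Finset.sum_add_distrib]
    congr 1
    · refine Finset.sum_congr rfl fun i hi => ?_
      have h1 : a + 1 - (i+1) = a - i := by omega
      have h2 : b - (i+1) = b - 1 - i := by omega
      rw [h1, h2, ← mul_assoc, ← map_mul, ← add_mul, ← map_add]
      congr 2
      have h3 : (b : ℝ) * (b-1).choose i = (i+1) * b.choose (i+1) := by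
        rcases b with _ | b
        · simp
        · have := Nat.add_one_mul_choose_eq b i
          have h := congrArg (Nat.cast : ℕ → ℝ) this
          push_cast at h ⊢
          linarith
      have h4 : ((a+1).choose (i+1) : ℝ) = a.choose i + a.choose (i+1) := by
        rw [Nat.choose_succ_succ]; push_cast; ring
      rw [h4, Nat.factorial_succ]
      push_cast
      linear_combination (i.factorial : ℝ) * a.choose i * R k m ^ (i+1) * h3
    · simp

lemma herm_eq (k : ℤ) (hk : R k k = 1) (a : ℕ) :
    Polynomial.aeval (MvPolynomial.X k : MvPolynomial ℤ ℝ) (Polynomial.hermite a) =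
      (dl R k)^[a] 1 := by
  induction a with
  | zero => simp
  | succ a ih =>
    rw [Function.iterate_succ_apply', Polynomial.hermite_succ, map_sub, map_mul, Polynomial.aeval_X, ih, dl]
    congr 1
    rw [← ih]
    have h := Derivation.map_aeval (R := ℤ) (Derivation.restrictScalars ℤ (DD R k)) (Polynomial.hermite a) (MvPolynomial.X k : MvPolynomial ℤ ℝ)
    have h2 : (Derivation.restrictScalars ℤ (DD R k)) (MvPolynomial.X k) = 1 := by
      show DD R k (MvPolynomial.X k) = 1
      rw [DD_X, hk]; simp
    rw [h2, smul_eq_mul, mul_one] at h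
    exact h.symm

end alg

section func
variable (R : ℤ → ℤ → ℝ) (E : MvPolynomial ℤ ℝ →ₗ[ℝ] ℝ)

lemma E_dl
    (hE : ∀ k F, E (MvPolynomial.X k * F) = E (DD R k F))
    (k : ℤ) (F G : MvPolynomial ℤ ℝ) : E (dl R k F * G) = E (F * DD R k G) := by
  rw [dl_mul, dl, map_add, map_sub, hE]; ring

lemma E_C_mul (c : ℝ) (F : MvPolynomial ℤ ℝ) : E (MvPolynomial.C c * F) = c * E F := by
  rw [MvPolynomial.C_mul', map_smul, smul_eq_mul]

lemma E_HH
    (hE : ∀ k F, E (MvPolynomial.X k * F) = E (DD R k F)) (hE1 : E 1 = 1)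
    (k m : ℤ) (q : ℕ) :
    E ((dl R k)^[q] 1 * (dl R m)^[q] 1) = q.factorial * R k m ^ q := by
  induction q with
  | zero => simp [hE1]
  | succ q ih =>
    rw [Function.iterate_succ_apply' (dl R k), E_dl R E hE, DD_W1, mul_left_comm, E_C_mul,
      Nat.add_sub_cancel, ih, Nat.factorial_succ]
    push_cast; ring

open Polynomial in
lemma E_WW
    (hE : ∀ k F, E (MvPolynomial.X k * F) = E (DD R k F)) (hE1 : E 1 = 1)
    (k m i j : ℤ) (a b c d : ℕ) (h : a + b = c + d) :
    E (WW R k m a b * WW R i j c d) = c.factorial * d.factorial *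
      ((C (R k i) * X + C (R k j))^a * (C (R m i) * X + C (R m j))^b : ℝ[X]).coeff c := by
  induction a generalizing b c d with
  | zero =>
    induction b generalizing c d with
    | zero =>
      obtain ⟨rfl, rfl⟩ : c = 0 ∧ d = 0 := by omega
      simp [WW, hE1]
    | succ b ih =>
      have h1 : WW R k m 0 (b+1) = dl R m (WW R k m 0 b) := by
        simp only [WW, Function.iterate_succ_apply', Function.iterate_zero, id]
      rw [h1, E_dl R E hE, DD_W, mul_add, mul_left_comm, mul_left_comm _ (MvPolynomial.C _), map_add,
        E_C_mul, E_C_mul]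
      have hdeg : ((C (R k i) * X + C (R k j))^0 * (C (R m i) * X + C (R m j))^b : ℝ[X]).natDegree ≤ b := by
        rw [pow_zero, one_mul]
        refine (Polynomial.natDegree_pow_le).trans ?_
        have : (C (R m i) * X + C (R m j) : ℝ[X]).natDegree ≤ 1 := Polynomial.natDegree_linear_le
        nlinarith
      rw [pow_succ (C (R m i) * X + C (R m j) : ℝ[X]), ← mul_assoc, mul_add, coeff_add, coeff_mul_C]
      set Q := ((C (R k i) * X + C (R k j))^0 * (C (R m i) * X + C (R m j))^b : ℝ[X]) with hQ
      rcases c with _ | c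
      · rcases d with _ | d
        · omega
        · rw [ih 0 (d+1-1) (by omega)]
          simp [Nat.factorial_succ]
          ring
      · have e : (Q * (C (R m i) * X)).coeff (c+1) = R m i * Q.coeff c := by
          rw [← mul_assoc, coeff_mul_X, coeff_mul_C]; ring
        rw [e]
        rcases d with _ | d
        · rw [ih (c+1-1) 0 (by omega), coeff_eq_zero_of_natDegree_lt (n := c+1) (by omega)]
          simp [Nat.factorial_succ]
          ring
        · rw [ih (c+1-1) (d+1) (by omega), ih (c+1) (d+1-1) (by omega)]
          simp [Nat.factorial_succ]
          ring
  | succ a ih =>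
      have h1 : WW R k m (a+1) b = dl R k (WW R k m a b) := by
        simp only [WW, Function.iterate_succ_apply']
      rw [h1, E_dl R E hE, DD_W, mul_add, mul_left_comm, mul_left_comm _ (MvPolynomial.C _), map_add,
        E_C_mul, E_C_mul]
      have hdeg : ((C (R k i) * X + C (R k j))^a * (C (R m i) * X + C (R m j))^b : ℝ[X]).natDegree ≤ a + b := by
        refine (Polynomial.natDegree_mul_le).trans (add_le_add ?_ ?_)
        · refine (Polynomial.natDegree_pow_le).trans ?_
          have : (C (R k i) * X + C (R k j) : ℝ[X]).natDegree ≤ 1 := Polynomial.natDegree_linear_le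
          nlinarith
        · refine (Polynomial.natDegree_pow_le).trans ?_
          have : (C (R m i) * X + C (R m j) : ℝ[X]).natDegree ≤ 1 := Polynomial.natDegree_linear_le
          nlinarith
      rw [pow_succ (C (R k i) * X + C (R k j) : ℝ[X]), mul_right_comm (_ ^ a) _ (_ ^ b), mul_add ((C (R k i) * X + C (R k j))^a * (C (R m i) * X + C (R m j))^b), coeff_add, coeff_mul_C]
      set Q := ((C (R k i) * X + C (R k j))^a * (C (R m i) * X + C (R m j))^b : ℝ[X]) with hQ
      rcases c with _ | c
      · rcases d with _ | d
        · omega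
        · rw [ih b 0 (d+1-1) (by omega), ← hQ]
          simp [Nat.factorial_succ]
          ring
      · have e : (Q * (C (R k i) * X)).coeff (c+1) = R k i * Q.coeff c := by
          rw [← mul_assoc, coeff_mul_X, coeff_mul_C]; ring
        rw [e]
        rcases d with _ | d
        · rw [ih b (c+1-1) 0 (by omega), coeff_eq_zero_of_natDegree_lt (n := c+1) (by omega)]
          simp [Nat.factorial_succ]
          ring
        · rw [ih b (c+1-1) (d+1) (by omega), ih b (c+1) (d+1-1) (by omega)]
          simp [Nat.factorial_succ]
          ring

open Polynomial in
lemma coeff_lin_pow (α β : ℝ) (p i : ℕ) :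
    ((C α * X + C β)^p : ℝ[X]).coeff i = α ^ i * β ^ (p - i) * p.choose i := by
  rw [add_pow, finsetSum_coeff]
  have : ∀ x ∈ Finset.range (p+1), (((C α * X)^x * (C β)^(p-x) * (p.choose x : ℝ[X])).coeff i : ℝ)
      = if i = x then α ^ i * β ^ (p - i) * p.choose i else 0 := by
    intro x _
    have : ((C α * X)^x * (C β)^(p-x) * (p.choose x : ℝ[X])) = C (α ^ x * β ^ (p-x) * p.choose x) * X ^ x := by
      simp only [map_mul, map_pow, map_natCast]; ring
    rw [this, coeff_C_mul_X_pow]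
    split_ifs with h
    · rw [h]
    · rfl
  rw [Finset.sum_congr rfl this]
  simp only [Finset.sum_ite_eq, Finset.mem_range]
  split_ifs with h
  · rfl
  · rw [Nat.choose_eq_zero_of_lt (by omega)]; simp

lemma pow_mix (x y : ℝ) (hx : 0 ≤ x) (hy : 0 ≤ y) (i j : ℕ) : x ^ i * y ^ j ≤ x ^ (i+j) + y ^ (i+j) := by
  rcases le_total x y with h | h
  · have : x ^ i * y ^ j ≤ y ^ i * y ^ j := by gcongr
    rw [pow_add y]; have := pow_nonneg hx (i+j); linarith
  · have : x ^ i * y ^ j ≤ x ^ i * x ^ j := by gcongr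
    rw [pow_add x]; have := pow_nonneg hy (i+j); linarith

lemma E_WW_bound
    (hE : ∀ k F, E (MvPolynomial.X k * F) = E (DD R k F)) (hE1 : E 1 = 1)
    (k m i j : ℤ) (p : ℕ) :
    |E (WW R k m p p * WW R i j p p)| ≤ (2*p).factorial *
      (|R k i| ^ p * |R m j| ^ p + |R k j| ^ p * |R m i| ^ p) := by
  rw [E_WW R E hE hE1 k m i j p p p p rfl, Polynomial.coeff_mul]
  have key : ∀ x ∈ Finset.HasAntidiagonal.antidiagonal p,
      |(((Polynomial.C (R k i) * Polynomial.X + Polynomial.C (R k j))^p : Polynomial ℝ).coeff x.1 *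
      ((Polynomial.C (R m i) * Polynomial.X + Polynomial.C (R m j))^p : Polynomial ℝ).coeff x.2)| ≤
      ((p.choose x.1 * p.choose x.2 : ℕ) : ℝ) * (|R k i| ^ p * |R m j| ^ p + |R k j| ^ p * |R m i| ^ p) := by
    rintro ⟨u, v⟩ huv
    have huv : u + v = p := by simpa using huv
    rw [coeff_lin_pow, coeff_lin_pow]
    have h1 : p - u = v := by omega
    have h2 : p - v = u := by omega
    simp only [h1, h2]
    have h3 := pow_mix (|R k i| * |R m j|) (|R k j| * |R m i|) (by positivity) (by positivity) u v
    rw [huv] at h3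
    simp only [mul_pow] at h3
    calc _ = ((p.choose u * p.choose v : ℕ) : ℝ) * (|R k i|^u * |R m j|^u * (|R k j|^v * |R m i|^v)) := by
            simp only [abs_mul, abs_pow, Nat.abs_cast]; push_cast; ring
      _ ≤ _ := by gcongr
  rw [abs_mul, abs_of_nonneg (by positivity)]
  calc _ ≤ (p.factorial * p.factorial : ℝ) * ∑ x ∈ Finset.HasAntidiagonal.antidiagonal p, ((p.choose x.1 * p.choose x.2 : ℕ) : ℝ) * (|R k i| ^ p * |R m j| ^ p + |R k j| ^ p * |R m i| ^ p) := by
        gcongr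
        exact (Finset.abs_sum_le_sum_abs _ _).trans (Finset.sum_le_sum key)
    _ = _ := by
        rw [← Finset.sum_mul, ← Nat.cast_sum, ← Nat.add_choose_eq, ← mul_assoc]
        congr 1
        have := Nat.add_choose_mul_factorial_mul_factorial p p
        rw [two_mul, ← this]; push_cast; ring

end func
end HermSub

namespace HermSub

/-- Standard Gaussian integration by parts. -/
lemma ibp1 (g g' : ℝ → ℝ) (hd : ∀ x, HasDerivAt g (g' x) x)
    (hg : Integrable g (gaussianReal 0 1)) (hxg : Integrable (fun x => x * g x) (gaussianReal 0 1))
    (hg' : Integrable g' (gaussianReal 0 1)) :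
    ∫ x, x * g x ∂(gaussianReal 0 1) = ∫ x, g' x ∂(gaussianReal 0 1) := by
  have conv : ∀ f : ℝ → ℝ, Integrable f (gaussianReal 0 1) →
      Integrable (fun x => gaussianPDFReal 0 1 x * f x) := by
    intro f hf
    rw [gaussianReal_of_var_ne_zero _ one_ne_zero,
      integrable_withDensity_iff_integrable_smul' (measurable_gaussianPDF _ _)
        (ae_of_all _ fun _ => gaussianPDF_lt_top)] at hf
    simpa using hf
  rw [integral_gaussianReal_eq_integral_smul one_ne_zero,
    integral_gaussianReal_eq_integral_smul one_ne_zero]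
  have hφ : ∀ x, HasDerivAt (gaussianPDFReal 0 1) (-x * gaussianPDFReal 0 1 x) x := by
    intro x
    rw [gaussianPDFReal_def]
    have h1 : HasDerivAt (fun x : ℝ => -(x - 0)^2 / (2 * ((1:ℝ≥0):ℝ))) (-x) x := by
      have := (((hasDerivAt_id x).sub_const 0).pow 2).neg.div_const (2 * ((1:ℝ≥0):ℝ))
      refine this.congr_deriv ?_
      simp [id]; ring
    have := (h1.exp).const_mul ((√(2 * Real.pi * ((1:ℝ≥0):ℝ)))⁻¹)
    refine this.congr_deriv ?_
    ring
  have hD : ∀ x, HasDerivAt (fun x => gaussianPDFReal 0 1 x * g x)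
      (gaussianPDFReal 0 1 x * g' x - gaussianPDFReal 0 1 x * (x * g x)) x := by
    intro x
    have := (hφ x).mul (hd x)
    refine this.congr_deriv ?_
    ring
  have h0 := integral_eq_zero_of_hasDerivAt_of_integrable hD ((conv _ hg').sub (conv _ hxg)) (conv _ hg)
  rw [integral_sub (conv _ hg') (conv _ hxg)] at h0
  simp only [smul_eq_mul]
  linarith

lemma gaussProc {Ω : Type*} [MeasurableSpace Ω] {P : Measure Ω}
    (X : ℤ → Ω → ℝ) (hXmeas : ∀ k, Measurable (X k))
    (hGauss : ∀ (s : Finset ℤ) (c : ℤ → ℝ), ∃ v : ℝ≥0,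
      Measure.map (fun ω => ∑ k ∈ s, c k * X k ω) P = gaussianReal 0 v) :
    IsGaussianProcess X P := by
  constructor
  intro I
  constructor
  apply isGaussian_of_map_eq_gaussianReal
  intro L
  classical
  have hm : Measurable (fun ω => I.restrict (X · ω)) := by
    rw [measurable_pi_iff]; intro i; exact hXmeas i
  obtain ⟨v, hv⟩ := hGauss I (fun k => if h : k ∈ I then L (Pi.single ⟨k, h⟩ 1) else 0)
  refine ⟨0, v, ?_⟩
  rw [Measure.map_map L.continuous.measurable hm, ← hv]
  congr 1
  ext ω
  rw [← Finset.sum_coe_sort I]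
  simp only [Function.comp, Finset.coe_mem, dite_true, Subtype.coe_eta]
  have : I.restrict (X · ω) = ∑ i : I, (X i ω) • (Pi.single i (1:ℝ) : I → ℝ) := by
    ext j
    simp [Finset.sum_apply, Pi.single_apply, Finset.restrict]
  rw [this, map_sum]
  refine Finset.sum_congr rfl fun i _ => ?_
  rw [map_smul, smul_eq_mul, mul_comm]

/-- Data of a centered Gaussian family with covariance `R`. -/
structure GSeq {Ω : Type*} [MeasurableSpace Ω] (P : Measure Ω) (X : ℤ → Ω → ℝ) (R : ℤ → ℤ → ℝ) :
    Prop where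
  meas : ∀ k, Measurable (X k)
  gp : IsGaussianProcess X P
  law : ∀ k, P.map (X k) = gaussianReal 0 1
  cov : ∀ k m, ∫ ω, X k ω * X m ω ∂P = R k m
  diag : ∀ k, R k k = 1

section
variable {Ω : Type*} [MeasurableSpace Ω] {P : Measure Ω} [IsProbabilityMeasure P]
  {X : ℤ → Ω → ℝ} {R : ℤ → ℤ → ℝ}

lemma GSeq.mean (h : GSeq P X R) (k : ℤ) : ∫ ω, X k ω ∂P = 0 := by
  have := integral_map (μ := P) (h.meas k).aemeasurable (f := fun x : ℝ => x) (by fun_prop)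
  rw [← this, h.law k, integral_id_gaussianReal]

lemma GSeq.indep (h : GSeq P X R) (k : ℤ) :
    IndepFun (X k) (fun ω m => X m ω - R k m * X k ω) P := by
  have h1 : IsGaussianProcess (Sum.elim (fun (_ : Unit) => X k) (fun (m : ℤ) ω => X m ω - R k m * X k ω)) P := by
    refine IsGaussianProcess.of_isGaussianProcess h.gp ?_
    classical
    rintro (_ | m)
    · refine ⟨{k}, ContinuousLinearMap.proj ⟨k, by simp⟩, fun ω => rfl⟩
    · refine ⟨{k, m}, ContinuousLinearMap.proj (R := ℝ) (φ := fun _ : ({k, m} : Finset ℤ) => ℝ) ⟨m, by simp⟩ - R k m • ContinuousLinearMap.proj (R := ℝ) (φ := fun _ : ({k, m} : Finset ℤ) => ℝ) ⟨k, by simp⟩, fun ω => ?_⟩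
      simp [Finset.restrict]
  have hL2 : ∀ m, MemLp (X m) 2 P := fun m => (h.gp.hasGaussianLaw_eval m).memLp_two
  have h2 := h1.indepFun_of_covariance_eq_zero (fun _ => (h.meas k).aemeasurable)
    (fun m => ((h.meas m).sub ((h.meas k).const_mul _)).aemeasurable) (fun _ m => by
      show cov[X k, fun ω => X m ω - R k m * X k ω; P] = 0
      rw [covariance_fun_sub_right (hL2 k) (hL2 m) ((hL2 k).const_mul _), covariance_const_mul_right,
        covariance_eq_sub (hL2 k) (hL2 m), covariance_eq_sub (hL2 k) (hL2 k)]
      simp only [Pi.mul_apply, h.cov, h.mean, h.diag]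
      ring)
  exact h2.comp (φ := fun x : Unit → ℝ => x ()) (ψ := id) (measurable_pi_apply _) measurable_id

/-- Directional integration by parts. -/
lemma GSeq.ibp (h : GSeq P X R) (k : ℤ) (G DG : (ℤ → ℝ) → ℝ) (hGm : Measurable G)
    (hDGm : Measurable DG)
    (hder : ∀ y, HasDerivAt (fun x : ℝ => G (y + x • R k)) (DG y) 0)
    (i1 : Integrable (fun ω => G (fun m => X m ω)) P)
    (i2 : Integrable (fun ω => X k ω * G (fun m => X m ω)) P)
    (i3 : Integrable (fun ω => DG (fun m => X m ω)) P) :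
    ∫ ω, X k ω * G (fun m => X m ω) ∂P = ∫ ω, DG (fun m => X m ω) ∂P := by
  set Y : Ω → ℤ → ℝ := fun ω m => X m ω - R k m * X k ω with hY
  have hYm : Measurable Y := by
    rw [measurable_pi_iff]; intro m; exact (h.meas m).sub ((h.meas k).const_mul _)
  have hpm : Measurable (fun ω => (X k ω, Y ω)) := (h.meas k).prodMk hYm
  have hmap := (indepFun_iff_map_prod_eq_prod_map_map (h.meas k).aemeasurable hYm.aemeasurable).1 (h.indep k)
  rw [h.law k] at hmap
  have : IsProbabilityMeasure (P.map Y) := Measure.isProbabilityMeasure_map hYm.aemeasurable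
  have hX : ∀ ω, (fun m => X m ω) = Y ω + X k ω • R k := by
    intro ω; ext m; simp [hY]; ring
  have mΦ : Measurable (fun z : ℝ × (ℤ → ℝ) => z.2 + z.1 • R k) := by
    rw [measurable_pi_iff]; intro m
    simp only [Pi.add_apply, Pi.smul_apply, smul_eq_mul]
    exact ((measurable_pi_apply m).comp measurable_snd).add (measurable_fst.mul_const _)
  have tr : ∀ F : ℝ × (ℤ → ℝ) → ℝ, Measurable F → Integrable (fun ω => F (X k ω, Y ω)) P →
      Integrable F ((gaussianReal 0 1).prod (P.map Y)) ∧
      ∫ ω, F (X k ω, Y ω) ∂P = ∫ y, ∫ x, F (x, y) ∂(gaussianReal 0 1) ∂(P.map Y) := by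
    intro F hF hFi
    have hi : Integrable F ((gaussianReal 0 1).prod (P.map Y)) := by
      rw [← hmap]
      exact (integrable_map_measure hF.aestronglyMeasurable hpm.aemeasurable).2 hFi
    refine ⟨hi, ?_⟩
    rw [← integral_prod_symm _ hi, ← hmap, integral_map hpm.aemeasurable hF.aestronglyMeasurable]
  obtain ⟨j1, -⟩ := tr (fun z => G (z.2 + z.1 • R k)) (hGm.comp mΦ) (by simpa only [hX] using i1)
  obtain ⟨j2, e2⟩ := tr (fun z => z.1 * G (z.2 + z.1 • R k)) (measurable_fst.mul (hGm.comp mΦ)) (by simpa only [hX] using i2)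
  obtain ⟨j3, e3⟩ := tr (fun z => DG (z.2 + z.1 • R k)) (hDGm.comp mΦ) (by simpa only [hX] using i3)
  simp only [hX]
  rw [e2, e3]
  apply integral_congr_ae
  filter_upwards [j1.prod_left_ae, j2.prod_left_ae, j3.prod_left_ae] with y a1 a2 a3
  refine ibp1 (fun x => G (y + x • R k)) (fun x => DG (y + x • R k)) (fun x => ?_) a1 a2 a3
  have := hder (y + x • R k)
  have h2 : HasDerivAt (fun t : ℝ => t - x) 1 x := (hasDerivAt_id x).sub_const x
  have h3 := HasDerivAt.comp x (h := fun t : ℝ => t - x) (h₂ := fun t : ℝ => G (y + x • R k + t • R k)) (h₂' := DG (y + x • R k)) (by simpa using this) h2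
  rw [mul_one] at h3
  have e : (fun x => G (y + x • R k)) = (fun t => G (y + x • R k + t • R k)) ∘ fun t => t - x := by
    ext t
    simp only [Function.comp]
    congr 1
    rw [add_assoc, ← add_smul]; simp
  rw [e]
  exact h3

lemma eval_deriv (k : ℤ) (F : MvPolynomial ℤ ℝ) (y : ℤ → ℝ) :
    HasDerivAt (fun x : ℝ => MvPolynomial.eval (y + x • R k) F)
      (MvPolynomial.eval y (DD R k F)) 0 := by
  induction F using MvPolynomial.induction_on with
  | C a => simpa [DD, MvPolynomial.derivation_C] using hasDerivAt_const (0:ℝ) a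
  | add p q hp hq =>
    simp only [map_add]
    exact hp.add hq
  | mul_X p i hp =>
    have h1 : HasDerivAt (fun x : ℝ => y i + x * R k i) (R k i) 0 := by
      simpa using ((hasDerivAt_id (0:ℝ)).mul_const (R k i)).const_add (y i)
    have := hp.mul h1
    simp only [Derivation.leibniz, DD_X, smul_eq_mul, map_mul, map_add, MvPolynomial.eval_X, Pi.add_apply, Pi.smul_apply, MvPolynomial.eval_C]
    refine HasDerivAt.congr_deriv (f' := MvPolynomial.eval y (DD R k p) * (y i + 0 * R k i) +
      MvPolynomial.eval (y + (0:ℝ) • R k) p * R k i) this ?_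
    simp; ring

lemma meas_eval (F : MvPolynomial ℤ ℝ) : Measurable (fun y : ℤ → ℝ => MvPolynomial.eval y F) := by
  induction F using MvPolynomial.induction_on with
  | C a => simp
  | add p q hp hq =>
    simp only [map_add]
    exact hp.add hq
  | mul_X p i hp =>
    simp only [map_mul, MvPolynomial.eval_X]
    exact hp.mul (measurable_pi_apply i)

/-- all moments finite -/
def AllLp (P : Measure Ω) (f : Ω → ℝ) : Prop := ∀ p : ℕ, MemLp f p P

lemma AllLp.mul {f g : Ω → ℝ} (hf : AllLp P f) (hg : AllLp P g) : AllLp P (fun ω => f ω * g ω) := by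
  intro p
  have h1 := hf (2*p)
  have h2 := hg (2*p)
  have : ENNReal.HolderTriple ((2*p : ℕ) : ENNReal) ((2*p : ℕ) : ENNReal) (p : ENNReal) := by
    constructor
    rcases p with _ | p
    · simp
    · push_cast
      rw [ENNReal.mul_inv (by simp) (by simp), ← add_mul, ENNReal.inv_two_add_inv_two, one_mul]
  exact h2.mul h1

lemma AllLp.add {f g : Ω → ℝ} (hf : AllLp P f) (hg : AllLp P g) : AllLp P (fun ω => f ω + g ω) :=
  fun p => (hf p).add (hg p)

lemma AllLp.const (c : ℝ) : AllLp P (fun _ => c) := fun _ => memLp_const c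

lemma AllLp.int {f : Ω → ℝ} (hf : AllLp P f) : Integrable f P := by
  have := hf 1
  rw [Nat.cast_one] at this
  exact memLp_one_iff_integrable.1 this

lemma allLp_eval (hX : ∀ k, AllLp P (X k)) (F : MvPolynomial ℤ ℝ) :
    AllLp P (fun ω => MvPolynomial.eval (fun m => X m ω) F) := by
  induction F using MvPolynomial.induction_on with
  | C a => simpa using AllLp.const a
  | add p q hp hq => simpa using hp.add hq
  | mul_X p i hp => simpa using hp.mul (hX i)

lemma GSeq.allLp (h : GSeq P X R) (k : ℤ) : AllLp P (X k) := fun p =>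
  (h.gp.hasGaussianLaw_eval k).memLp (by simp)

/-- Expectation as linear functional. -/
noncomputable def EE (hX : ∀ k, AllLp P (X k)) : MvPolynomial ℤ ℝ →ₗ[ℝ] ℝ where
  toFun F := ∫ ω, MvPolynomial.eval (fun m => X m ω) F ∂P
  map_add' F G := by
    simp only [map_add]
    exact integral_add (allLp_eval hX F).int (allLp_eval hX G).int
  map_smul' c F := by
    simp [integral_const_mul, MvPolynomial.smul_eval]

lemma GSeq.EE_X (h : GSeq P X R) (k : ℤ) (F : MvPolynomial ℤ ℝ) :
    EE h.allLp (MvPolynomial.X k * F) = EE h.allLp (DD R k F) := by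
  show ∫ ω, _ ∂P = ∫ ω, _ ∂P
  simp only [map_mul, MvPolynomial.eval_X]
  exact h.ibp k _ _ (meas_eval F) (meas_eval _) (eval_deriv k F) (allLp_eval h.allLp F).int
    ((h.allLp k).mul (allLp_eval h.allLp F)).int (allLp_eval h.allLp _).int

lemma EE_one (hX : ∀ k, AllLp P (X k)) : EE (P := P) hX 1 = 1 := by
  show ∫ ω, _ ∂P = 1
  simp

end
end HermSub

namespace HermSub

lemma growth1 (h1 h2 : ℝ → ℝ) (C : ℝ) (hd2 : ∀ x, HasDerivAt h1 (h2 x) x) (hC : ∀ x, |h2 x| ≤ C)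
    (y : ℝ) : |h1 y| ≤ |h1 0| + C * |y| := by
  have := Convex.norm_image_sub_le_of_norm_hasDerivWithin_le (f := h1) (f' := h2) (C := C)
    (s := Set.univ) (x := 0) (y := y) (fun x _ => (hd2 x).hasDerivWithinAt) (fun x _ => hC x)
    convex_univ trivial trivial
  rw [sub_zero, Real.norm_eq_abs, Real.norm_eq_abs] at this
  have h3 := abs_sub_abs_le_abs_sub (h1 y) (h1 0)
  linarith

lemma growth0 (h h1 h2 : ℝ → ℝ) (C : ℝ) (hd1 : ∀ x, HasDerivAt h (h1 x) x)
    (hd2 : ∀ x, HasDerivAt h1 (h2 x) x) (hC : ∀ x, |h2 x| ≤ C)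
    (y : ℝ) : |h y| ≤ |h 0| + (|h1 0| + C * |y|) * |y| := by
  have hC0 : 0 ≤ C := (abs_nonneg _).trans (hC 0)
  have := Convex.norm_image_sub_le_of_norm_hasDerivWithin_le (f := h) (f' := h1) (C := |h1 0| + C * |y|)
    (s := Set.Icc (-|y|) |y|) (x := 0) (y := y) (fun x _ => (hd1 x).hasDerivWithinAt) (fun x hx => by
      rw [Real.norm_eq_abs]
      refine (growth1 h1 h2 C hd2 hC x).trans ?_
      have : |x| ≤ |y| := abs_le.2 hx
      gcongr)
    (convex_Icc _ _) (by simp) ⟨neg_abs_le y, le_abs_self y⟩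
  rw [sub_zero, Real.norm_eq_abs, Real.norm_eq_abs] at this
  have h3 := abs_sub_abs_le_abs_sub (h y) (h 0)
  linarith

section
variable {Ω : Type*} [MeasurableSpace Ω] {P : Measure Ω} [IsProbabilityMeasure P]

lemma AllLp.of_bound {f g : Ω → ℝ} (hg : AllLp P g) (hf : AEStronglyMeasurable f P)
    (hb : ∀ ω, |f ω| ≤ |g ω|) : AllLp P f := fun p =>
  (hg p).mono hf (ae_of_all _ hb)

lemma AllLp.abs {f : Ω → ℝ} (hf : AllLp P f) : AllLp P (fun ω => |f ω|) := fun p => (hf p).abs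

lemma AllLp.aesm {f : Ω → ℝ} (hf : AllLp P f) : AEStronglyMeasurable f P :=
  (hf 1).aestronglyMeasurable

lemma AllLp.growth1 {f : Ω → ℝ} (hf : AllLp P f) (h1 h2 : ℝ → ℝ) (C : ℝ) (hd2 : ∀ x, HasDerivAt h1 (h2 x) x)
    (hC : ∀ x, |h2 x| ≤ C) : AllLp P (fun ω => h1 (f ω)) := by
  have hc : Continuous h1 := continuous_iff_continuousAt.2 fun x => (hd2 x).continuousAt
  refine AllLp.of_bound (g := fun ω => |h1 0| + C * |f ω|)
    ((AllLp.const _).add ((AllLp.const C).mul hf.abs))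
    (hc.comp_aestronglyMeasurable hf.aesm) fun ω => ?_
  exact (HermSub.growth1 h1 h2 C hd2 hC _).trans (le_abs_self _)

lemma AllLp.growth0 {f : Ω → ℝ} (hf : AllLp P f) (h h1 h2 : ℝ → ℝ) (C : ℝ)
    (hd1 : ∀ x, HasDerivAt h (h1 x) x) (hd2 : ∀ x, HasDerivAt h1 (h2 x) x)
    (hC : ∀ x, |h2 x| ≤ C) : AllLp P (fun ω => h (f ω)) := by
  have hc : Continuous h := continuous_iff_continuousAt.2 fun x => (hd1 x).continuousAt
  refine AllLp.of_bound (g := fun ω => |h 0| + (|h1 0| + C * |f ω|) * |f ω|)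
    ((AllLp.const _).add (((AllLp.const _).add ((AllLp.const C).mul hf.abs)).mul hf.abs))
    (hc.comp_aestronglyMeasurable hf.aesm) fun ω => ?_
  exact (HermSub.growth0 h h1 h2 C hd1 hd2 hC _).trans (le_abs_self _)

lemma AllLp.bdd {f : Ω → ℝ} (hf : AllLp P f) (h2 : ℝ → ℝ) (C : ℝ) (hc : Continuous h2)
    (hC : ∀ x, |h2 x| ≤ C) : AllLp P (fun ω => h2 (f ω)) :=
  AllLp.of_bound (AllLp.const C) (hc.comp_aestronglyMeasurable hf.aesm)
    fun ω => (hC _).trans (le_abs_self _)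

lemma interp (S Γ : Ω → ℝ) (hS : AllLp P S) (hΓ : AllLp P Γ)
    (hIBP : ∀ (φ φ' : ℝ → ℝ) (C : ℝ), (∀ x, HasDerivAt φ (φ' x) x) → Continuous φ' →
      (∀ x, |φ' x| ≤ C) → ∫ ω, S ω * φ (S ω) ∂P = ∫ ω, φ' (S ω) * Γ ω ∂P)
    (h h1 h2 : ℝ → ℝ) (C : ℝ) (hd1 : ∀ x, HasDerivAt h (h1 x) x)
    (hd2 : ∀ x, HasDerivAt h1 (h2 x) x) (hc2 : Continuous h2) (hC : ∀ x, |h2 x| ≤ C) (v : ℝ≥0) :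
    |∫ ω, h (S ω) ∂P - ∫ x, h x ∂(gaussianReal 0 v)| ≤ C / 2 * ∫ ω, |Γ ω - v| ∂P := by
  have hC0 : 0 ≤ C := (abs_nonneg _).trans (hC 0)
  set γ := gaussianReal 0 1 with hγ
  set μ := P.prod γ with hμ
  set s : ℝ := Real.sqrt v with hs
  have hsv : s * s = v := Real.mul_self_sqrt v.2
  have hS' : AllLp μ (fun z => S z.1) := fun p => (hS p).comp_fst γ
  have hΓ' : AllLp μ (fun z => Γ z.1) := fun p => (hΓ p).comp_fst γ
  have hz : AllLp γ (fun z : ℝ => z) := fun p => memLp_id_gaussianReal' p (by simp)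
  have hz' : AllLp μ (fun z => z.2) := fun p => (hz p).comp_snd P
  have hL : ∀ u, AllLp μ (fun z => Real.cos u * S z.1 + Real.sin u * (s * z.2)) := fun u =>
    ((AllLp.const _).mul hS').add ((AllLp.const _).mul ((AllLp.const _).mul hz'))
  have hL' : ∀ u, AllLp μ (fun z => -Real.sin u * S z.1 + Real.cos u * (s * z.2)) := fun u =>
    ((AllLp.const _).mul hS').add ((AllLp.const _).mul ((AllLp.const _).mul hz'))
  set Φ : ℝ → ℝ := fun u => ∫ z, h (Real.cos u * S z.1 + Real.sin u * (s * z.2)) ∂μ with hΦ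
  have hΦ0 : Φ 0 = ∫ ω, h (S ω) ∂P := by
    simp only [hΦ, Real.cos_zero, Real.sin_zero, one_mul, zero_mul, add_zero]
    rw [hμ, integral_fun_fst (fun ω => h (S ω))]
    simp
  have hΦ1 : Φ (Real.pi/2) = ∫ x, h x ∂(gaussianReal 0 v) := by
    simp only [hΦ, Real.cos_pi_div_two, Real.sin_pi_div_two, one_mul, zero_mul, zero_add]
    rw [hμ, integral_fun_snd (fun z => h (s * z))]
    have hmap : gaussianReal 0 v = γ.map (s * ·) := by
      rw [hγ, gaussianReal_map_const_mul, mul_zero, mul_one]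
      congr 1
      ext
      show (v : ℝ) = s ^ 2
      rw [sq, hsv]
    rw [hmap, integral_map (by fun_prop)]
    · simp
    · exact (continuous_iff_continuousAt.2 fun x => (hd1 x).continuousAt).aestronglyMeasurable
  have hDΦ : ∀ u, HasDerivAt Φ (∫ z, h1 (Real.cos u * S z.1 + Real.sin u * (s * z.2)) *
      (-Real.sin u * S z.1 + Real.cos u * (s * z.2)) ∂μ) u := by
    intro u
    have hM : AllLp μ (fun z => |S z.1| + |s * z.2|) := hS'.abs.add ((AllLp.const s).mul hz').abs
    refine (hasDerivAt_integral_of_dominated_loc_of_deriv_le (s := Set.univ)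
      (F := fun (u : ℝ) (z : Ω × ℝ) => h (Real.cos u * S z.1 + Real.sin u * (s * z.2)))
      (F' := fun (u : ℝ) (z : Ω × ℝ) => h1 (Real.cos u * S z.1 + Real.sin u * (s * z.2)) *
        (-Real.sin u * S z.1 + Real.cos u * (s * z.2)))
      (bound := fun (z : Ω × ℝ) => (|h1 0| + C * (|S z.1| + |s * z.2|)) * (|S z.1| + |s * z.2|))
      univ_mem ?_ ?_ ?_ ?_ ?_ ?_).2
    · exact Eventually.of_forall fun u => ((hL u).growth0 h h1 h2 C hd1 hd2 hC).aesm
    · exact ((hL u).growth0 h h1 h2 C hd1 hd2 hC).int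
    · exact (((hL u).growth1 h1 h2 C hd2 hC).mul (hL' u)).aesm
    · refine ae_of_all _ fun z u _ => ?_
      have b1 : ∀ a b : ℝ, |a| ≤ 1 → |b| ≤ 1 → |a * S z.1 + b * (s * z.2)| ≤ |S z.1| + |s * z.2| := by
        intro a b ha hb
        refine (abs_add_le _ _).trans ?_
        rw [abs_mul, abs_mul b]
        have := mul_le_mul_of_nonneg_right ha (abs_nonneg (S z.1))
        have := mul_le_mul_of_nonneg_right hb (abs_nonneg (s * z.2))
        linarith
      rw [norm_mul, Real.norm_eq_abs, Real.norm_eq_abs]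
      have c1 := b1 (Real.cos u) (Real.sin u) (Real.abs_cos_le_one u) (Real.abs_sin_le_one u)
      have c2 := b1 (-Real.sin u) (Real.cos u) (by rw [abs_neg]; exact Real.abs_sin_le_one u) (Real.abs_cos_le_one u)
      have c3 := HermSub.growth1 h1 h2 C hd2 hC (Real.cos u * S z.1 + Real.sin u * (s * z.2))
      have c4 : |h1 (Real.cos u * S z.1 + Real.sin u * (s * z.2))| ≤ |h1 0| + C * (|S z.1| + |s * z.2|) :=
        c3.trans (by gcongr)
      gcongr
    · exact (((AllLp.const _).add ((AllLp.const C).mul hM)).mul hM).int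
    · refine ae_of_all _ fun z u _ => ?_
      have d1 : HasDerivAt (fun u => Real.cos u * S z.1 + Real.sin u * (s * z.2))
          (-Real.sin u * S z.1 + Real.cos u * (s * z.2)) u :=
        ((Real.hasDerivAt_cos u).mul_const _).add ((Real.hasDerivAt_sin u).mul_const _)
      exact (hd1 _).comp u d1
  have hval : ∀ u, ∫ z, h1 (Real.cos u * S z.1 + Real.sin u * (s * z.2)) *
      (-Real.sin u * S z.1 + Real.cos u * (s * z.2)) ∂μ =
      - (Real.sin u * Real.cos u) * ∫ z, h2 (Real.cos u * S z.1 + Real.sin u * (s * z.2)) * (Γ z.1 - v) ∂μ := by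
    intro u
    set c := Real.cos u
    set d := Real.sin u
    have i1 : AllLp μ (fun z => h1 (c * S z.1 + d * (s * z.2))) := (hL u).growth1 h1 h2 C hd2 hC
    have i2 : AllLp μ (fun z => h2 (c * S z.1 + d * (s * z.2))) := (hL u).bdd h2 C hc2 hC
    have hA : ∫ z, S z.1 * h1 (c * S z.1 + d * (s * z.2)) ∂μ =
        ∫ z, c * (h2 (c * S z.1 + d * (s * z.2)) * Γ z.1) ∂μ := by
      rw [hμ, integral_prod_symm _ (hS'.mul i1).int, integral_prod_symm _ ((AllLp.const c).mul (i2.mul hΓ')).int]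
      congr 1
      ext y
      have := hIBP (fun x => h1 (c * x + d * (s * y))) (fun x => c * h2 (c * x + d * (s * y))) (|c| * C)
        (fun x => by
          have e : HasDerivAt (fun x => c * x + d * (s * y)) c x := by
            simpa using ((hasDerivAt_id x).const_mul c).add_const (d * (s * y))
          have := (hd2 (c * x + d * (s * y))).comp x e
          exact this.congr_deriv (mul_comm _ _))
        (by fun_prop) (fun x => by rw [abs_mul]; gcongr; exact hC _)
      simp only at this ⊢
      rw [this]
      congr 1; ext ω; ring
    have hB : ∫ z, z.2 * h1 (c * S z.1 + d * (s * z.2)) ∂μ =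
        ∫ z, (d * s) * h2 (c * S z.1 + d * (s * z.2)) ∂μ := by
      have j0 := (hz'.mul i1).int
      have j1 := ((AllLp.const (d*s)).mul i2).int
      rw [hμ, integral_prod _ j0, integral_prod _ j1]
      apply integral_congr_ae
      filter_upwards [j0.prod_right_ae, j1.prod_right_ae, i1.int.prod_right_ae] with ω a0 a1 a2
      refine ibp1 (fun x => h1 (c * S ω + d * (s * x))) (fun x => (d * s) * h2 (c * S ω + d * (s * x)))
        (fun x => ?_) a2 a0 a1
      have e : HasDerivAt (fun x => c * S ω + d * (s * x)) (d * s) x := by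
        simpa using (((hasDerivAt_id x).const_mul s).const_mul d).const_add (c * S ω)
      have := (hd2 (c * S ω + d * (s * x))).comp x e
      exact this.congr_deriv (mul_comm _ _)
    have e1 : ∀ z : Ω × ℝ, h1 (c * S z.1 + d * (s * z.2)) * (-d * S z.1 + c * (s * z.2)) =
        (-d) * (S z.1 * h1 (c * S z.1 + d * (s * z.2))) + (c * s) * (z.2 * h1 (c * S z.1 + d * (s * z.2))) := by
      intro z; ring
    have e2 : ∀ z : Ω × ℝ, h2 (c * S z.1 + d * (s * z.2)) * (Γ z.1 - v) =
        h2 (c * S z.1 + d * (s * z.2)) * Γ z.1 - v * h2 (c * S z.1 + d * (s * z.2)) := by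
      intro z; ring
    simp only [e1, e2]
    rw [integral_add ((AllLp.const _).mul (hS'.mul i1)).int ((AllLp.const _).mul (hz'.mul i1)).int,
      integral_sub (i2.mul hΓ').int ((AllLp.const _).mul i2).int,
      integral_const_mul, integral_const_mul, integral_const_mul, hA, hB, integral_const_mul, integral_const_mul,
      ← hsv]
    ring
  set K := ∫ ω, |Γ ω - v| ∂P with hK
  have hbd : ∀ u, |∫ z, h2 (Real.cos u * S z.1 + Real.sin u * (s * z.2)) * (Γ z.1 - v) ∂μ| ≤ C * K := by
    intro u
    have i2 : AllLp μ (fun z => h2 (Real.cos u * S z.1 + Real.sin u * (s * z.2))) := (hL u).bdd h2 C hc2 hC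
    have i3 : AllLp μ (fun z => Γ z.1 - v) := by
      simpa [sub_eq_add_neg] using hΓ'.add (AllLp.const (-(v:ℝ)))
    refine (abs_integral_le_integral_abs).trans ?_
    have e : K = ∫ z, |Γ z.1 - v| ∂μ := by
      rw [hμ, integral_fun_fst (fun ω => |Γ ω - v|)]; simp [hK]
    rw [e, ← integral_const_mul]
    refine integral_mono (i2.mul i3).abs.int ((AllLp.const C).mul i3.abs).int fun z => ?_
    simp only [abs_mul]
    gcongr
    exact hC _
  have main := image_norm_le_of_norm_deriv_right_le_deriv_boundary (f := fun u => Φ u - Φ 0)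
    (a := 0) (b := Real.pi / 2) (f' := fun u => ∫ z, h1 (Real.cos u * S z.1 + Real.sin u * (s * z.2)) *
      (-Real.sin u * S z.1 + Real.cos u * (s * z.2)) ∂μ)
    (B := fun u => C / 2 * K * (Real.sin u) ^ 2) (B' := fun u => C * K * (Real.sin u * Real.cos u))
    (fun u _ => ((hDΦ u).sub_const _).continuousAt.continuousWithinAt)
    (fun u _ => ((hDΦ u).sub_const _).hasDerivWithinAt) (by simp)
    (fun u => by
      have := ((Real.hasDerivAt_sin u).pow 2).const_mul (C / 2 * K)
      refine this.congr_deriv ?_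
      simp; ring)
    (fun u hu => by
      have hs0 : 0 ≤ Real.sin u := Real.sin_nonneg_of_nonneg_of_le_pi hu.1 (by linarith [hu.2, Real.pi_pos])
      have hc0 : 0 ≤ Real.cos u := Real.cos_nonneg_of_neg_pi_div_two_le_of_le (by linarith [hu.1, Real.pi_pos]) hu.2.le
      rw [hval, norm_mul, norm_neg, Real.norm_eq_abs, abs_of_nonneg (mul_nonneg hs0 hc0), mul_comm (C * K)]
      exact mul_le_mul_of_nonneg_left (hbd u) (mul_nonneg hs0 hc0))
    (x := Real.pi/2) ⟨by positivity, le_rfl⟩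
  simp only [Real.sin_pi_div_two, one_pow, mul_one, Real.norm_eq_abs] at main
  rw [hΦ1, hΦ0, abs_sub_comm] at main
  exact main

end
end HermSub

namespace HermSub

lemma young (a b : ℝ) (ha : 0 ≤ a) (hb : 0 ≤ b) (l p q : ℕ) (hq : l + p = q) (h0 : 1 ≤ q) :
    a ^ l * b ^ p ≤ (l / q : ℝ) * a ^ q + (p / q : ℝ) * b ^ q := by
  have hq0 : (q : ℝ) ≠ 0 := by positivity
  have hs : (l / q : ℝ) + (p / q : ℝ) = 1 := by
    rw [← add_div, ← hq]; push_cast; rw [div_self]; rw [← hq] at hq0; exact_mod_cast hq0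
  have := Real.geom_mean_le_arith_mean2_weighted (w₁ := (l / q : ℝ)) (w₂ := (p / q : ℝ))
    (p₁ := a ^ q) (p₂ := b ^ q) (by positivity) (by positivity) (by positivity) (by positivity) hs
  have e : ∀ (x : ℝ) (m : ℕ), 0 ≤ x → (x ^ q) ^ (m / q : ℝ) = x ^ m := by
    intro x m hx
    rw [← Real.rpow_natCast x q, ← Real.rpow_mul hx, mul_div_cancel₀ _ hq0, Real.rpow_natCast]
  rwa [e a l ha, e b p hb] at this

/-- sum over a translated window is bounded by the sum over the centred window -/
lemma sum_window (g : ℤ → ℝ) (hg : ∀ j, 0 ≤ g j) (n : ℕ) (m : ℤ) (hm : m ∈ Finset.Icc (1:ℤ) n) :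
    ∑ k ∈ Finset.Icc (1:ℤ) n, g (k - m) ≤ ∑ j ∈ Finset.Icc (-(n:ℤ)) n, g j := by
  have h := Finset.sum_image (s := Finset.Icc (1:ℤ) n) (f := g) (g := fun k => k - m)
    (by intro a _ b _ hab; simpa using hab)
  rw [← h]
  refine Finset.sum_le_sum_of_subset_of_nonneg ?_ fun j _ _ => hg j
  intro j hj
  simp only [Finset.mem_image, Finset.mem_Icc] at hj hm ⊢
  obtain ⟨k, hk, rfl⟩ := hj
  omega

lemma sum_window' (g : ℤ → ℝ) (hg : ∀ j, 0 ≤ g j) (hs : Summable g) (s : Finset ℤ) (m : ℤ) :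
    ∑ k ∈ s, g (k - m) ≤ ∑' j, g j := by
  have h := Finset.sum_image (s := s) (f := g) (g := fun k => k - m)
    (by intro a _ b _ hab; simpa using hab)
  rw [← h]
  exact hs.sum_le_tsum _ fun j _ => hg j

lemma toep (g : ℤ → ℝ) (n : ℕ) :
    ∑ k ∈ Finset.Icc (1:ℤ) n, ∑ m ∈ Finset.Icc (1:ℤ) n, g (m - k) =
      ∑ j ∈ Finset.Icc (-(n:ℤ)) n, ((n:ℝ) - |(j:ℝ)|) * g j := by
  rw [← Finset.sum_product']
  rw [← Finset.sum_fiberwise_of_maps_to (s := Finset.Icc (1:ℤ) n ×ˢ Finset.Icc (1:ℤ) n)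
    (t := Finset.Icc (-(n:ℤ)) n) (g := fun x => x.2 - x.1)]
  · refine Finset.sum_congr rfl fun j hj => ?_
    rw [Finset.sum_congr rfl (g := fun _ => g j)]
    · rw [Finset.sum_const, nsmul_eq_mul]
      congr 1
      have hc : (Finset.filter (fun x : ℤ × ℤ => x.2 - x.1 = j) (Finset.Icc (1:ℤ) n ×ˢ Finset.Icc (1:ℤ) n)).card
          = (Finset.Icc (max 1 (1 - j)) (min (n:ℤ) (n - j))).card := by
        refine Finset.card_bij (fun x _ => x.1) ?_ ?_ ?_
        · intro x hx
          simp only [Finset.mem_filter, Finset.mem_product, Finset.mem_Icc] at hx ⊢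
          omega
        · intro x hx y hy hxy
          simp only [Finset.mem_filter, Finset.mem_product, Finset.mem_Icc] at hx hy
          ext <;> omega
        · intro k hk
          simp only [Finset.mem_Icc] at hk
          refine ⟨(k, k + j), ?_, rfl⟩
          simp only [Finset.mem_filter, Finset.mem_product, Finset.mem_Icc]
          omega
      rw [hc, Int.card_Icc]
      simp only [Finset.mem_Icc] at hj
      have : ((min (n:ℤ) (n - j) + 1 - max 1 (1 - j)).toNat : ℤ) = n - |j| := by
        rcases abs_cases j with h | h <;> omega
      have h2 : (((min (n:ℤ) (n - j) + 1 - max 1 (1 - j)).toNat : ℤ) : ℝ) = ((n - |j| : ℤ) : ℝ) := by rw [this]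
      push_cast at h2
      exact_mod_cast h2
    · intro x hx
      simp only [Finset.mem_filter] at hx
      rw [hx.2]
  · intro x hx
    simp only [Finset.mem_product, Finset.mem_Icc] at hx ⊢
    omega

lemma var_diff (g : ℤ → ℝ) (hs : Summable fun j => |g j|) (n : ℕ) (hn : 1 ≤ n) :
    |(n:ℝ)⁻¹ * (∑ k ∈ Finset.Icc (1:ℤ) n, ∑ m ∈ Finset.Icc (1:ℤ) n, g (m - k)) - ∑' j, g j| ≤
      (∑ j ∈ Finset.Icc (-(n : ℤ)) n, |g j| * |(j : ℝ)| / n) +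
     ∑' j : {j : ℤ // (n : ℤ) < |j|}, |g (j : ℤ)| := by
  have hn0 : (n:ℝ) ≠ 0 := by positivity
  have hs' : Summable g := hs.of_abs
  have hset : {j : ℤ | (n:ℤ) < |j|} = {x | x ∉ Finset.Icc (-(n:ℤ)) n} := by
    ext j
    simp only [Set.mem_ofPred_eq, Finset.mem_Icc, ← abs_le, not_le]
  have ht : ∀ f : ℤ → ℝ, Summable f → ∑' j, f j = ∑ j ∈ Finset.Icc (-(n:ℤ)) n, f j +
      ∑' j : {j : ℤ // (n : ℤ) < |j|}, f j := by
    intro f hf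
    rw [← hf.sum_add_tsum_compl (s := Finset.Icc (-(n:ℤ)) n)]
    congr 1
    have : ((Finset.Icc (-(n:ℤ)) n : Finset ℤ) : Set ℤ)ᶜ = {j : ℤ | (n:ℤ) < |j|} := by
      rw [hset]; rfl
    rw [this]; rfl
  rw [toep, ht g hs', Finset.mul_sum, ← sub_sub, ← Finset.sum_sub_distrib]
  refine (abs_sub _ _).trans (add_le_add ?_ ?_)
  · refine (Finset.abs_sum_le_sum_abs _ _).trans (le_of_eq (Finset.sum_congr rfl fun j _ => ?_))
    have : (n:ℝ)⁻¹ * (((n:ℝ) - |(j:ℝ)|) * g j) - g j = - (g j * |(j:ℝ)| / n) := by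
      field_simp; ring
    rw [this, abs_neg, abs_div, abs_mul, abs_abs, Nat.abs_cast]
  · have hsub : Summable fun j : {j : ℤ // (n : ℤ) < |j|} => |g j| := hs.comp_injective Subtype.val_injective
    have := norm_tsum_le_tsum_norm (f := fun j : {j : ℤ // (n : ℤ) < |j|} => g j) hsub
    simpa using this

/-- The fourfold sum estimate. -/
lemma quad (r : ℤ → ℝ) (hsym : ∀ j, r (-j) = r j) (l p q : ℕ) (hq : l + p = q) (h0 : 1 ≤ q)
    (hs : Summable fun j : ℤ => |r j| ^ q) (n : ℕ) :
    ∑ k ∈ Finset.Icc (1:ℤ) n, ∑ m ∈ Finset.Icc (1:ℤ) n, ∑ i ∈ Finset.Icc (1:ℤ) n, ∑ j ∈ Finset.Icc (1:ℤ) n,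
      |r (m - k)| ^ l * |r (j - i)| ^ l * (|r (i - k)| ^ p * |r (j - m)| ^ p) ≤
    n * ((∑' j, |r j| ^ q) * (∑ j ∈ Finset.Icc (-(n : ℤ)) n, |r j| ^ l) *
      (∑ j ∈ Finset.Icc (-(n : ℤ)) n, |r j| ^ p)) := by
  set I := Finset.Icc (1:ℤ) n with hI
  set θ := ∑' j, |r j| ^ q with hθ
  set L := ∑ j ∈ Finset.Icc (-(n : ℤ)) n, |r j| ^ l with hL
  set Q := ∑ j ∈ Finset.Icc (-(n : ℤ)) n, |r j| ^ p with hQ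
  have hsy : ∀ a b : ℤ, r (a - b) = r (b - a) := fun a b => by rw [← hsym, neg_sub]
  have hL0 : 0 ≤ L := Finset.sum_nonneg fun _ _ => by positivity
  have hQ0 : 0 ≤ Q := Finset.sum_nonneg fun _ _ => by positivity
  have hθ0 : 0 ≤ θ := tsum_nonneg fun _ => by positivity
  have wL : ∀ m ∈ I, ∑ k ∈ I, |r (k - m)| ^ l ≤ L := fun m hm =>
    sum_window (fun j => |r j| ^ l) (fun _ => by positivity) n m hm
  have wQ : ∀ m ∈ I, ∑ k ∈ I, |r (k - m)| ^ p ≤ Q := fun m hm =>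
    sum_window (fun j => |r j| ^ p) (fun _ => by positivity) n m hm
  have wθ : ∀ m, ∑ k ∈ I, |r (k - m)| ^ q ≤ θ := fun m =>
    sum_window' (fun j => |r j| ^ q) (fun _ => by positivity) hs I m
  have hw : (l / q : ℝ) + (p / q : ℝ) = 1 := by
    have : (q:ℝ) ≠ 0 := by positivity
    rw [← add_div, ← hq]; push_cast; rw [div_self]; rw [← hq] at this; exact_mod_cast this
  -- bound for fixed `k`, summing over `m`, `i`, `j`
  have key : ∀ k ∈ I, ∑ m ∈ I, ∑ i ∈ I, ∑ j ∈ I,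
      |r (m - k)| ^ l * |r (j - i)| ^ l * (|r (i - k)| ^ p * |r (j - m)| ^ p) ≤ θ * L * Q := by
    intro k hk
    -- apply Young to `|r (m-k)|^l |r (j-m)|^p`
    have hY : ∀ m i j : ℤ, |r (m - k)| ^ l * |r (j - i)| ^ l * (|r (i - k)| ^ p * |r (j - m)| ^ p) ≤
        (l / q : ℝ) * (|r (m - k)| ^ q * (|r (i - k)| ^ p * |r (j - i)| ^ l)) +
        (p / q : ℝ) * (|r (m - j)| ^ q * (|r (i - k)| ^ p * |r (j - i)| ^ l)) := by
      intro m i j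
      have := young (|r (m - k)|) (|r (j - m)|) (abs_nonneg _) (abs_nonneg _) l p q hq h0
      rw [hsy m j]
      have h2 := mul_le_mul_of_nonneg_right this (show 0 ≤ |r (i - k)| ^ p * |r (j - i)| ^ l by positivity)
      nlinarith [h2]
    have s1 : ∀ f : ℤ → ℤ → ℝ, (∀ i j, 0 ≤ f i j) → (∀ i j, f i j ≤ θ) →
        ∑ i ∈ I, ∑ j ∈ I, f i j * (|r (i - k)| ^ p * |r (j - i)| ^ l) ≤ θ * L * Q := by
      intro f hf hf'
      calc ∑ i ∈ I, ∑ j ∈ I, f i j * (|r (i - k)| ^ p * |r (j - i)| ^ l)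
          ≤ ∑ i ∈ I, ∑ j ∈ I, θ * (|r (i - k)| ^ p * |r (j - i)| ^ l) := by
            gcongr with i hi j hj; exact hf' i j
        _ = ∑ i ∈ I, θ * |r (i - k)| ^ p * ∑ j ∈ I, |r (j - i)| ^ l := by
            refine Finset.sum_congr rfl fun i _ => ?_
            rw [Finset.mul_sum]; refine Finset.sum_congr rfl fun j _ => by ring
        _ ≤ ∑ i ∈ I, θ * |r (i - k)| ^ p * L := by
            gcongr with i hi; exact wL i hi
        _ = θ * L * ∑ i ∈ I, |r (i - k)| ^ p := by
            rw [Finset.mul_sum]; refine Finset.sum_congr rfl fun j _ => by ring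
        _ ≤ θ * L * Q := by gcongr; exact wQ k hk
    have re : ∀ g : ℤ → ℤ → ℝ, ∑ m ∈ I, ∑ i ∈ I, ∑ j ∈ I, |g m j| ^ q * (|r (i - k)| ^ p * |r (j - i)| ^ l) =
        ∑ i ∈ I, ∑ j ∈ I, (∑ m ∈ I, |g m j| ^ q) * (|r (i - k)| ^ p * |r (j - i)| ^ l) := by
      intro g
      rw [Finset.sum_comm]
      refine Finset.sum_congr rfl fun i _ => ?_
      rw [Finset.sum_comm]
      refine Finset.sum_congr rfl fun j _ => ?_
      rw [Finset.sum_mul]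
    calc _ ≤ ∑ m ∈ I, ∑ i ∈ I, ∑ j ∈ I, ((l / q : ℝ) * (|r (m - k)| ^ q * (|r (i - k)| ^ p * |r (j - i)| ^ l)) +
        (p / q : ℝ) * (|r (m - j)| ^ q * (|r (i - k)| ^ p * |r (j - i)| ^ l))) := by
          gcongr with m _ i _ j _; exact hY m i j
      _ = (l / q : ℝ) * (∑ i ∈ I, ∑ j ∈ I, (∑ m ∈ I, |r (m - k)| ^ q) * (|r (i - k)| ^ p * |r (j - i)| ^ l)) +
          (p / q : ℝ) * (∑ i ∈ I, ∑ j ∈ I, (∑ m ∈ I, |r (m - j)| ^ q) * (|r (i - k)| ^ p * |r (j - i)| ^ l)) := by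
          rw [← re (fun m _ => r (m - k)), ← re (fun m j => r (m - j))]
          simp only [Finset.mul_sum, Finset.sum_add_distrib]
      _ ≤ (l / q : ℝ) * (θ * L * Q) + (p / q : ℝ) * (θ * L * Q) := by
          gcongr
          · exact s1 (fun _ _ => ∑ m ∈ I, |r (m - k)| ^ q) (fun _ _ => Finset.sum_nonneg fun _ _ => by positivity) fun _ _ => wθ k
          · exact s1 (fun _ j => ∑ m ∈ I, |r (m - j)| ^ q) (fun _ _ => Finset.sum_nonneg fun _ _ => by positivity) fun _ j => wθ j
      _ = θ * L * Q := by rw [← add_mul, hw, one_mul]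
  calc _ ≤ ∑ k ∈ I, θ * L * Q := Finset.sum_le_sum key
    _ = _ := by rw [Finset.sum_const, hI, Int.card_Icc, nsmul_eq_mul]; simp

end HermSub

namespace HermSub

section
variable {Ω : Type*} [MeasurableSpace Ω] {P : Measure Ω} [IsProbabilityMeasure P]
  {X : ℤ → Ω → ℝ} {R : ℤ → ℤ → ℝ}

lemma GSeq.ibp_dl (h : GSeq P X R) (k : ℤ) (F S : MvPolynomial ℤ ℝ) (φ φ' : ℝ → ℝ) (C : ℝ)
    (hd : ∀ x, HasDerivAt φ (φ' x) x) (hc : Continuous φ') (hC : ∀ x, |φ' x| ≤ C) :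
    ∫ ω, MvPolynomial.eval (fun m => X m ω) (dl R k F) * φ (MvPolynomial.eval (fun m => X m ω) S) ∂P =
    ∫ ω, φ' (MvPolynomial.eval (fun m => X m ω) S) *
      MvPolynomial.eval (fun m => X m ω) (F * DD R k S) ∂P := by
  have hφc : Continuous φ := continuous_iff_continuousAt.2 fun x => (hd x).continuousAt
  have aS := allLp_eval h.allLp S
  have aF := allLp_eval h.allLp F
  have aDF := allLp_eval h.allLp (DD R k F)
  have aDS := allLp_eval h.allLp (DD R k S)
  have aφ := aS.growth1 φ φ' C hd hC
  have aφ' := aS.bdd φ' C hc hC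
  have key := h.ibp k
    (fun y => MvPolynomial.eval y F * φ (MvPolynomial.eval y S))
    (fun y => MvPolynomial.eval y (DD R k F) * φ (MvPolynomial.eval y S) +
      MvPolynomial.eval y F * (φ' (MvPolynomial.eval y S) * MvPolynomial.eval y (DD R k S)))
    ((meas_eval F).mul (hφc.measurable.comp (meas_eval S)))
    (((meas_eval _).mul (hφc.measurable.comp (meas_eval S))).add
      ((meas_eval F).mul ((hc.measurable.comp (meas_eval S)).mul (meas_eval _))))
    (fun y => by
      have e1 := eval_deriv (R := R) k F y
      have e2 := eval_deriv (R := R) k S y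
      have e3 := HasDerivAt.comp (0:ℝ) (hd (MvPolynomial.eval (y + (0:ℝ) • R k) S)) e2
      have := e1.mul e3
      refine this.congr_deriv ?_
      simp)
    (aF.mul aφ).int ((h.allLp k).mul (aF.mul aφ)).int
    ((aDF.mul aφ).add (aF.mul (aφ'.mul aDS))).int
  rw [integral_add (aDF.mul aφ).int (aF.mul (aφ'.mul aDS)).int] at key
  have e1 : ∀ ω, MvPolynomial.eval (fun m => X m ω) (dl R k F) * φ (MvPolynomial.eval (fun m => X m ω) S) =
      X k ω * (MvPolynomial.eval (fun m => X m ω) F * φ (MvPolynomial.eval (fun m => X m ω) S)) -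
      MvPolynomial.eval (fun m => X m ω) (DD R k F) * φ (MvPolynomial.eval (fun m => X m ω) S) := by
    intro ω
    simp only [dl, map_sub, map_mul, MvPolynomial.eval_X]; ring
  have e2 : ∀ ω, φ' (MvPolynomial.eval (fun m => X m ω) S) *
      MvPolynomial.eval (fun m => X m ω) (F * DD R k S) = MvPolynomial.eval (fun m => X m ω) F *
      (φ' (MvPolynomial.eval (fun m => X m ω) S) * MvPolynomial.eval (fun m => X m ω) (DD R k S)) := by
    intro ω
    simp only [map_mul]; ring
  simp only [e1, e2]
  rw [integral_sub ((h.allLp k).mul (aF.mul aφ)).int (aDF.mul aφ).int, key]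
  ring

end

/-- the polynomial of the normalized sum -/
noncomputable def SP (R : ℤ → ℤ → ℝ) (c : ℝ) (I : Finset ℤ) (q : ℕ) : MvPolynomial ℤ ℝ :=
  ∑ k ∈ I, MvPolynomial.C c * (dl R k)^[q+1] 1

/-- carré du champ polynomial -/
noncomputable def GP (R : ℤ → ℤ → ℝ) (c : ℝ) (I : Finset ℤ) (q : ℕ) : MvPolynomial ℤ ℝ :=
  ∑ k ∈ I, MvPolynomial.C c * ((dl R k)^[q] 1 * DD R k (SP R c I q))

noncomputable def VP (R : ℤ → ℤ → ℝ) (d : ℝ) (I : Finset ℤ) (l p : ℕ) : MvPolynomial ℤ ℝ :=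
  ∑ k ∈ I, ∑ m ∈ I, MvPolynomial.C (d * R k m ^ l) * WW R k m p p

lemma GP_eq (R : ℤ → ℤ → ℝ) (c d : ℝ) (hcd : c * c = d) (I : Finset ℤ) (q : ℕ) :
    GP R c I q = ∑ l ∈ Finset.range (q+1),
      MvPolynomial.C (((q+1 : ℕ) : ℝ) * ((l.factorial : ℝ) * q.choose l ^ 2)) * VP R d I (l+1) (q - l) := by
  have e1 : ∀ k, DD R k (SP R c I q) = ∑ m ∈ I, MvPolynomial.C (c * (((q+1 : ℕ) : ℝ) * R k m)) * (dl R m)^[q] 1 := by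
    intro k
    rw [SP, map_sum]
    refine Finset.sum_congr rfl fun m _ => ?_
    rw [MvPolynomial.C_mul', Derivation.map_smul, DD_W1, ← MvPolynomial.C_mul', ← mul_assoc, ← map_mul]
    simp
  have e2 : ∀ k m, MvPolynomial.C c * ((dl R k)^[q] 1 * (MvPolynomial.C (c * (((q+1 : ℕ) : ℝ) * R k m)) * (dl R m)^[q] 1)) =
      ∑ l ∈ Finset.range (q+1), MvPolynomial.C (((q+1 : ℕ) : ℝ) * ((l.factorial : ℝ) * q.choose l ^ 2)) *
        (MvPolynomial.C (d * R k m ^ (l+1)) * WW R k m (q-l) (q-l)) := by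
    intro k m
    have : MvPolynomial.C c * ((dl R k)^[q] 1 * (MvPolynomial.C (c * (((q+1 : ℕ) : ℝ) * R k m)) * (dl R m)^[q] 1)) =
      MvPolynomial.C (c * (c * (((q+1 : ℕ) : ℝ) * R k m))) * ((dl R k)^[q] 1 * (dl R m)^[q] 1) := by
      rw [MvPolynomial.C_mul (a := c) (a' := c * (((q+1 : ℕ) : ℝ) * R k m))]; ring
    rw [this, prod_formula, Finset.mul_sum]
    refine Finset.sum_congr rfl fun l _ => ?_
    have ac : ∀ (x y : ℝ) (F : MvPolynomial ℤ ℝ), MvPolynomial.C x * (MvPolynomial.C y * F) =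
        MvPolynomial.C (x * y) * F := by
      intro x y F
      rw [MvPolynomial.C_mul, mul_assoc]
    rw [ac, ac, ← hcd]
    congr 2
    ring
  simp only [GP, e1, Finset.mul_sum, e2, VP]
  rw [Finset.sum_congr rfl fun k _ => Finset.sum_comm, Finset.sum_comm]

lemma VP_top (R : ℤ → ℤ → ℝ) (d : ℝ) (I : Finset ℤ) (l : ℕ) :
    VP R d I l 0 = MvPolynomial.C (d * ∑ k ∈ I, ∑ m ∈ I, R k m ^ l) := by
  simp [VP, WW, Finset.mul_sum]

section
variable {Ω : Type*} [MeasurableSpace Ω] {P : Measure Ω} [IsProbabilityMeasure P]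
  {X : ℤ → Ω → ℝ} {R : ℤ → ℤ → ℝ}

lemma GSeq.ibpS (h : GSeq P X R) (c : ℝ) (I : Finset ℤ) (q : ℕ) (φ φ' : ℝ → ℝ) (C : ℝ)
    (hd : ∀ x, HasDerivAt φ (φ' x) x) (hc : Continuous φ') (hC : ∀ x, |φ' x| ≤ C) :
    ∫ ω, MvPolynomial.eval (fun m => X m ω) (SP R c I q) *
      φ (MvPolynomial.eval (fun m => X m ω) (SP R c I q)) ∂P =
    ∫ ω, φ' (MvPolynomial.eval (fun m => X m ω) (SP R c I q)) *
      MvPolynomial.eval (fun m => X m ω) (GP R c I q) ∂P := by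
  set S := SP R c I q with hS
  have aS := allLp_eval h.allLp S
  have aφ := aS.growth1 φ φ' C hd hC
  have aφ' := aS.bdd φ' C hc hC
  have e1 : ∀ ω, MvPolynomial.eval (fun m => X m ω) S * φ (MvPolynomial.eval (fun m => X m ω) S) =
      ∑ k ∈ I, c * (MvPolynomial.eval (fun m => X m ω) (dl R k ((dl R k)^[q] 1)) *
        φ (MvPolynomial.eval (fun m => X m ω) S)) := by
    intro ω
    rw [hS]
    nth_rewrite 1 [SP]
    rw [map_sum, Finset.sum_mul]
    refine Finset.sum_congr rfl fun k _ => ?_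
    rw [map_mul, MvPolynomial.eval_C, Function.iterate_succ_apply', mul_assoc]
  have e2 : ∀ ω, φ' (MvPolynomial.eval (fun m => X m ω) S) * MvPolynomial.eval (fun m => X m ω) (GP R c I q) =
      ∑ k ∈ I, c * (φ' (MvPolynomial.eval (fun m => X m ω) S) *
        MvPolynomial.eval (fun m => X m ω) ((dl R k)^[q] 1 * DD R k S)) := by
    intro ω
    rw [GP, map_sum, Finset.mul_sum]
    refine Finset.sum_congr rfl fun k _ => ?_
    rw [map_mul, MvPolynomial.eval_C]; ring
  simp only [e1, e2]
  rw [integral_finsetSum, integral_finsetSum]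
  · refine Finset.sum_congr rfl fun k _ => ?_
    rw [integral_const_mul, integral_const_mul, h.ibp_dl k _ S φ φ' C hd hc hC]
  · intro k _
    exact ((AllLp.const c).mul (aφ'.mul (allLp_eval h.allLp _))).int
  · intro k _
    exact ((AllLp.const c).mul ((allLp_eval h.allLp _).mul aφ)).int

lemma abs_le_sqrt {f : Ω → ℝ} (hf : AllLp P f) (B : ℝ) (hB : ∫ ω, f ω * f ω ∂P ≤ B) :
    ∫ ω, |f ω| ∂P ≤ Real.sqrt B := by
  apply Real.le_sqrt_of_sq_le
  refine le_trans ?_ hB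
  set M := ∫ ω, |f ω| ∂P with hM
  have h0 : 0 ≤ ∫ ω, (|f ω| - M) * (|f ω| - M) ∂P := integral_nonneg fun ω => mul_self_nonneg _
  have e : ∀ ω, (|f ω| - M) * (|f ω| - M) = f ω * f ω + ((-2 * M) * |f ω| + M * M) := by
    intro ω
    have := abs_mul_abs_self (f ω)
    linear_combination this
  simp only [e] at h0
  rw [integral_add (hf.mul hf).int (((AllLp.const _).mul hf.abs).add (AllLp.const _)).int,
    integral_add ((AllLp.const _).mul hf.abs).int (AllLp.const _).int, integral_const_mul] at h0
  simp at h0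
  nlinarith

lemma GSeq.V_bound (r : ℤ → ℝ) (hsym : ∀ j, r (-j) = r j) (h : GSeq P X (fun k m => r (m - k)))
    (l p q : ℕ) (hq : l + p = q) (h0 : 1 ≤ q)
    (hs : Summable fun j : ℤ => |r j| ^ q) (n : ℕ) (hn : 1 ≤ n) :
    ∫ ω, |MvPolynomial.eval (fun m => X m ω) (VP (fun k m => r (m - k)) (n:ℝ)⁻¹ (Finset.Icc (1:ℤ) n) l p)| ∂P ≤
      Real.sqrt ((2*p).factorial) * Real.sqrt (2 * (∑' j, |r j| ^ q) * (n:ℝ)⁻¹ *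
        (∑ j ∈ Finset.Icc (-(n : ℤ)) n, |r j| ^ l) * (∑ j ∈ Finset.Icc (-(n : ℤ)) n, |r j| ^ p)) := by
  set R : ℤ → ℤ → ℝ := fun k m => r (m - k) with hR
  set I := Finset.Icc (1:ℤ) n with hI
  set V := VP R (n:ℝ)⁻¹ I l p with hV
  set T := (∑' j, |r j| ^ q) * (∑ j ∈ Finset.Icc (-(n : ℤ)) n, |r j| ^ l) * (∑ j ∈ Finset.Icc (-(n : ℤ)) n, |r j| ^ p) with hT
  have hn0 : (n:ℝ) ≠ 0 := by positivity
  rw [← Real.sqrt_mul (by positivity)]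
  refine abs_le_sqrt (allLp_eval h.allLp V) _ ?_
  have e : ∫ ω, MvPolynomial.eval (fun m => X m ω) V * MvPolynomial.eval (fun m => X m ω) V ∂P = EE h.allLp (V * V) := by
    show _ = ∫ ω, _ ∂P
    simp only [map_mul]
  have hQ := quad r hsym l p q hq h0 hs n
  rw [← hI, ← hT] at hQ
  have hQ' : ∑ k ∈ I, ∑ m ∈ I, ∑ i ∈ I, ∑ j ∈ I,
      |r (m - k)| ^ l * |r (j - i)| ^ l * (|r (j - k)| ^ p * |r (i - m)| ^ p) ≤ n * T := by
    refine le_trans (le_of_eq ?_) hQ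
    refine Finset.sum_congr rfl fun k _ => Finset.sum_congr rfl fun m _ => ?_
    rw [Finset.sum_comm]
    refine Finset.sum_congr rfl fun j _ => Finset.sum_congr rfl fun i _ => ?_
    rw [← hsym (j - i), neg_sub]
  have e2 : EE h.allLp (V * V) = ∑ k ∈ I, ∑ m ∈ I, ∑ i ∈ I, ∑ j ∈ I,
      ((n:ℝ)⁻¹ * R k m ^ l) * ((n:ℝ)⁻¹ * R i j ^ l) * EE h.allLp (WW R k m p p * WW R i j p p) := by
    rw [hV, VP, Finset.sum_mul, map_sum]
    refine Finset.sum_congr rfl fun k _ => ?_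
    rw [Finset.sum_mul, map_sum]
    refine Finset.sum_congr rfl fun m _ => ?_
    rw [Finset.mul_sum, map_sum]
    refine Finset.sum_congr rfl fun i _ => ?_
    rw [Finset.mul_sum, map_sum]
    refine Finset.sum_congr rfl fun j _ => ?_
    rw [mul_mul_mul_comm, ← map_mul, E_C_mul]
  rw [e, e2]
  calc _ ≤ ∑ k ∈ I, ∑ m ∈ I, ∑ i ∈ I, ∑ j ∈ I, ((n:ℝ)⁻¹ * (n:ℝ)⁻¹ * (2*p).factorial) *
        (|r (m - k)| ^ l * |r (j - i)| ^ l * (|r (i - k)| ^ p * |r (j - m)| ^ p) +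
         |r (m - k)| ^ l * |r (j - i)| ^ l * (|r (j - k)| ^ p * |r (i - m)| ^ p)) := by
        refine Finset.sum_le_sum fun k _ => Finset.sum_le_sum fun m _ => Finset.sum_le_sum fun i _ =>
          Finset.sum_le_sum fun j _ => ?_
        refine (le_abs_self _).trans ?_
        have hb := E_WW_bound R (EE h.allLp) h.EE_X (EE_one h.allLp) k m i j p
        rw [abs_mul, abs_mul, abs_mul, abs_mul, abs_pow, abs_pow, abs_of_nonneg (show (0:ℝ) ≤ (n:ℝ)⁻¹ by positivity)]
        refine (mul_le_mul_of_nonneg_left hb (by positivity)).trans (le_of_eq ?_)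
        simp only [hR]
        ring
    _ = ((n:ℝ)⁻¹ * (n:ℝ)⁻¹ * (2*p).factorial) * (
        (∑ k ∈ I, ∑ m ∈ I, ∑ i ∈ I, ∑ j ∈ I, |r (m - k)| ^ l * |r (j - i)| ^ l * (|r (i - k)| ^ p * |r (j - m)| ^ p)) +
        (∑ k ∈ I, ∑ m ∈ I, ∑ i ∈ I, ∑ j ∈ I, |r (m - k)| ^ l * |r (j - i)| ^ l * (|r (j - k)| ^ p * |r (i - m)| ^ p))) := by
        simp only [← Finset.mul_sum, Finset.sum_add_distrib]
    _ ≤ ((n:ℝ)⁻¹ * (n:ℝ)⁻¹ * (2*p).factorial) * (n * T + n * T) := by gcongr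
    _ = _ := by rw [hT]; field_simp; ring

lemma GSeq.final (r : ℤ → ℝ) (hsym : ∀ j, r (-j) = r j) (h : GSeq P X (fun k m => r (m - k))) (hr0 : r 0 = 1)
    (q' q : ℕ) (hq : q = q' + 1)
    (hs : Summable fun j : ℤ => |r j| ^ q) (n : ℕ) (hn : 1 ≤ n) (c : ℝ) (hc : c * c = (n:ℝ)⁻¹) :
    ∫ ω, |MvPolynomial.eval (fun m => X m ω) (GP (fun k m => r (m - k)) c (Finset.Icc (1:ℤ) n) q') -
        (((q.factorial : ℝ) * ∑' j : ℤ, r j ^ q).toNNReal : ℝ)| ∂P ≤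
      (q.factorial : ℝ) * (∑' j, |r j| ^ q) *
    ((∑ j ∈ Finset.Icc (-(n : ℤ)) n, |r j| ^ q * |(j : ℝ)| / n) +
     ∑' j : {j : ℤ // (n : ℤ) < |j|}, |r (j : ℤ)| ^ q) +
     1 / (q : ℝ) * ∑ l ∈ Finset.Icc 1 (q - 1),
    (l : ℝ) * (l.factorial : ℝ) * (q.choose l : ℝ) ^ 2 *
      Real.sqrt ((2 * q - 2 * l).factorial) * Real.sqrt (2 * (∑' j, |r j| ^ q) * (n:ℝ)⁻¹ *
        (∑ j ∈ Finset.Icc (-(n : ℤ)) n, |r j| ^ l) * (∑ j ∈ Finset.Icc (-(n : ℤ)) n, |r j| ^ (q-l))) := by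
  set R : ℤ → ℤ → ℝ := fun k m => r (m - k) with hR
  set I := Finset.Icc (1:ℤ) n with hI
  set v : ℝ := (((q.factorial : ℝ) * ∑' j : ℤ, r j ^ q).toNNReal : ℝ) with hv
  set θ := ∑' j, |r j| ^ q with hθ
  set γ : ℕ → ℝ := fun l => Real.sqrt (2 * θ * (n:ℝ)⁻¹ *
        (∑ j ∈ Finset.Icc (-(n : ℤ)) n, |r j| ^ l) * (∑ j ∈ Finset.Icc (-(n : ℤ)) n, |r j| ^ (q-l))) with hγ
  set W := (n:ℝ)⁻¹ * ∑ k ∈ I, ∑ m ∈ I, R k m ^ q with hW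
  set d : ℕ → ℝ := fun l => ((q'+1 : ℕ) : ℝ) * ((l.factorial : ℝ) * q'.choose l ^ 2) with hd
  set V : ℕ → Ω → ℝ := fun l ω => MvPolynomial.eval (fun m => X m ω) (VP R (n:ℝ)⁻¹ I (l+1) (q' - l)) with hVdef
  have aV : ∀ l, AllLp P (V l) := fun l => allLp_eval h.allLp _
  have hG : ∀ ω, MvPolynomial.eval (fun m => X m ω) (GP R c I q') =
      ∑ l ∈ Finset.range q', d l * V l ω + (q.factorial : ℝ) * W := by
    intro ω
    rw [GP_eq R c _ hc, map_sum, Finset.sum_range_succ]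
    congr 1
    · refine Finset.sum_congr rfl fun l _ => ?_
      rw [map_mul, MvPolynomial.eval_C]
    · rw [Nat.sub_self, VP_top, map_mul, MvPolynomial.eval_C, MvPolynomial.eval_C, hW, hq,
        Nat.factorial_succ]
      simp only [Nat.choose_self]
      push_cast
      ring
  -- the variance is nonnegative
  have hWnn : 0 ≤ (q.factorial : ℝ) * W := by
    have e : EE h.allLp (SP R c I q' * SP R c I q') = (q.factorial : ℝ) * W := by
      rw [SP, Finset.sum_mul, map_sum, hW, Finset.mul_sum, Finset.mul_sum]
      refine Finset.sum_congr rfl fun k _ => ?_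
      rw [Finset.mul_sum, map_sum, Finset.mul_sum, Finset.mul_sum]
      refine Finset.sum_congr rfl fun m _ => ?_
      rw [mul_mul_mul_comm, ← map_mul, E_C_mul, ← hq, E_HH R (EE h.allLp) h.EE_X (EE_one h.allLp), hc]
      ring
    rw [← e]
    show 0 ≤ ∫ ω, _ ∂P
    simp only [map_mul]
    exact integral_nonneg fun ω => mul_self_nonneg _
  have hsabs : Summable fun j => |r j ^ q| := by simpa only [abs_pow] using hs
  have hθ1 : 1 ≤ θ := by
    have := hs.le_tsum 0 (fun j _ => by positivity)
    simpa [hr0] using this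
  set A := ((∑ j ∈ Finset.Icc (-(n : ℤ)) n, |r j| ^ q * |(j : ℝ)| / n) +
     ∑' j : {j : ℤ // (n : ℤ) < |j|}, |r (j : ℤ)| ^ q) with hA
  have hA0 : 0 ≤ A := add_nonneg (Finset.sum_nonneg fun _ _ => by positivity) (tsum_nonneg fun _ => by positivity)
  have hvar : |(q.factorial : ℝ) * W - v| ≤ q.factorial * θ * A := by
    have h1 : |(q.factorial : ℝ) * W - v| ≤ |(q.factorial : ℝ) * W - (q.factorial : ℝ) * ∑' j : ℤ, r j ^ q| := by
      rw [hv, Real.coe_toNNReal']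
      nth_rewrite 1 [← max_eq_left hWnn]
      exact abs_max_sub_max_le_abs _ _ _
    refine h1.trans ?_
    rw [← mul_sub, abs_mul, Nat.abs_cast]
    have h2 := var_diff (fun j => r j ^ q) hsabs n hn
    simp only [abs_pow] at h2
    have h3 : |W - ∑' j : ℤ, r j ^ q| ≤ A := h2
    calc (q.factorial:ℝ) * |W - ∑' j : ℤ, r j ^ q| ≤ q.factorial * (θ * A) := by
          gcongr
          nlinarith
      _ = _ := by ring
  have hVb : ∀ l ∈ Finset.range q', ∫ ω, |V l ω| ∂P ≤ Real.sqrt ((2 * (q' - l)).factorial) * γ (l+1) := by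
    intro l hl
    have hl' := Finset.mem_range.1 hl
    have := h.V_bound r hsym (l+1) (q'-l) q (by omega) (by omega) hs n hn
    have e : q - (l+1) = q' - l := by omega
    simp only [hγ, e]
    exact this
  have hd0 : ∀ l, 0 ≤ d l := fun l => by positivity
  have step : ∫ ω, |MvPolynomial.eval (fun m => X m ω) (GP R c I q') - v| ∂P ≤
      ∫ ω, (|(q.factorial : ℝ) * W - v| + ∑ l ∈ Finset.range q', d l * |V l ω|) ∂P := by
    have aG : AllLp P (fun ω => MvPolynomial.eval (fun m => X m ω) (GP R c I q') - v) := by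
      simpa [sub_eq_add_neg] using (allLp_eval h.allLp (GP R c I q')).add (AllLp.const (-v))
    refine integral_mono aG.abs.int ?_ fun ω => ?_
    · exact (integrable_const _).add (integrable_finsetSum _ fun l _ => ((AllLp.const (d l)).mul (aV l).abs).int)
    · simp only [hG]
      rw [add_sub_assoc, add_comm]
      refine (abs_add_le _ _).trans ?_
      gcongr
      refine (Finset.abs_sum_le_sum_abs _ _).trans (le_of_eq (Finset.sum_congr rfl fun l _ => ?_))
      rw [abs_mul, abs_of_nonneg (hd0 l)]
  refine step.trans ?_
  rw [integral_add (integrable_const _) (integrable_finsetSum _ fun l _ => ((AllLp.const (d l)).mul (aV l).abs).int),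
    integral_finsetSum _ fun l _ => ((AllLp.const (d l)).mul (aV l).abs).int]
  simp only [integral_const, probReal_univ, one_smul, integral_const_mul]
  refine add_le_add hvar ?_
  have hre : ∀ f : ℕ → ℝ, ∑ l ∈ Finset.Icc 1 (q-1), f l = ∑ l ∈ Finset.range q', f (l+1) := by
    intro f
    rw [Finset.range_eq_Ico, Finset.sum_Ico_add' f 0 q' 1]
    congr 1
    ext x
    simp only [Finset.mem_Icc, Finset.mem_Ico]
    omega
  rw [hre, Finset.mul_sum]
  refine Finset.sum_le_sum fun l hl => ?_
  refine (mul_le_mul_of_nonneg_left (hVb l hl) (hd0 l)).trans (le_of_eq ?_)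
  have hl' := Finset.mem_range.1 hl
  have e2 : 2 * q - 2 * (l+1) = 2 * (q' - l) := by omega
  rw [e2]
  have hch : ((q' + 1 : ℕ) : ℝ) * (q'.choose l : ℝ) = (q.choose (l+1) : ℝ) * ((l + 1 : ℕ) : ℝ) := by
    rw [hq]
    exact_mod_cast Nat.add_one_mul_choose_eq q' l
  have hq0 : ((q' + 1 : ℕ) : ℝ) ≠ 0 := by positivity
  have hdl : d l = 1 / (q:ℝ) * (((l+1 : ℕ) : ℝ) * ((l+1).factorial : ℝ) * (q.choose (l+1) : ℝ) ^ 2) := by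
    rw [Nat.factorial_succ]
    have : ((l+1 : ℕ) : ℝ) * (((l+1) * l.factorial : ℕ) : ℝ) * (q.choose (l+1) : ℝ) ^ 2 =
        l.factorial * (((q' + 1 : ℕ) : ℝ) * (q'.choose l : ℝ)) ^ 2 := by
      rw [hch]; push_cast; ring
    rw [this, hd, hq]
    simp only
    field_simp
  rw [hdl]
  ring

end

end HermSub

/-- Hermite subordination, bound for C² test functions with bounded second
derivative: |E[h(S_n)] - E[h(S)]| <= ||h''||_inf (A_{1,n} + A_{3,n}). -/
theorem stmt10
    {Ω : Type} [MeasureSpace Ω] [IsProbabilityMeasure (ℙ : Measure Ω)]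
    (X : ℤ → Ω → ℝ) (hXmeas : ∀ k, Measurable (X k))
    (hGauss : ∀ (s : Finset ℤ) (c : ℤ → ℝ), ∃ v : ℝ≥0,
      Measure.map (fun ω => ∑ k ∈ s, c k * X k ω) ℙ = gaussianReal 0 v)
    (r : ℤ → ℝ) (hr : ∀ k j : ℤ, ∫ ω, X k ω * X (k + j) ω = r j)
    (hr0 : r 0 = 1) (q : ℕ) (hq : 1 ≤ q)
    (hBM : Summable fun j : ℤ => |r j| ^ q)    :
    ∀ h : ℝ → ℝ, ContDiff ℝ 2 h → ∀ C : ℝ, (∀ x, |iteratedDeriv 2 h x| ≤ C) →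
    ∀ n : ℕ, 1 ≤ n →
      |(∫ ω, h (S1 q X n ω)) - ∫ x, h x ∂(gaussianReal 0 (sig1 q r).toNNReal)| ≤
        C * (A1one q r n + A3one q r n) := by
  intro h hh C hC n hn
  obtain ⟨q', hq'⟩ : ∃ q', q = q' + 1 := ⟨q - 1, by omega⟩
  have hC0 : 0 ≤ C := (abs_nonneg _).trans (hC 0)
  have hsym : ∀ j, r (-j) = r j := by
    intro j
    rw [← hr j (-j), ← hr 0 j]
    simp only [add_neg_cancel, zero_add, mul_comm]
  have hG : HermSub.GSeq (ℙ : Measure Ω) X (fun k m => r (m - k)) := by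
    refine ⟨hXmeas, HermSub.gaussProc X hXmeas hGauss, fun k => ?_, fun k m => ?_, fun k => ?_⟩
    · obtain ⟨v, hv⟩ := hGauss {k} (fun _ => 1)
      simp only [Finset.sum_singleton, one_mul] at hv
      have hv' : Measure.map (X k) ℙ = gaussianReal 0 v := hv
      have h2 : ∫ ω, X k ω * X k ω = 1 := by
        have := hr k 0
        rw [add_zero, hr0] at this
        exact this
      have h3 : ∫ x, x * x ∂(gaussianReal 0 v) = 1 := by
        rw [← hv', integral_map (hXmeas k).aemeasurable (by fun_prop)]
        exact h2
      have h4 := variance_fun_id_gaussianReal (μ := 0) (v := v)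
      rw [variance_eq_integral (by fun_prop)] at h4
      simp only [integral_id_gaussianReal, sub_zero, sq] at h4
      rw [h3] at h4
      have : v = 1 := by exact_mod_cast h4.symm
      rw [hv', this]
    · rw [← hr k (m - k)]
      simp
    · simpa using hr0
  set R : ℤ → ℤ → ℝ := fun k m => r (m - k) with hR
  set c : ℝ := (Real.sqrt n)⁻¹ with hc
  set I := Finset.Icc (1:ℤ) n with hI
  have hcc : c * c = (n:ℝ)⁻¹ := by
    rw [hc, ← mul_inv, Real.mul_self_sqrt (by positivity)]
  have hS : ∀ ω, S1 q X n ω = MvPolynomial.eval (fun m => X m ω) (HermSub.SP R c I q') := by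
    intro ω
    rw [S1, HermSub.SP, map_sum, Finset.mul_sum]
    refine Finset.sum_congr rfl fun k _ => ?_
    rw [map_mul, MvPolynomial.eval_C, ← HermSub.herm_eq R k (hG.diag k), Hev, ← hq']
    congr 1
    have := Polynomial.aeval_algHom_apply ((MvPolynomial.aeval (fun m => X m ω) : MvPolynomial ℤ ℝ →ₐ[ℝ] ℝ).restrictScalars ℤ)
      (MvPolynomial.X k) (Polynomial.hermite q)
    simpa [MvPolynomial.aeval_eq_eval] using this
  have hh1 : Differentiable ℝ h := hh.differentiable (by norm_num)
  have hh2 : Differentiable ℝ (deriv h) := by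
    have := hh.differentiable_iteratedDeriv 1 (by norm_num)
    rwa [iteratedDeriv_one] at this
  have e2 : iteratedDeriv 2 h = deriv (deriv h) := by
    rw [iteratedDeriv_succ, iteratedDeriv_one]
  have hc2 : Continuous (iteratedDeriv 2 h) := hh.continuous_iteratedDeriv 2 (by norm_num)
  have main := HermSub.interp (P := (ℙ : Measure Ω))
    (fun ω => MvPolynomial.eval (fun m => X m ω) (HermSub.SP R c I q'))
    (fun ω => MvPolynomial.eval (fun m => X m ω) (HermSub.GP R c I q'))
    (HermSub.allLp_eval hG.allLp _) (HermSub.allLp_eval hG.allLp _)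
    (fun φ φ' C h1 h2 h3 => hG.ibpS c I q' φ φ' C h1 h2 h3)
    h (deriv h) (iteratedDeriv 2 h) C (fun x => (hh1 x).hasDerivAt)
    (fun x => by rw [e2]; exact (hh2 x).hasDerivAt) hc2 hC (sig1 q r).toNNReal
  simp only [hS]
  refine main.trans ?_
  have fin := hG.final r hsym hr0 q' q hq' hBM n hn c hcc
  refine (mul_le_mul_of_nonneg_left fin (by positivity)).trans (le_of_eq ?_)
  rw [A1one, A3one]
  simp only [gamma1, theta1]
  have hq0 : (q:ℝ) ≠ 0 := by positivity
  field_simp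
end

section
/- Assume in addition σ > 0. For every Lipschitz function h : ℝ → ℝ with Lipschitz constant ‖h'‖_∞ and every n ≥ 1, one has |E[h(S_n)] − E[h(S)]| ≤ (2‖h'‖_∞/σ)(A_{1,n} + A_{3,n}), where S ~ N(0,σ²). -/
open MeasureTheory ProbabilityTheory Filter
open scoped BigOperators NNReal Topology

/-- Standardized Gaussian sequence with covariance `R`. -/
structure StdG {Ω : Type} [MeasurableSpace Ω] (P : Measure Ω) (X : ℤ → Ω → ℝ)
    (R : ℤ → ℤ → ℝ) : Prop where
  meas : ∀ k, Measurable (X k)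
  proc : IsGaussianProcess X P
  mean : ∀ k, ∫ ω, X k ω ∂P = 0
  cov : ∀ k j, ∫ ω, X k ω * X j ω ∂P = R k j
  var : ∀ k, R k k = 1

lemma gpdf_deriv (x : ℝ) :
    HasDerivAt (gaussianPDFReal 0 1) (-(x * gaussianPDFReal 0 1 x)) x := by
  have h1 : gaussianPDFReal 0 1 = fun x => (Real.sqrt (2 * Real.pi * (1:ℝ≥0)))⁻¹ *
      Real.exp (-(x - 0) ^ 2 / (2 * (1:ℝ≥0))) := by
    ext x; rw [gaussianPDFReal]
  rw [h1]
  have h2 : HasDerivAt (fun x : ℝ => -(x - 0) ^ 2 / (2 * ((1:ℝ≥0) : ℝ))) (-x) x := by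
    have := (((hasDerivAt_id x).sub_const 0).pow 2).neg.div_const (2 * ((1:ℝ≥0) : ℝ))
    refine (this.congr_deriv ?_)
    simp
    ring
  refine (h2.exp.const_mul _).congr_deriv ?_
  simp
  ring

lemma integrable_gauss_iff (g : ℝ → ℝ) :
    Integrable g (gaussianReal 0 1) ↔ Integrable (fun x => gaussianPDFReal 0 1 x * g x) := by
  rw [gaussianReal_of_var_ne_zero _ one_ne_zero]
  rw [integrable_withDensity_iff_integrable_smul₀' (measurable_gaussianPDF 0 1).aemeasurable
    (by simp [gaussianPDF_lt_top])]
  simp [toReal_gaussianPDF]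

lemma ibp1 (g g' : ℝ → ℝ) (hg : ∀ x, HasDerivAt g (g' x) x)
    (h1 : Integrable (fun x => x * g x) (gaussianReal 0 1))
    (h2 : Integrable g (gaussianReal 0 1)) (h3 : Integrable g' (gaussianReal 0 1)) :
    ∫ x, x * g x ∂(gaussianReal 0 1) = ∫ x, g' x ∂(gaussianReal 0 1) := by
  rw [integral_gaussianReal_eq_integral_smul one_ne_zero,
    integral_gaussianReal_eq_integral_smul one_ne_zero]
  rw [integrable_gauss_iff] at h1 h2 h3
  have := integral_mul_deriv_eq_deriv_mul_of_integrable (u := g) (u' := g')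
    (v := gaussianPDFReal 0 1) (v' := fun x => -(x * gaussianPDFReal 0 1 x))
    (fun x _ => hg x) (fun x _ => gpdf_deriv x)
    (by refine h1.neg.congr (ae_of_all _ fun x => ?_); simp; ring)
    (by refine h3.congr (ae_of_all _ fun x => ?_); simp; ring)
    (by refine h2.congr (ae_of_all _ fun x => ?_); simp; ring)
  have h4 : ∫ x, g' x * gaussianPDFReal 0 1 x = - ∫ x, g x * -(x * gaussianPDFReal 0 1 x) := by
    rw [this, neg_neg]
  rw [← integral_neg] at h4
  simp only [smul_eq_mul]
  convert h4.symm using 2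
  · ext; ring
  · ext; ring

lemma procOf {Ω : Type} [MeasurableSpace Ω] {P : Measure Ω} [IsProbabilityMeasure P]
    (X : ℤ → Ω → ℝ) (hXmeas : ∀ k, Measurable (X k))
    (hGauss : ∀ (s : Finset ℤ) (c : ℤ → ℝ), ∃ v : ℝ≥0,
      Measure.map (fun ω => ∑ k ∈ s, c k * X k ω) P = gaussianReal 0 v) :
    IsGaussianProcess X P := by
  classical
  refine ⟨fun I => ⟨isGaussian_of_map_eq_gaussianReal fun L => ?_⟩⟩
  obtain ⟨v, hv⟩ := hGauss I
    (fun k => if h : k ∈ I then L (Pi.single ⟨k, h⟩ 1) else 0)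
  refine ⟨0, v, ?_⟩
  have hm : Measurable (fun ω => I.restrict fun x => X x ω) :=
    measurable_pi_lambda _ fun i => hXmeas _
  rw [← hv, Measure.map_map (by fun_prop) hm]
  congr 1
  ext ω
  rw [← Finset.sum_coe_sort I]
  simp only [Function.comp]
  conv_lhs => rw [← Finset.univ_sum_single (I.restrict fun x => X x ω)]
  rw [map_sum]
  refine Finset.sum_congr rfl fun i _ => ?_
  have : Pi.single i (I.restrict (fun x => X x ω) i) = (X i ω) • (Pi.single i (1:ℝ) : I → ℝ) := by
    ext j
    by_cases h : j = i
    · subst h; simp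
    · simp [Pi.single_eq_of_ne h]
  rw [this, map_smul]
  simp [mul_comm]

lemma StdG.sumElim {Ω : Type} [MeasurableSpace Ω] {P : Measure Ω} {X : ℤ → Ω → ℝ}
    {R : ℤ → ℤ → ℝ} (hS : StdG P X R) (k : ℤ) {ι : Type} (e : ι → ℤ) :
    IsGaussianProcess (Sum.elim (fun (_ : Unit) => X k)
      (fun (i : ι) ω => X (e i) ω - R k (e i) * X k ω)) P := by
  classical
  refine hS.proc.of_isGaussianProcess fun s => ?_
  rcases s with s | i
  · refine ⟨{k}, ContinuousLinearMap.proj ⟨k, by simp⟩, ?_⟩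
    simp
  · refine ⟨{k, e i}, ContinuousLinearMap.proj ⟨e i, by simp⟩
      - R k (e i) • ContinuousLinearMap.proj ⟨k, by simp⟩, ?_⟩
    simp

lemma StdG.memLp {Ω : Type} [MeasurableSpace Ω] {P : Measure Ω} {X : ℤ → Ω → ℝ}
    {R : ℤ → ℤ → ℝ} (hS : StdG P X R) (k : ℤ) (p : ℝ≥0) : MemLp (X k) p P :=
  (hS.proc.hasGaussianLaw_eval k).memLp (by simp)

lemma StdG.law {Ω : Type} [MeasurableSpace Ω] {P : Measure Ω} [IsProbabilityMeasure P]
    {X : ℤ → Ω → ℝ}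
    {R : ℤ → ℤ → ℝ} (hS : StdG P X R) (k : ℤ) : P.map (X k) = gaussianReal 0 1 := by
  rw [(hS.proc.hasGaussianLaw_eval k).map_eq_gaussianReal, hS.mean]
  rw [variance_eq_integral (hS.meas k).aemeasurable, hS.mean]
  have := hS.cov k k
  rw [hS.var] at this
  simp only [sub_zero, pow_two, this]
  simp

lemma StdG.indep {Ω : Type} [MeasurableSpace Ω] {P : Measure Ω} [IsProbabilityMeasure P]
    {X : ℤ → Ω → ℝ}
    {R : ℤ → ℤ → ℝ} (hS : StdG P X R) (k : ℤ) {ι : Type} [Fintype ι] (e : ι → ℤ) :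
    IndepFun (X k) (fun ω (i : ι) => X (e i) ω - R k (e i) * X k ω) P := by
  have h2 : ∀ k, MemLp (X k) 2 P := fun k => by simpa using hS.memLp k 2
  have := (hS.sumElim k e).indepFun_of_covariance_eq_zero
    (fun _ => (hS.meas k).aemeasurable)
    (fun i => ((hS.meas _).sub ((hS.meas _).const_mul _)).aemeasurable) (by
      intro _ i
      have h4 : MemLp (fun ω => X (e i) ω - R k (e i) * X k ω) 2 P :=
        (h2 _).sub ((h2 k).const_mul _)
      rw [covariance_eq_sub (h2 k) h4]
      rw [hS.mean]
      have h3 : (X k * fun ω => X (e i) ω - R k (e i) * X k ω)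
        = fun ω => X k ω * X (e i) ω - R k (e i) * (X k ω * X k ω) := by
        ext ω; simp; ring
      have i1 : Integrable (fun ω => X k ω * X (e i) ω) P := (h2 k).integrable_mul (h2 _)
      have i2 : Integrable (fun ω => R k (e i) * (X k ω * X k ω)) P :=
        ((h2 k).integrable_mul (h2 k)).const_mul _
      rw [h3, integral_sub i1 i2, integral_const_mul, hS.cov, hS.cov, hS.var]
      simp)
  exact this.comp (φ := fun f : Unit → ℝ => f ()) (ψ := id) (measurable_pi_apply _) measurable_id

lemma StdG.ibp {Ω : Type} [MeasurableSpace Ω] {P : Measure Ω} [IsProbabilityMeasure P]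
    {X : ℤ → Ω → ℝ} {R : ℤ → ℤ → ℝ} (hS : StdG P X R) (k : ℤ)
    {ι : Type} [Fintype ι] (e : ι → ℤ) (G G' : (ι → ℝ) → ℝ) (hG : Measurable G)
    (hG' : Measurable G')
    (hd : ∀ v : ι → ℝ, HasDerivAt (fun t : ℝ => G (fun i => v i + t * R k (e i))) (G' v) 0)
    (h1 : Integrable (fun ω => X k ω * G (fun i => X (e i) ω)) P)
    (h2 : Integrable (fun ω => G (fun i => X (e i) ω)) P)
    (h3 : Integrable (fun ω => G' (fun i => X (e i) ω)) P) :
    ∫ ω, X k ω * G (fun i => X (e i) ω) ∂P = ∫ ω, G' (fun i => X (e i) ω) ∂P := by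
  set Y : Ω → ι → ℝ := fun ω i => X (e i) ω - R k (e i) * X k ω with hY
  have hYm : Measurable Y :=
    measurable_pi_lambda _ fun i => (hS.meas _).sub ((hS.meas _).const_mul _)
  have hind := hS.indep k e
  rw [indepFun_iff_map_prod_eq_prod_map_map (hS.meas k).aemeasurable hYm.aemeasurable,
    hS.law] at hind
  have hpm : Measurable (fun ω => (X k ω, Y ω)) := (hS.meas k).prodMk hYm
  have : IsProbabilityMeasure (P.map Y) := P.isProbabilityMeasure_map hYm.aemeasurable
  have hsh : Measurable (fun p : ℝ × (ι → ℝ) => (fun i => p.2 i + p.1 * R k (e i))) := by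
    fun_prop
  have key : ∀ ω, (fun i => X (e i) ω) = fun i => Y ω i + X k ω * R k (e i) := by
    intro ω; ext i; simp [hY]; ring
  simp only [key] at h1 h2 h3 ⊢
  have m1 : Measurable (fun p : ℝ × (ι → ℝ) => p.1 * G (fun i => p.2 i + p.1 * R k (e i))) :=
    measurable_fst.mul (hG.comp hsh)
  have m2 : Measurable (fun p : ℝ × (ι → ℝ) => G (fun i => p.2 i + p.1 * R k (e i))) :=
    (hG.comp hsh)
  have m3 : Measurable (fun p : ℝ × (ι → ℝ) => G' (fun i => p.2 i + p.1 * R k (e i))) :=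
    (hG'.comp hsh)
  have t1 := (integrable_map_measure m1.aestronglyMeasurable hpm.aemeasurable).2 h1
  have t2 := (integrable_map_measure m2.aestronglyMeasurable hpm.aemeasurable).2 h2
  have t3 := (integrable_map_measure m3.aestronglyMeasurable hpm.aemeasurable).2 h3
  have e1 := integral_map hpm.aemeasurable m1.aestronglyMeasurable (μ := P)
  have e3 := integral_map hpm.aemeasurable m3.aestronglyMeasurable (μ := P)
  rw [hind] at t1 t2 t3 e1 e3
  rw [← e1, ← e3, integral_prod_symm _ t1, integral_prod_symm _ t3]
  refine integral_congr_ae ?_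
  filter_upwards [t1.prod_left_ae, t2.prod_left_ae, t3.prod_left_ae] with y a1 a2 a3
  refine ibp1 _ _ (fun x => ?_) a1 a2 a3
  have := hd (fun i => y i + x * R k (e i))
  have h5 : HasDerivAt (fun t : ℝ => t - x) 1 x := (hasDerivAt_id x).sub_const x
  have h6 := HasDerivAt.comp x (h := fun t : ℝ => t - x) (by simpa using this) h5
  simp only [mul_one] at h6
  refine h6.congr_of_eventuallyEq (Eventually.of_forall fun t => ?_)
  change G _ = G _
  congr 1
  funext i
  simp only
  ring

/-- All moments finite. -/
def ML {Ω : Type} [MeasurableSpace Ω] (P : Measure Ω) (f : Ω → ℝ) : Prop :=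
  ∀ p : ℝ≥0, MemLp f p P

section ML
set_option linter.unusedSectionVars false
variable {Ω : Type} [MeasurableSpace Ω] {P : Measure Ω} [IsProbabilityMeasure P] {f g : Ω → ℝ}

lemma ML.add (hf : ML P f) (hg : ML P g) : ML P (fun ω => f ω + g ω) := fun p => (hf p).add (hg p)
lemma ML.sub (hf : ML P f) (hg : ML P g) : ML P (fun ω => f ω - g ω) := fun p => (hf p).sub (hg p)
lemma ML.const (c : ℝ) : ML P (fun _ => c) := fun _ => memLp_const c
lemma ML.mul (hf : ML P f) (hg : ML P g) : ML P (fun ω => f ω * g ω) := fun p => by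
  have : ENNReal.HolderTriple ((2 * p : ℝ≥0) : ENNReal) ((2 * p : ℝ≥0) : ENNReal) (p : ENNReal) := by
    constructor
    rcases eq_or_ne p 0 with h | h
    · subst h; simp
    · rw [← ENNReal.coe_inv (by positivity), ← ENNReal.coe_inv (by positivity)]
      norm_cast
      rw [mul_inv, ← add_mul]
      have : (2 : ℝ≥0)⁻¹ + 2⁻¹ = 1 := by
        rw [← NNReal.coe_inj]; norm_num
      rw [this, one_mul]
  exact (hg (2 * p)).mul (hf (2 * p))
lemma ML.const_mul (c : ℝ) (hf : ML P f) : ML P (fun ω => c * f ω) := (ML.const c).mul hf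
lemma ML.sum {ι : Type} (s : Finset ι) {F : ι → Ω → ℝ} (h : ∀ i ∈ s, ML P (F i)) :
    ML P (fun ω => ∑ i ∈ s, F i ω) := fun p => memLp_finsetSum s fun i hi => h i hi p
lemma ML.integrable (hf : ML P f) : Integrable f P := by
  exact memLp_one_iff_integrable.1 (by simpa using (hf 1))
lemma ML.bdd (C : ℝ) (hf : Measurable f) (h : ∀ ω, |f ω| ≤ C) : ML P f := fun _ =>
  MemLp.of_bound hf.aestronglyMeasurable C (ae_of_all _ h)
end ML

lemma Hev_zero (x : ℝ) : Hev 0 x = 1 := by simp [Hev]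

lemma herm_deriv (n : ℕ) : Polynomial.derivative (Polynomial.hermite n)
    = (n : Polynomial ℤ) * Polynomial.hermite (n - 1) := by
  induction n with
  | zero => simp
  | succ n ih =>
    rw [Polynomial.hermite_succ, Polynomial.derivative_sub, Polynomial.derivative_mul, ih,
      Polynomial.derivative_X, Polynomial.derivative_mul, Polynomial.derivative_natCast]
    cases n with
    | zero => simp
    | succ n =>
      simp only [Nat.add_sub_cancel]
      conv_rhs => rw [Polynomial.hermite_succ (n := n)]
      have := Polynomial.hermite_succ n
      rw [this]
      push_cast
      ring

lemma Hev_succ (n : ℕ) (x : ℝ) : Hev (n + 1) x = x * Hev n x - n * Hev (n - 1) x := by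
  simp [Hev, Polynomial.hermite_succ, herm_deriv]

lemma Hev_deriv (n : ℕ) (x : ℝ) : HasDerivAt (Hev n) (n * Hev (n - 1) x) x := by
  have := Polynomial.hasDerivAt_aeval (𝕜 := ℝ) (q := Polynomial.hermite n) x
  rw [herm_deriv] at this
  simpa [Hev] using! this

/-- Bivariate Hermite (Wick) polynomials with correlation `ρ`. -/
noncomputable def W (ρ x y : ℝ) : ℕ → ℕ → ℝ
  | 0 => fun b => Hev b y
  | 1 => fun b => x * W ρ x y 0 b - b * ρ * W ρ x y 0 (b - 1)
  | (a + 2) => fun b => x * W ρ x y (a + 1) b - (a + 1) * W ρ x y a b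
      - b * ρ * W ρ x y (a + 1) (b - 1)

lemma W_zero (ρ x y : ℝ) (b : ℕ) : W ρ x y 0 b = Hev b y := by simp [W]

lemma W_succ (ρ x y : ℝ) (a b : ℕ) : W ρ x y (a + 1) b =
    x * W ρ x y a b - a * W ρ x y (a - 1) b - b * ρ * W ρ x y a (b - 1) := by
  cases a with
  | zero => simp [W]
  | succ a => rw [W]; simp

lemma Hev_meas (n : ℕ) : Measurable (Hev n) := by
  have : Differentiable ℝ (Hev n) := fun x => (Hev_deriv n x).differentiableAt
  exact this.continuous.measurable

lemma W_meas {α : Type} [MeasurableSpace α] (ρ : ℝ) {u v : α → ℝ} (hu : Measurable u)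
    (hv : Measurable v) (a : ℕ) : ∀ b, Measurable (fun t => W ρ (u t) (v t) a b) := by
  induction a using Nat.strong_induction_on with
  | _ a ih =>
    intro b
    cases a with
    | zero => simp only [W_zero]; exact (Hev_meas b).comp hv
    | succ a =>
      simp only [W_succ]
      have h1 := ih a (by lia) b
      have h2 := ih (a - 1) (by lia) b
      have h3 := ih a (by lia) (b - 1)
      fun_prop

lemma ML_Hev {Ω : Type} [MeasurableSpace Ω] {P : Measure Ω} [IsProbabilityMeasure P]
    {v : Ω → ℝ} (hv : ML P v) (n : ℕ) : ML P (fun t => Hev n (v t)) := by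
  induction n using Nat.strong_induction_on with
  | _ n ih =>
    cases n with
    | zero => simp only [Hev_zero]; exact ML.const 1
    | succ n =>
      simp only [Hev_succ]
      exact (hv.mul (ih n (by lia))).sub ((ih (n - 1) (by lia)).const_mul _)

lemma ML_W {Ω : Type} [MeasurableSpace Ω] {P : Measure Ω} [IsProbabilityMeasure P]
    (ρ : ℝ) {u v : Ω → ℝ} (hu : ML P u)
    (hv : ML P v) (a : ℕ) : ∀ b, ML P (fun t => W ρ (u t) (v t) a b) := by
  induction a using Nat.strong_induction_on with
  | _ a ih =>
    intro b
    cases a with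
    | zero => simp only [W_zero]; exact ML_Hev hv b
    | succ a =>
      simp only [W_succ]
      have h1 := ih a (by lia) b
      have h2 := ih (a - 1) (by lia) b
      have h3 := ih a (by lia) (b - 1)
      exact ((hu.mul h1).sub (h2.const_mul _)).sub (h3.const_mul _)

lemma W_deriv (ρ : ℝ) {u v : ℝ → ℝ} {u' v' t : ℝ} (hu : HasDerivAt u u' t)
    (hv : HasDerivAt v v' t) (a : ℕ) : ∀ b, HasDerivAt (fun t => W ρ (u t) (v t) a b)
      (u' * a * W ρ (u t) (v t) (a - 1) b + v' * b * W ρ (u t) (v t) a (b - 1)) t := by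
  induction a using Nat.strong_induction_on with
  | _ a ih =>
    intro b
    cases a with
    | zero =>
      simp only [W_zero]
      refine ((Hev_deriv b (v t)).comp t hv).congr_deriv ?_
      simp; ring
    | succ a =>
      simp only [W_succ ρ _ _ a b]
      have h1 := ih a (by lia) b
      have h2 := ih (a - 1) (by lia) b
      have h3 := ih a (by lia) (b - 1)
      refine (((hu.mul h1).sub (h2.const_mul (a:ℝ))).sub (h3.const_mul ((b:ℝ) * ρ))).congr_deriv ?_
      rw [Nat.add_sub_cancel, W_succ ρ _ _ a (b-1)]
      have e1 : (a:ℝ) * W ρ (u t) (v t) a b = a * (u t * W ρ (u t) (v t) (a - 1) b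
          - ((a - 1 : ℕ):ℝ) * W ρ (u t) (v t) (a - 1 - 1) b
          - b * ρ * W ρ (u t) (v t) (a - 1) (b - 1)) := by
        cases a with
        | zero => simp
        | succ a => rw [W_succ ρ _ _ a b]; simp
      push_cast
      linear_combination (-u') * e1

section mom
set_option linter.unusedSectionVars false
variable {Ω : Type} [MeasurableSpace Ω] {P : Measure Ω} [IsProbabilityMeasure P]
    {X : ℤ → Ω → ℝ} {R : ℤ → ℤ → ℝ}

lemma StdG.ml (hS : StdG P X R) (k : ℤ) : ML P (X k) := fun p => hS.memLp k p

lemma StdG.mlW (hS : StdG P X R) (j k : ℤ) (a b : ℕ) :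
    ML P (fun ω => W (R j k) (X j ω) (X k ω) a b) := ML_W _ (hS.ml j) (hS.ml k) a b

lemma StdG.symm (hS : StdG P X R) (j k : ℤ) : R j k = R k j := by
  rw [← hS.cov, ← hS.cov]; simp [mul_comm]

/-- Moment of a pair of Wick polynomials. -/
noncomputable def mom (P : Measure Ω) (X : ℤ → Ω → ℝ) (R : ℤ → ℤ → ℝ) (j k j' k' : ℤ)
    (a b c d : ℕ) : ℝ :=
  ∫ ω, W (R j k) (X j ω) (X k ω) a b * W (R j' k') (X j' ω) (X k' ω) c d ∂P

lemma StdG.ibpW (hS : StdG P X R) (i j k j' k' : ℤ) (a b c d : ℕ) :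
    ∫ ω, X i ω * (W (R j k) (X j ω) (X k ω) a b * W (R j' k') (X j' ω) (X k' ω) c d) ∂P
    = R i j * a * mom P X R j k j' k' (a-1) b c d + R i k * b * mom P X R j k j' k' a (b-1) c d
    + R i j' * c * mom P X R j k j' k' a b (c-1) d
    + R i k' * d * mom P X R j k j' k' a b c (d-1) := by
  have I : ∀ a b c d, ML P (fun ω =>
      W (R j k) (X j ω) (X k ω) a b * W (R j' k') (X j' ω) (X k' ω) c d) :=
    fun a b c d => (hS.mlW j k a b).mul (hS.mlW j' k' c d)
  have J : ∀ a b c d (z : ℝ), Integrable (fun ω =>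
      z * (W (R j k) (X j ω) (X k ω) a b * W (R j' k') (X j' ω) (X k' ω) c d)) P :=
    fun a b c d z => ((I a b c d).const_mul z).integrable
  have M : ∀ a b c d, Measurable (fun v : Fin 4 → ℝ =>
      W (R j k) (v 0) (v 1) a b * W (R j' k') (v 2) (v 3) c d) := fun a b c d =>
    (W_meas _ (measurable_pi_apply _) (measurable_pi_apply _) _ _).mul
      (W_meas _ (measurable_pi_apply _) (measurable_pi_apply _) _ _)
  have key := hS.ibp i (e := ![j, k, j', k'])
    (fun v => W (R j k) (v 0) (v 1) a b * W (R j' k') (v 2) (v 3) c d)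
    (fun v => R i j * a * (W (R j k) (v 0) (v 1) (a-1) b * W (R j' k') (v 2) (v 3) c d)
      + R i k * b * (W (R j k) (v 0) (v 1) a (b-1) * W (R j' k') (v 2) (v 3) c d)
      + R i j' * c * (W (R j k) (v 0) (v 1) a b * W (R j' k') (v 2) (v 3) (c-1) d)
      + R i k' * d * (W (R j k) (v 0) (v 1) a b * W (R j' k') (v 2) (v 3) c (d-1)))
    (M a b c d)
    (by
      exact ((((M (a-1) b c d).const_mul _).add ((M a (b-1) c d).const_mul _)).add
        ((M a b (c-1) d).const_mul _)).add ((M a b c (d-1)).const_mul _))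
    (by
      intro v
      have l : ∀ (x z : ℝ), HasDerivAt (fun t : ℝ => x + t * z) z 0 := fun x z => by
        simpa using ((hasDerivAt_id (0:ℝ)).mul_const z).const_add x
      have := (W_deriv (R j k) (l (v 0) (R i j)) (l (v 1) (R i k)) a b).mul
        (W_deriv (R j' k') (l (v 2) (R i j')) (l (v 3) (R i k')) c d)
      refine this.congr_deriv ?_
      simp
      ring)
    (((hS.ml i).mul (I a b c d)).integrable)
    ((I a b c d).integrable)
    ((((J (a-1) b c d _).add (J a (b-1) c d _)).add (J a b (c-1) d _)).add (J a b c (d-1) _))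
  refine key.trans ?_
  simp only [mom, ← integral_const_mul]
  rw [← integral_add (J _ _ _ _ _) (J _ _ _ _ _), ← integral_add _ (J _ _ _ _ _),
    ← integral_add _ (J _ _ _ _ _)]
  · rfl
  · exact ((J _ _ _ _ _).add (J _ _ _ _ _)).add (J _ _ _ _ _)
  · exact ((J _ _ _ _ _).add (J _ _ _ _ _))

lemma StdG.momX (hS : StdG P X R) (j k j' k' : ℤ) (a b c d : ℕ) :
    mom P X R j k j' k' (a+1) b c d =
      R j j' * c * mom P X R j k j' k' a b (c-1) d + R j k' * d * mom P X R j k j' k' a b c (d-1) := by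
  have I : ∀ a b c d, ML P (fun ω =>
      W (R j k) (X j ω) (X k ω) a b * W (R j' k') (X j' ω) (X k' ω) c d) :=
    fun a b c d => (hS.mlW j k a b).mul (hS.mlW j' k' c d)
  have key := hS.ibpW j j k j' k' a b c d
  have : mom P X R j k j' k' (a+1) b c d =
      ∫ ω, X j ω * (W (R j k) (X j ω) (X k ω) a b * W (R j' k') (X j' ω) (X k' ω) c d) ∂P
      - a * mom P X R j k j' k' (a-1) b c d - b * R j k * mom P X R j k j' k' a (b-1) c d := by
    simp only [mom, ← integral_const_mul]
    rw [← integral_sub ((hS.ml j).mul (I a b c d)).integrable ((I _ _ _ _).const_mul _).integrable,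
      ← integral_sub (((hS.ml j).mul (I a b c d)).sub ((I _ _ _ _).const_mul _)).integrable
        ((I _ _ _ _).const_mul _).integrable]
    congr 1
    funext ω
    rw [W_succ]
    ring
  rw [this, key, hS.var]
  ring

lemma StdG.momY (hS : StdG P X R) (j k j' k' : ℤ) (b c d : ℕ) :
    mom P X R j k j' k' 0 (b+1) c d =
      R k j' * c * mom P X R j k j' k' 0 b (c-1) d + R k k' * d * mom P X R j k j' k' 0 b c (d-1) := by
  have I : ∀ a b c d, ML P (fun ω =>
      W (R j k) (X j ω) (X k ω) a b * W (R j' k') (X j' ω) (X k' ω) c d) :=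
    fun a b c d => (hS.mlW j k a b).mul (hS.mlW j' k' c d)
  have key := hS.ibpW k j k j' k' 0 b c d
  have : mom P X R j k j' k' 0 (b+1) c d =
      ∫ ω, X k ω * (W (R j k) (X j ω) (X k ω) 0 b * W (R j' k') (X j' ω) (X k' ω) c d) ∂P
      - b * mom P X R j k j' k' 0 (b-1) c d := by
    simp only [mom, ← integral_const_mul]
    rw [← integral_sub ((hS.ml k).mul (I 0 b c d)).integrable ((I _ _ _ _).const_mul _).integrable]
    congr 1
    funext ω
    simp only [W_zero, Hev_succ]
    ring
  rw [this, key, hS.var]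
  simp only [Nat.cast_zero]
  ring

lemma mom_swap (j k j' k' : ℤ) (a b c d : ℕ) :
    mom P X R j k j' k' a b c d = mom P X R j' k' j k c d a b := by
  simp [mom, mul_comm]

lemma StdG.mom0 (hS : StdG P X R) (j k j' k' : ℤ) (c d : ℕ) :
    mom P X R j k j' k' 0 0 c d = if c = 0 ∧ d = 0 then 1 else 0 := by
  rw [mom_swap]
  rcases c with _ | c
  · rcases d with _ | d
    · simp [mom, W_zero, Hev_zero]
    · rw [hS.momY]; simp
  · rw [hS.momX]; simp

open Polynomial in
/-- A linear polynomial. -/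
noncomputable def LL (x y : ℝ) : ℝ[X] :=
  C x * Polynomial.X + C y

open Polynomial in
lemma StdG.mom_eq (hS : StdG P X R) (j k j' k' : ℤ) (a b c d : ℕ) :
    mom P X R j k j' k' a b c d = if c + d = a + b then (c.factorial * d.factorial : ℝ) *
      (LL (R j j') (R j k') ^ a * LL (R k j') (R k k') ^ b : ℝ[X]).coeff c
      else 0 := by
  have deg1 : ∀ (x y : ℝ) (m : ℕ), (LL x y ^ m : ℝ[X]).natDegree ≤ m := fun x y m => by
    have := natDegree_pow_le_of_le m (natDegree_linear_le (a := x) (b := y))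
    simpa [LL] using this
  have deg : ∀ (a b n : ℕ), a + b < n → (LL (R j j') (R j k') ^ a *
      LL (R k j') (R k k') ^ b : ℝ[X]).coeff n = 0 := fun a b n h =>
    coeff_eq_zero_of_natDegree_lt
      (lt_of_le_of_lt (natDegree_mul_le_of_le (deg1 _ _ _) (deg1 _ _ _)) h)
  have step : ∀ (x y : ℝ) (a b c d : ℕ) (Q : ℝ[X]), (∀ n, a + b < n → Q.coeff n = 0) →
      x * c * (if (c - 1) + d = a + b then ((c-1).factorial * d.factorial : ℝ) * Q.coeff (c-1) else 0)
      + y * d * (if c + (d - 1) = a + b then (c.factorial * (d-1).factorial : ℝ) * Q.coeff c else 0)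
      = if c + d = a + b + 1 then (c.factorial * d.factorial : ℝ) * (LL x y * Q).coeff c
        else 0 := by
    intro x y a b c d Q hQ
    have e : (LL x y * Q) = C x * (Polynomial.X * Q) + C y * Q := by rw [LL]; ring
    rw [e, coeff_add, coeff_C_mul, coeff_C_mul]
    rcases c with _ | c
    · rcases d with _ | d
      · simp
      · simp only [Nat.factorial_succ, coeff_X_mul_zero]
        by_cases h : d = a + b
        · simp [h]; ring
        · simp [h]
    · rw [coeff_X_mul]
      rcases d with _ | d
      · by_cases h : c = a + b
        · simp [h, hQ, Nat.factorial_succ]; ring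
        · simp [h]
      · by_cases h : c + (d + 1) = a + b
        · have h1 : c + 1 + d = a + b := by lia
          have h2 : c + 1 + (d + 1) = a + b + 1 := by lia
          simp [h, h1, h2, Nat.factorial_succ]; ring
        · have h1 : ¬ c + 1 + d = a + b := by lia
          have h2 : ¬ c + 1 + (d + 1) = a + b + 1 := by lia
          simp [h, h1, h2]
  induction a generalizing c d with
  | zero =>
    induction b generalizing c d with
    | zero =>
      rw [hS.mom0]
      by_cases h : c = 0 ∧ d = 0
      · obtain ⟨rfl, rfl⟩ := h; simp
      · rw [if_neg h, if_neg (by lia)]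
    | succ b ih =>
      rw [hS.momY, ih, ih, step _ _ 0 b c d _ (fun n hn => deg 0 b n hn)]
      have : (LL (R k j') (R k k') * (LL (R j j') (R j k') ^ 0 *
        LL (R k j') (R k k') ^ b) : ℝ[X]) = LL (R j j') (R j k') ^ 0 *
        LL (R k j') (R k k') ^ (b + 1) := by ring
      rw [this, ← add_assoc]
  | succ a ih =>
    rw [hS.momX, ih, ih, step _ _ a b c d _ (fun n hn => deg a b n hn)]
    have : (LL (R j j') (R j k') * (LL (R j j') (R j k') ^ a *
      LL (R k j') (R k k') ^ b) : ℝ[X]) = LL (R j j') (R j k') ^ (a + 1) *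
      LL (R k j') (R k k') ^ b := by ring
    rw [this, add_right_comm a b 1]

end mom

lemma LL_coeff (x y : ℝ) (m i : ℕ) (hi : i ≤ m) :
    (LL x y ^ m).coeff i = x ^ i * y ^ (m - i) * (m.choose i : ℝ) := by
  rw [LL, add_pow, Polynomial.finsetSum_coeff, Finset.sum_eq_single i]
  · rw [mul_pow, ← Polynomial.C_pow, ← Polynomial.C_pow, ← Polynomial.C_eq_natCast]
    have : (Polynomial.C (x ^ i) * Polynomial.X ^ i * Polynomial.C (y ^ (m - i)) *
      Polynomial.C ((m.choose i : ℕ) : ℝ)) = Polynomial.C (x ^ i * y ^ (m - i) * (m.choose i : ℝ))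
        * Polynomial.X ^ i := by
      simp only [Polynomial.C_mul]; ring
    rw [this, Polynomial.coeff_C_mul, Polynomial.coeff_X_pow, if_pos rfl, mul_one]
  · intro b _ hb
    rw [mul_pow, ← Polynomial.C_pow, ← Polynomial.C_pow, ← Polynomial.C_eq_natCast]
    have : (Polynomial.C (x ^ b) * Polynomial.X ^ b * Polynomial.C (y ^ (m - b)) *
      Polynomial.C ((m.choose b : ℕ) : ℝ)) = Polynomial.C (x ^ b * y ^ (m - b) * (m.choose b : ℝ))
        * Polynomial.X ^ b := by
      simp only [Polynomial.C_mul]; ring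
    rw [this, Polynomial.coeff_C_mul, Polynomial.coeff_X_pow, if_neg (Ne.symm hb), mul_zero]
  · intro h; exact absurd (Finset.mem_range.2 (by lia)) h

section mom2
variable {Ω : Type} [MeasurableSpace Ω] {P : Measure Ω} [IsProbabilityMeasure P]
    {X : ℤ → Ω → ℝ} {R : ℤ → ℤ → ℝ}

lemma StdG.mom_diag (hS : StdG P X R) (j k j' k' : ℤ) (m : ℕ) :
    mom P X R j k j' k' m m m m = ∑ s ∈ Finset.range (m + 1),
      (m.factorial : ℝ) ^ 2 * (m.choose s : ℝ) ^ 2 *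
      ((R j j' * R k k') ^ s * (R j k' * R k j') ^ (m - s)) := by
  rw [hS.mom_eq, if_pos rfl, Polynomial.coeff_mul, Finset.Nat.sum_antidiagonal_eq_sum_range_succ_mk,
    Finset.mul_sum]
  refine Finset.sum_congr rfl fun s hs => ?_
  have hs' : s ≤ m := by simpa [Nat.lt_succ_iff] using hs
  simp only
  rw [LL_coeff _ _ _ _ hs', LL_coeff _ _ _ _ (Nat.sub_le m s), Nat.sub_sub_self hs',
    Nat.choose_symm hs', mul_pow, mul_pow]
  ring

end mom2

lemma sum_choose_fact (m : ℕ) : ∑ s ∈ Finset.range (m + 1),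
      (m.factorial : ℝ) ^ 2 * (m.choose s : ℝ) ^ 2 = ((2 * m).factorial : ℝ) := by
  rw [← Finset.mul_sum]
  have h := Nat.sum_range_choose_sq m
  have h2 := Nat.choose_mul_factorial_mul_factorial (show m ≤ 2 * m by lia)
  rw [show 2 * m - m = m by lia] at h2
  have h3 : (∑ s ∈ Finset.range (m + 1), (m.choose s : ℝ) ^ 2) = ((2 * m).choose m : ℝ) := by
    exact_mod_cast h
  rw [h3, ← h2]
  push_cast; ring

/-- coefficient of the product formula -/
noncomputable def cc (a b i : ℕ) : ℝ := (i.factorial : ℝ) * a.choose i * b.choose i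

lemma cc_rec (a b i : ℕ) : cc (a + 1) b (i + 1) =
    cc a b (i + 1) + ((b - i : ℕ) : ℝ) * cc a b i := by
  have h : (b.choose (i + 1) : ℝ) * (i + 1) = b.choose i * ((b - i : ℕ) : ℝ) := by
    exact_mod_cast Nat.choose_succ_right_eq b i
  simp only [cc, Nat.choose_succ_succ, Nat.factorial_succ]
  push_cast
  linear_combination ((i.factorial : ℝ) * a.choose i) * h

lemma cc_low (a b i : ℕ) (hi : i ≤ a) : ((a - i : ℕ) : ℝ) * cc a b i = a * cc (a - 1) b i := by
  rcases a with _ | a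
  · simp
  · have h : ((a + 1).choose i : ℝ) * ((a + 1 - i : ℕ) : ℝ) = (a + 1) * a.choose i := by
      have := Nat.choose_mul_succ_eq a i
      have h2 : ((a.choose i * (a + 1) : ℕ) : ℝ) = (((a + 1).choose i * (a + 1 - i) : ℕ) : ℝ) := by
        rw [this]
      push_cast at h2 ⊢
      linarith
    simp only [cc, Nat.add_sub_cancel]
    push_cast at h ⊢
    linear_combination ((i.factorial : ℝ) * b.choose i) * h

lemma cc_zero_a (a b i : ℕ) (h : a < i) : cc a b i = 0 := by simp [cc, Nat.choose_eq_zero_of_lt h]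
lemma cc_zero_b (a b i : ℕ) (h : b < i) : cc a b i = 0 := by simp [cc, Nat.choose_eq_zero_of_lt h]

/-- product formula -/
lemma prod_formula (ρ x y : ℝ) (a b : ℕ) : ∀ N, a < N → Hev a x * Hev b y =
    ∑ i ∈ Finset.range N, cc a b i * ρ ^ i * W ρ x y (a - i) (b - i) := by
  induction a using Nat.strong_induction_on with
  | _ a ih =>
    intro N hN
    rcases a with _ | a
    · rw [Finset.sum_eq_single_of_mem 0 (by simpa using hN)]
      · simp [cc, W_zero, Hev_zero]
      · intro i _ hi
        rw [cc_zero_a _ _ _ (by lia)]; simp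
    · obtain ⟨N, rfl⟩ : ∃ M, N = M + 1 := ⟨N - 1, by lia⟩
      have h1 := ih a (by lia) N (by lia)
      have h1' := ih a (by lia) (N + 1) (by lia)
      have h2 := ih (a - 1) (by lia) (N + 1) (by lia)
      have e0 : Hev (a + 1) x * Hev b y = x * (Hev a x * Hev b y) - a * (Hev (a - 1) x * Hev b y) := by
        rw [Hev_succ]; ring
      -- termwise multiplication
      have e1 : ∀ i, cc a b i * (x * W ρ x y (a - i) (b - i)) = cc a b i * W ρ x y (a + 1 - i) (b - i)
          + a * cc (a - 1) b i * W ρ x y (a - 1 - i) (b - i)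
          + cc a b i * ((b - i : ℕ) : ℝ) * ρ * W ρ x y (a - i) (b - (i + 1)) := by
        intro i
        rcases lt_or_ge a i with h | h
        · rw [cc_zero_a a b i h, cc_zero_a (a - 1) b i (by lia)]; simp
        · rw [← cc_low a b i h, show a + 1 - i = (a - i) + 1 by lia, W_succ,
            show a - i - 1 = a - 1 - i by lia, show b - i - 1 = b - (i + 1) by lia]
          ring
      have e2 : x * (Hev a x * Hev b y) = (∑ i ∈ Finset.range (N+1), cc a b i * ρ ^ i * W ρ x y (a + 1 - i) (b - i))
          + a * (Hev (a - 1) x * Hev b y) +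
          ∑ i ∈ Finset.range (N + 1), cc a b i * ((b - i : ℕ) : ℝ) * ρ ^ (i + 1) * W ρ x y (a - i) (b - (i + 1)) := by
        rw [h1', h2, Finset.mul_sum, Finset.mul_sum, ← Finset.sum_add_distrib, ← Finset.sum_add_distrib]
        refine Finset.sum_congr rfl fun i _ => ?_
        have := e1 i
        linear_combination ρ ^ i * this
      rw [e0, e2, Finset.sum_range_succ' (fun i => cc a b i * ρ ^ i * W ρ x y (a + 1 - i) (b - i)),
        Finset.sum_range_succ' (fun i => cc (a + 1) b i * ρ ^ i * W ρ x y (a + 1 - i) (b - i)),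
        Finset.sum_range_succ (fun i => cc a b i * ((b - i : ℕ) : ℝ) * ρ ^ (i + 1) *
          W ρ x y (a - i) (b - (i + 1))), cc_zero_a a b N (by lia)]
      have e3 : ∑ i ∈ Finset.range N, cc (a + 1) b (i + 1) * ρ ^ (i + 1) * W ρ x y (a + 1 - (i + 1)) (b - (i + 1))
          = ∑ i ∈ Finset.range N, cc a b (i + 1) * ρ ^ (i + 1) * W ρ x y (a + 1 - (i + 1)) (b - (i + 1))
          + ∑ i ∈ Finset.range N, cc a b i * ((b - i : ℕ) : ℝ) * ρ ^ (i + 1) * W ρ x y (a - i) (b - (i + 1)) := by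
        rw [← Finset.sum_add_distrib]
        refine Finset.sum_congr rfl fun i _ => ?_
        rw [cc_rec, show a + 1 - (i + 1) = a - i by lia]
        ring
      rw [e3]
      have e4 : cc (a + 1) b 0 = cc a b 0 := by simp [cc]
      rw [e4]
      ring

section FG
set_option linter.unusedSectionVars false
variable {Ω : Type} [MeasurableSpace Ω] {P : Measure Ω} [IsProbabilityMeasure P]
    {X : ℤ → Ω → ℝ} {R : ℤ → ℤ → ℝ}

/-- normalized Hermite sum -/
noncomputable def FF (X : ℤ → Ω → ℝ) (c : ℝ) (q : ℕ) (s : Finset ℤ) (ω : Ω) : ℝ :=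
  c * ∑ k ∈ s, Hev q (X k ω)

/-- carre du champ -/
noncomputable def GG (X : ℤ → Ω → ℝ) (R : ℤ → ℤ → ℝ) (c : ℝ) (p : ℕ) (s : Finset ℤ) (ω : Ω) : ℝ :=
  c ^ 2 * (p + 1) * ∑ k ∈ s, ∑ j ∈ s, R k j * (Hev p (X k ω) * Hev p (X j ω))

lemma StdG.mlF (hS : StdG P X R) (c : ℝ) (q : ℕ) (s : Finset ℤ) : ML P (FF X c q s) :=
  ML.const_mul c (ML.sum s fun k _ => ML_Hev (hS.ml k) q)

lemma StdG.mlG (hS : StdG P X R) (c : ℝ) (p : ℕ) (s : Finset ℤ) : ML P (GG X R c p s) :=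
  ML.const_mul _ (ML.sum s fun k _ => ML.sum s fun j _ =>
    ML.const_mul _ ((ML_Hev (hS.ml k) p).mul (ML_Hev (hS.ml j) p)))

lemma StdG.measF (hS : StdG P X R) (c : ℝ) (q : ℕ) (s : Finset ℤ) : Measurable (FF X c q s) :=
  (Finset.measurable_sum s fun k _ => (Hev_meas q).comp (hS.meas k)).const_mul c

lemma StdG.steinF1 (hS : StdG P X R) (c : ℝ) (p : ℕ) (s : Finset ℤ) (g g' : ℝ → ℝ)
    (hg : ∀ x, HasDerivAt g (g' x) x) (hg' : Measurable g') (C C' : ℝ) (hC : ∀ x, |g x| ≤ C)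
    (hC' : ∀ x, |g' x| ≤ C') (k : ℤ) (hk : k ∈ s) :
    ∫ ω, Hev (p + 1) (X k ω) * g (FF X c (p + 1) s ω) ∂P =
    ∫ ω, Hev p (X k ω) * (g' (FF X c (p + 1) s ω) *
      (c * ∑ j ∈ s, R k j * ((p + 1) * Hev p (X j ω)))) ∂P := by
  have hgm : Measurable g := (show Continuous g from
    continuous_iff_continuousAt.2 fun x => (hg x).continuousAt).measurable
  have mF := hS.measF c (p + 1) s
  have mlg : ML P (fun ω => g (FF X c (p + 1) s ω)) := ML.bdd C (hgm.comp mF) fun _ => hC _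
  have mlg' : ML P (fun ω => g' (FF X c (p + 1) s ω)) := ML.bdd C' (hg'.comp mF) fun _ => hC' _
  have i1 : ML P (fun ω => Hev p (X k ω) * g (FF X c (p + 1) s ω)) :=
    (ML_Hev (hS.ml k) p).mul mlg
  have i2 : ML P (fun ω => (p * Hev (p - 1) (X k ω)) * g (FF X c (p + 1) s ω)) :=
    ((ML_Hev (hS.ml k) (p - 1)).const_mul _).mul mlg
  have i3 : ML P (fun ω => Hev p (X k ω) * (g' (FF X c (p + 1) s ω) *
      (c * ∑ j ∈ s, R k j * ((p + 1) * Hev p (X j ω))))) :=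
    (ML_Hev (hS.ml k) p).mul (mlg'.mul (ML.const_mul _ (ML.sum s fun j _ =>
      ML.const_mul _ (ML.const_mul _ (ML_Hev (hS.ml j) p)))))
  have c1 : ∀ ω, ∑ i : s, Hev (p + 1) (X i.1 ω) = ∑ i ∈ s, Hev (p + 1) (X i ω) := fun ω =>
    Finset.sum_coe_sort s (fun i => Hev (p + 1) (X i ω))
  have c2 : ∀ ω, ∑ i : s, R k i.1 * ((p + 1) * Hev p (X i.1 ω)) =
      ∑ i ∈ s, R k i * ((p + 1) * Hev p (X i ω)) := fun ω =>
    Finset.sum_coe_sort s (fun i => R k i * ((p + 1) * Hev p (X i ω)))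
  have key := hS.ibp k (ι := s) (fun i => i.1)
    (fun v => Hev p (v ⟨k, hk⟩) * g (c * ∑ i : s, Hev (p + 1) (v i)))
    (fun v => (p * Hev (p - 1) (v ⟨k, hk⟩)) * g (c * ∑ i : s, Hev (p + 1) (v i)) +
      Hev p (v ⟨k, hk⟩) * (g' (c * ∑ i : s, Hev (p + 1) (v i)) *
        (c * ∑ i : s, R k i * ((p + 1) * Hev p (v i)))))
    (by
      have := Hev_meas
      exact ((Hev_meas p).comp (measurable_pi_apply _)).mul (hgm.comp
        ((Finset.measurable_sum _ fun i _ => (Hev_meas _).comp (measurable_pi_apply i)).const_mul c)))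
    (by
      have a1 : Measurable (fun v : s → ℝ => (c * ∑ i : s, Hev (p + 1) (v i))) :=
        (Finset.measurable_sum _ fun i _ => (Hev_meas _).comp (measurable_pi_apply i)).const_mul c
      have a2 : Measurable (fun v : s → ℝ => (c * ∑ i : s, R k i * ((p + 1) * Hev p (v i)))) :=
        (Finset.measurable_sum _ fun i _ => (((Hev_meas _).comp
          (measurable_pi_apply i)).const_mul _).const_mul _).const_mul c
      exact ((((Hev_meas _).comp (measurable_pi_apply _)).const_mul _).mul (hgm.comp a1)).add
        (((Hev_meas _).comp (measurable_pi_apply _)).mul ((hg'.comp a1).mul a2)))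
    (by
      intro v
      have lin : ∀ i : s, HasDerivAt (fun t : ℝ => v i + t * R k i) (R k i) 0 := fun i => by
        simpa using ((hasDerivAt_id (0:ℝ)).mul_const (R k i)).const_add (v i)
      have hH : ∀ (i : s) (m : ℕ), HasDerivAt (fun t : ℝ => Hev m (v i + t * R k i))
          (m * Hev (m - 1) (v i) * R k i) 0 := fun i m => by
        have := (Hev_deriv m (v i + 0 * R k i)).comp 0 (lin i)
        simpa [Function.comp_def] using! this
      have hsum : HasDerivAt (fun t : ℝ => c * ∑ i : s, Hev (p + 1) (v i + t * R k i))
          (c * ∑ i : s, R k i * ((p + 1) * Hev p (v i))) 0 := by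
        refine HasDerivAt.const_mul c ?_
        refine (HasDerivAt.fun_sum fun i _ => hH i (p + 1)).congr_deriv ?_
        refine Finset.sum_congr rfl fun i _ => ?_
        push_cast; ring
      have hgc := (hg (c * ∑ i : s, Hev (p + 1) (v i + 0 * R k i))).comp 0 hsum
      have := (hH ⟨k, hk⟩ p).mul hgc
      refine this.congr_deriv ?_
      simp [hS.var])
    (by
      have : ML P (fun ω => X k ω * (Hev p (X k ω) * g (FF X c (p + 1) s ω))) := (hS.ml k).mul i1
      have := this.integrable
      simp only [FF] at this
      simpa only [c1] using this)
    (by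
      have := i1.integrable
      simp only [FF] at this
      simpa only [c1] using this)
    (by
      have := (i2.add i3).integrable
      simp only [FF] at this
      simpa only [c1,
        c2] using this)
  simp only [c1,
        c2] at key
  rw [show (fun ω => Hev (p + 1) (X k ω) * g (FF X c (p + 1) s ω)) = fun ω =>
    X k ω * (Hev p (X k ω) * g (FF X c (p + 1) s ω)) -
      (p * Hev (p - 1) (X k ω)) * g (FF X c (p + 1) s ω) from by
        ext ω; rw [Hev_succ]; ring]
  rw [integral_sub ((hS.ml k).mul i1).integrable i2.integrable]
  have k2 := integral_add i2.integrable i3.integrable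
  simp only [FF] at k2 ⊢
  rw [key, k2]; ring

lemma StdG.steinF (hS : StdG P X R) (c : ℝ) (p : ℕ) (s : Finset ℤ) (g g' : ℝ → ℝ)
    (hg : ∀ x, HasDerivAt g (g' x) x) (hg' : Measurable g') (C C' : ℝ) (hC : ∀ x, |g x| ≤ C)
    (hC' : ∀ x, |g' x| ≤ C') :
    ∫ ω, FF X c (p + 1) s ω * g (FF X c (p + 1) s ω) ∂P =
    ∫ ω, g' (FF X c (p + 1) s ω) * GG X R c p s ω ∂P := by
  have hgm : Measurable g := (show Continuous g from
    continuous_iff_continuousAt.2 fun x => (hg x).continuousAt).measurable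
  have mF := hS.measF c (p + 1) s
  have mlg : ML P (fun ω => g (FF X c (p + 1) s ω)) := ML.bdd C (hgm.comp mF) fun _ => hC _
  have mlg' : ML P (fun ω => g' (FF X c (p + 1) s ω)) := ML.bdd C' (hg'.comp mF) fun _ => hC' _
  have e1 : ∀ ω, FF X c (p + 1) s ω * g (FF X c (p + 1) s ω) =
      c * ∑ k ∈ s, Hev (p + 1) (X k ω) * g (FF X c (p + 1) s ω) := fun ω => by
    conv_lhs => rw [FF, mul_assoc, Finset.sum_mul]
    simp only [FF]
  have e2 : ∀ ω, g' (FF X c (p + 1) s ω) * GG X R c p s ω = c * ∑ k ∈ s,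
      Hev p (X k ω) * (g' (FF X c (p + 1) s ω) *
      (c * ∑ j ∈ s, R k j * ((p + 1) * Hev p (X j ω)))) := fun ω => by
    rw [GG]
    simp only [Finset.mul_sum]
    refine Finset.sum_congr rfl fun k _ => Finset.sum_congr rfl fun j _ => ?_
    ring
  simp only [e1, e2]
  rw [integral_const_mul, integral_const_mul, integral_finsetSum, integral_finsetSum]
  · congr 1
    exact Finset.sum_congr rfl fun k hk => hS.steinF1 c p s g g' hg hg' C C' hC hC' k hk
  · intro k _
    exact ((ML_Hev (hS.ml k) p).mul (mlg'.mul (ML.const_mul _ (ML.sum s fun j _ =>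
      ML.const_mul _ (ML.const_mul _ (ML_Hev (hS.ml j) p)))))).integrable
  · intro k _
    exact ((ML_Hev (hS.ml k) (p + 1)).mul mlg).integrable

end FG

section path
set_option linter.unusedSectionVars false

lemma gauss_int_id : Integrable (fun y : ℝ => y) (gaussianReal 0 1) := by
  have := (memLp_id_gaussianReal (μ := 0) (v := 1) 1)
  exact memLp_one_iff_integrable.1 (by simpa [id_def] using! this)

lemma gauss_int_abs : ∫ y, |y| ∂(gaussianReal 0 1) ≤ 1 := by
  have h2 : MemLp (fun y : ℝ => y) 2 (gaussianReal 0 1) := by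
    simpa [id_def] using! (memLp_id_gaussianReal (μ := 0) (v := 1) 2)
  have hsq : Integrable (fun y : ℝ => y ^ 2) (gaussianReal 0 1) := h2.integrable_sq
  have hv : ∫ y, y ^ 2 ∂(gaussianReal 0 1) = 1 := by
    have := variance_id_gaussianReal (μ := 0) (v := 1)
    rw [variance_eq_integral aemeasurable_id] at this
    simpa using this
  calc ∫ y, |y| ∂(gaussianReal 0 1) ≤ ∫ y, (1 + y ^ 2) / 2 ∂(gaussianReal 0 1) := by
        refine integral_mono gauss_int_id.abs (((integrable_const 1).add hsq).div_const 2) fun y => ?_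
        show |y| ≤ (1 + y ^ 2) / 2
        nlinarith [sq_nonneg (|y| - 1), sq_abs y]
    _ = 1 := by
        rw [integral_div, integral_add (integrable_const 1) hsq, hv]; simp

variable {Ω : Type} [MeasurableSpace Ω] {P : Measure Ω} [IsProbabilityMeasure P]

/-- Integration by parts formula for `F` with carre du champ `Γ`. -/
def SteinPair (P : Measure Ω) (F Γ : Ω → ℝ) : Prop :=
  ∀ (g g' : ℝ → ℝ), (∀ x, HasDerivAt g (g' x) x) → Measurable g' → ∀ (C C' : ℝ),
    (∀ x, |g x| ≤ C) → (∀ x, |g' x| ≤ C') → ∫ ω, F ω * g (F ω) ∂P = ∫ ω, g' (F ω) * Γ ω ∂P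

lemma path_deriv {F Γ : Ω → ℝ} (hF : Measurable F) (iF : Integrable F P) (iΓ : Integrable Γ P)
    (hst : SteinPair P F Γ) (σ : ℝ) (hσ : 0 < σ) (h h' h'' : ℝ → ℝ)
    (d1 : ∀ x, HasDerivAt h (h' x) x) (d2 : ∀ x, HasDerivAt h' (h'' x) x) (m2 : Measurable h'')
    (L M : ℝ) (b1 : ∀ x, |h' x| ≤ L) (b2 : ∀ x, |h'' x| ≤ M) (s c : ℝ) (hs : 0 ≤ s) :
    |∫ z, h' (s * F z.1 + c * (σ * z.2)) * (c * F z.1 - s * (σ * z.2)) ∂(P.prod (gaussianReal 0 1))|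
      ≤ L / σ * (∫ ω, |Γ ω - σ ^ 2| ∂P) * s := by
  have hL : 0 ≤ L := (abs_nonneg _).trans (b1 0)
  have m1 : Measurable h' := (show Continuous h' from
    continuous_iff_continuousAt.2 fun x => (d2 x).continuousAt).measurable
  set γ := gaussianReal 0 1 with hγ
  set U : Ω × ℝ → ℝ := fun z => s * F z.1 + c * (σ * z.2) with hU
  have mU : Measurable U := by
    have : Measurable (fun z : Ω × ℝ => F z.1) := hF.comp measurable_fst
    have a2 : Measurable (fun z : Ω × ℝ => c * (σ * z.2)) := by fun_prop
    exact (this.const_mul s).add a2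
  have iF' : Integrable (fun z : Ω × ℝ => F z.1) (P.prod γ) := iF.comp_fst γ
  have iΓ' : Integrable (fun z : Ω × ℝ => Γ z.1) (P.prod γ) := iΓ.comp_fst γ
  have iy' : Integrable (fun z : Ω × ℝ => z.2) (P.prod γ) := gauss_int_id.comp_snd P
  have bd1 : ∀ {f : Ω × ℝ → ℝ}, Integrable f (P.prod γ) →
      Integrable (fun z => h' (U z) * f z) (P.prod γ) := fun hf =>
    hf.bdd_mul (m1.comp mU).aestronglyMeasurable (ae_of_all _ fun z => b1 (U z))
  have bd2 : ∀ {f : Ω × ℝ → ℝ}, Integrable f (P.prod γ) →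
      Integrable (fun z => h'' (U z) * f z) (P.prod γ) := fun hf =>
    hf.bdd_mul (m2.comp mU).aestronglyMeasurable (ae_of_all _ fun z => b2 (U z))
  have e0 : ∫ z, h' (U z) * (c * F z.1 - s * (σ * z.2)) ∂(P.prod γ) =
      c * ∫ z, h' (U z) * F z.1 ∂(P.prod γ) - s * σ * ∫ z, h' (U z) * z.2 ∂(P.prod γ) := by
    rw [← integral_const_mul, ← integral_const_mul,
      ← integral_sub ((bd1 iF').const_mul c) ((bd1 iy').const_mul (s * σ))]
    congr 1; ext z; ring
  have e1 : ∫ z, h' (U z) * F z.1 ∂(P.prod γ) = s * ∫ z, h'' (U z) * Γ z.1 ∂(P.prod γ) := by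
    rw [integral_prod_symm _ (bd1 iF'), integral_prod_symm _ (bd2 iΓ'), ← integral_const_mul]
    congr 1; ext y
    have := hst (fun x => h' (s * x + c * (σ * y))) (fun x => s * h'' (s * x + c * (σ * y)))
      (fun x => by
        have l : HasDerivAt (fun x : ℝ => s * x + c * (σ * y)) s x := by
          simpa using ((hasDerivAt_id x).const_mul s).add_const (c * (σ * y))
        have := (d2 (s * x + c * (σ * y))).comp x l
        exact this.congr_deriv (mul_comm _ _))
      ((m2.comp (by fun_prop)).const_mul s) L (|s| * M) (fun x => b1 _)
      (fun x => by rw [abs_mul]; exact mul_le_mul_of_nonneg_left (b2 _) (abs_nonneg _))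
    rw [← integral_const_mul]
    simp only [hU]
    rw [show (fun a => h' (s * F a + c * (σ * y)) * F a) =
      fun a => F a * h' (s * F a + c * (σ * y)) from by ext; ring, this]
    congr 1; ext a; ring
  set A : Ω → ℝ := fun ω => ∫ y, h' (U (ω, y)) * y ∂γ with hA
  have Abd : ∀ ω, |A ω| ≤ L := fun ω => by
    calc |A ω| ≤ ∫ y, |h' (U (ω, y)) * y| ∂γ := abs_integral_le_integral_abs
      _ ≤ ∫ y, L * |y| ∂γ := by
          refine integral_mono_of_nonneg (ae_of_all _ fun y => abs_nonneg _)
            (gauss_int_id.abs.const_mul L) (ae_of_all _ fun y => ?_)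
          simp only [abs_mul]
          exact mul_le_mul_of_nonneg_right (b1 _) (abs_nonneg _)
      _ = L * ∫ y, |y| ∂γ := integral_const_mul _ _
      _ ≤ L * 1 := mul_le_mul_of_nonneg_left gauss_int_abs hL
      _ = L := mul_one L
  have mA : AEStronglyMeasurable A P := (bd1 iy').aestronglyMeasurable.integral_prod_right'
  have iA : ∀ {f : Ω → ℝ}, Integrable f P → Integrable (fun ω => A ω * f ω) P := fun hf =>
    hf.bdd_mul mA (ae_of_all _ Abd)
  have e2 : ∀ ω, c * ∫ y, h'' (U (ω, y)) ∂γ = A ω / σ := fun ω => by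
    have iin : ∀ {f : ℝ → ℝ}, Integrable f γ → Integrable (fun y => f y * h' (U (ω, y))) γ :=
      fun hf => hf.mul_bdd (c := L) (m1.comp (mU.comp (measurable_prodMk_left))).aestronglyMeasurable
        (ae_of_all _ fun z => b1 _)
    have := ibp1 (fun y => h' (U (ω, y))) (fun y => (c * σ) * h'' (U (ω, y)))
      (fun y => by
        have l : HasDerivAt (fun y : ℝ => s * F ω + c * (σ * y)) (c * σ) y := by
          simpa using (((hasDerivAt_id y).const_mul σ).const_mul c).const_add (s * F ω)
        have := (d2 (s * F ω + c * (σ * y))).comp y l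
        exact this.congr_deriv (mul_comm _ _))
      (iin gauss_int_id) (by simpa using iin (integrable_const (1:ℝ)))
      ((Integrable.of_bound (m2.comp (mU.comp (measurable_prodMk_left))).aestronglyMeasurable M
        (ae_of_all _ fun z => b2 _)).const_mul _)
    rw [integral_const_mul] at this
    rw [eq_div_iff hσ.ne', hA]
    simp only [mul_comm (h' _)]
    rw [this]; ring
  have e3 : c * ∫ z, h'' (U z) * Γ z.1 ∂(P.prod γ) = (∫ ω, A ω * Γ ω ∂P) / σ := by
    rw [integral_prod _ (bd2 iΓ'), ← integral_const_mul, ← integral_div]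
    congr 1; ext ω
    show c * ∫ y, h'' (U (ω, y)) * Γ ω ∂γ = _
    rw [integral_mul_const, ← mul_assoc, e2]; ring
  have e4 : ∫ z, h' (U z) * z.2 ∂(P.prod γ) = ∫ ω, A ω ∂P := integral_prod _ (bd1 iy')
  have e5 : ∫ z, h' (U z) * (c * F z.1 - s * (σ * z.2)) ∂(P.prod γ) =
      s / σ * ∫ ω, A ω * (Γ ω - σ ^ 2) ∂P := by
    have : ∫ ω, A ω * (Γ ω - σ ^ 2) ∂P = ∫ ω, A ω * Γ ω ∂P - σ ^ 2 * ∫ ω, A ω ∂P := by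
      rw [← integral_const_mul, ← integral_sub (iA iΓ)]
      · congr 1; ext; ring
      · have := iA (integrable_const (σ ^ 2)); simpa only [mul_comm] using this
    rw [e0, e1, e4, this, show ∀ t, c * (s * t) = s * (c * t) from fun t => by ring, e3]
    field_simp
  rw [e5, abs_mul, abs_of_nonneg (div_nonneg hs hσ.le)]
  have e6 : |∫ ω, A ω * (Γ ω - σ ^ 2) ∂P| ≤ L * ∫ ω, |Γ ω - σ ^ 2| ∂P := by
    rw [← integral_const_mul]
    refine abs_integral_le_integral_abs.trans (integral_mono_of_nonneg (ae_of_all _ fun y => abs_nonneg _)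
            ((iΓ.sub (integrable_const _)).abs.const_mul L) (ae_of_all _ fun y => ?_))
    simp only [abs_mul]
    exact mul_le_mul_of_nonneg_right (Abd _) (abs_nonneg _)
  calc s / σ * |∫ ω, A ω * (Γ ω - σ ^ 2) ∂P| ≤ s / σ * (L * ∫ ω, |Γ ω - σ ^ 2| ∂P) :=
        mul_le_mul_of_nonneg_left e6 (div_nonneg hs hσ.le)
    _ = _ := by ring

lemma path_bound {F Γ : Ω → ℝ} (hF : Measurable F) (iF : Integrable F P) (iΓ : Integrable Γ P)
    (hst : SteinPair P F Γ) (σ : ℝ) (hσ : 0 < σ) (h h' h'' : ℝ → ℝ)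
    (d1 : ∀ x, HasDerivAt h (h' x) x) (d2 : ∀ x, HasDerivAt h' (h'' x) x) (m2 : Measurable h'')
    (L : ℝ≥0) (M : ℝ) (hL : LipschitzWith L h) (b1 : ∀ x, |h' x| ≤ L) (b2 : ∀ x, |h'' x| ≤ M) :
    |∫ ω, h (F ω) ∂P - ∫ y, h (σ * y) ∂(gaussianReal 0 1)|
      ≤ L / σ * (∫ ω, |Γ ω - σ ^ 2| ∂P) := by
  have m1 : Measurable h' := (show Continuous h' from
    continuous_iff_continuousAt.2 fun x => (d2 x).continuousAt).measurable
  set γ := gaussianReal 0 1 with hγ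
  have iF' : Integrable (fun z : Ω × ℝ => F z.1) (P.prod γ) := iF.comp_fst γ
  have iy' : Integrable (fun z : Ω × ℝ => z.2) (P.prod γ) := gauss_int_id.comp_snd P
  set U : ℝ → Ω × ℝ → ℝ := fun θ z => Real.sin θ * F z.1 + Real.cos θ * (σ * z.2) with hU
  have mU : ∀ θ, Measurable (U θ) := fun θ => by
    have : Measurable (fun z : Ω × ℝ => F z.1) := hF.comp measurable_fst
    have a2 : Measurable (fun z : Ω × ℝ => Real.cos θ * (σ * z.2)) := by fun_prop
    exact (this.const_mul _).add a2
  set φ : ℝ → ℝ := fun θ => ∫ z, h (U θ z) ∂(P.prod γ) with hφ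
  have iU : ∀ θ, Integrable (U θ) (P.prod γ) := fun θ =>
    (iF'.const_mul _).add ((iy'.const_mul σ).const_mul _)
  have ih : ∀ θ, Integrable (fun z => h (U θ z)) (P.prod γ) := fun θ => by
    refine Integrable.mono' (((iU θ).abs.const_mul L).add (integrable_const |h 0|))
      (hL.continuous.measurable.comp (mU θ)).aestronglyMeasurable (ae_of_all _ fun z => ?_)
    have := hL.dist_le_mul (U θ z) 0
    rw [Real.dist_eq, Real.dist_eq, sub_zero] at this
    have t2 := abs_sub_abs_le_abs_sub (h (U θ z)) (h 0)
    simp only [Real.norm_eq_abs, Pi.add_apply]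
    linarith
  have hd : ∀ θ, HasDerivAt φ (∫ z, h' (U θ z) *
      (Real.cos θ * F z.1 - Real.sin θ * (σ * z.2)) ∂(P.prod γ)) θ := fun θ => by
    refine (hasDerivAt_integral_of_dominated_loc_of_deriv_le (μ := P.prod γ) (F := fun θ z => h (U θ z))
      (F' := fun θ z => h' (U θ z) * (Real.cos θ * F z.1 - Real.sin θ * (σ * z.2)))
      (bound := fun z => L * (|F z.1| + |σ * z.2|)) (s := Set.univ) Filter.univ_mem
      (Filter.Eventually.of_forall fun θ => (ih θ).aestronglyMeasurable) (ih θ) ?_ ?_ ?_ ?_).2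
    · have a1 : Measurable (fun z : Ω × ℝ => F z.1) := hF.comp measurable_fst
      have a2 : Measurable (fun z : Ω × ℝ => Real.sin θ * (σ * z.2)) := by fun_prop
      exact ((m1.comp (mU θ)).mul ((a1.const_mul _).sub a2)).aestronglyMeasurable
    · refine ae_of_all _ fun z t _ => ?_
      simp only [Real.norm_eq_abs, abs_mul]
      refine mul_le_mul (b1 _) ?_ (abs_nonneg _) L.2
      refine (abs_sub _ _).trans ?_
      rw [abs_mul, abs_mul, abs_mul]
      refine add_le_add ?_ ?_
      · exact mul_le_of_le_one_left (abs_nonneg _) (Real.abs_cos_le_one _)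
      · exact mul_le_of_le_one_left (by positivity) (Real.abs_sin_le_one _)
    · exact (iF'.abs.add (iy'.const_mul σ).abs).const_mul _
    · refine ae_of_all _ fun z t _ => ?_
      have l : HasDerivAt (fun t => U t z) (Real.cos t * F z.1 - Real.sin t * (σ * z.2)) t := by
        have := ((Real.hasDerivAt_sin t).mul_const (F z.1)).add
          ((Real.hasDerivAt_cos t).mul_const (σ * z.2))
        exact this.congr_deriv (by ring)
      exact (d1 (U t z)).comp t l
  set K := L / σ * (∫ ω, |Γ ω - σ ^ 2| ∂P) with hK
  have key := image_norm_le_of_norm_deriv_right_le_deriv_boundary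
    (f := fun θ => φ θ - φ 0) (f' := fun θ => ∫ z, h' (U θ z) *
      (Real.cos θ * F z.1 - Real.sin θ * (σ * z.2)) ∂(P.prod γ)) (a := 0) (b := Real.pi / 2)
    (B := fun θ => K * (1 - Real.cos θ)) (B' := fun θ => K * Real.sin θ)
    (fun θ _ => ((hd θ).sub_const _).continuousAt.continuousWithinAt)
    (fun θ _ => ((hd θ).sub_const _).hasDerivWithinAt)
    (by simp)
    (fun θ => by simpa using ((Real.hasDerivAt_cos θ).const_sub 1).const_mul K)
    (fun θ hθ => path_deriv hF iF iΓ hst σ hσ h h' h'' d1 d2 m2 L M b1 b2 _ _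
      (Real.sin_nonneg_of_nonneg_of_le_pi hθ.1 (by linarith [hθ.2, Real.pi_pos])))
    (x := Real.pi / 2) ⟨by positivity, le_rfl⟩
  have p1 : φ (Real.pi / 2) = ∫ ω, h (F ω) ∂P := by
    simp only [hφ, hU, Real.sin_pi_div_two, Real.cos_pi_div_two, one_mul, zero_mul, add_zero]
    have := integral_fun_fst (μ := P) (ν := γ) (fun ω => h (F ω))
    simpa using this
  have p0 : φ 0 = ∫ y, h (σ * y) ∂γ := by
    simp only [hφ, hU, Real.sin_zero, Real.cos_zero, one_mul, zero_mul, zero_add]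
    have := integral_fun_snd (μ := P) (ν := γ) (fun y => h (σ * y))
    simpa using this
  simp only [p1, p0, Real.cos_pi_div_two, sub_zero, mul_one, Real.norm_eq_abs] at key
  exact key

lemma smooth1 (L : ℝ≥0) (h : ℝ → ℝ) (hL : LipschitzWith L h) (ε : ℝ) (hε : 0 < ε) :
    ∃ h1 : ℝ → ℝ, (∀ x, HasDerivAt h1 ((h (x + ε) - h x) / ε) x) ∧ LipschitzWith L h1 ∧
      (∀ x, |(h (x + ε) - h x) / ε| ≤ L) ∧ ∀ x, |h1 x - h x| ≤ L * ε := by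
  have hc := hL.continuous
  have hH : ∀ x, HasDerivAt (fun x => ∫ u in (0:ℝ)..x, h u) (h x) x := fun x =>
    intervalIntegral.integral_hasDerivAt_right (hc.intervalIntegrable _ _)
      hc.stronglyMeasurable.stronglyMeasurableAtFilter hc.continuousAt
  have hd : ∀ x, HasDerivAt (fun x => ((∫ u in (0:ℝ)..(x + ε), h u) - ∫ u in (0:ℝ)..x, h u) / ε)
      ((h (x + ε) - h x) / ε) x := fun x =>
    ((((hH (x + ε)).comp_add_const x ε)).sub (hH x)).div_const ε
  have hb : ∀ x, |(h (x + ε) - h x) / ε| ≤ L := fun x => by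
    rw [abs_div, abs_of_pos hε, div_le_iff₀ hε]
    have := hL.dist_le_mul (x + ε) x
    rw [Real.dist_eq, Real.dist_eq] at this
    simpa [abs_of_pos hε] using this
  refine ⟨_, hd, ?_, hb, ?_⟩
  · refine lipschitzWith_of_nnnorm_deriv_le (fun x => (hd x).differentiableAt) fun x => ?_
    rw [(hd x).deriv]
    exact_mod_cast hb x
  · intro x
    have e : ((∫ u in (0:ℝ)..(x + ε), h u) - ∫ u in (0:ℝ)..x, h u) / ε - h x =
        (∫ u in x..(x + ε), (h u - h x)) / ε := by
      rw [intervalIntegral.integral_interval_sub_left (hc.intervalIntegrable _ _)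
        (hc.intervalIntegrable _ _), intervalIntegral.integral_sub (hc.intervalIntegrable _ _)
        intervalIntegrable_const, intervalIntegral.integral_const]
      simp; field_simp
    rw [e, abs_div, abs_of_pos hε, div_le_iff₀ hε]
    have := intervalIntegral.norm_integral_le_of_norm_le_const (a := x) (b := x + ε)
      (f := fun u => h u - h x) (C := L * ε) (fun u hu => by
        rw [Set.uIoc_of_le (by linarith)] at hu
        have := hL.dist_le_mul u x
        rw [Real.dist_eq, Real.dist_eq] at this
        refine this.trans (mul_le_mul_of_nonneg_left ?_ L.2)
        rw [abs_of_pos (by linarith [hu.1])]; linarith [hu.2])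
    simpa [abs_of_pos hε] using this

lemma lip_int {Ω' : Type} [MeasurableSpace Ω'] {Q : Measure Ω'} [IsProbabilityMeasure Q]
    {F : Ω' → ℝ} (iF : Integrable F Q) {L : ℝ≥0} {h : ℝ → ℝ}
    (hL : LipschitzWith L h) : Integrable (fun ω => h (F ω)) Q := by
  refine Integrable.mono' ((iF.abs.const_mul L).add (integrable_const |h 0|))
    (hL.continuous.comp_aestronglyMeasurable iF.aestronglyMeasurable) (ae_of_all _ fun z => ?_)
  have := hL.dist_le_mul (F z) 0
  rw [Real.dist_eq, Real.dist_eq, sub_zero] at this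
  have t2 := abs_sub_abs_le_abs_sub (h (F z)) (h 0)
  simp only [Real.norm_eq_abs, Pi.add_apply]
  linarith

lemma close_int {Ω' : Type} [MeasurableSpace Ω'] {Q : Measure Ω'} [IsProbabilityMeasure Q]
    {f g : Ω' → ℝ} (hf : Integrable f Q) (hg : Integrable g Q) (δ : ℝ) (h : ∀ x, |f x - g x| ≤ δ) :
    |∫ x, f x ∂Q - ∫ x, g x ∂Q| ≤ δ := by
  rw [← integral_sub hf hg]
  refine abs_integral_le_integral_abs.trans ?_
  calc ∫ a, |f a - g a| ∂Q ≤ ∫ _, δ ∂Q := integral_mono (hf.sub hg).abs (integrable_const δ) h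
    _ = δ := by simp

lemma lip_bound {F Γ : Ω → ℝ} (hF : Measurable F) (iF : Integrable F P) (iΓ : Integrable Γ P)
    (hst : SteinPair P F Γ) (v : ℝ) (hv : 0 < v) (h : ℝ → ℝ) (L : ℝ≥0) (hL : LipschitzWith L h) :
    |∫ ω, h (F ω) ∂P - ∫ y, h y ∂(gaussianReal 0 v.toNNReal)|
      ≤ L / Real.sqrt v * (∫ ω, |Γ ω - v| ∂P) := by
  set σ := Real.sqrt v with hσd
  have hσ : 0 < σ := Real.sqrt_pos.2 hv
  have hsq : σ ^ 2 = v := Real.sq_sqrt hv.le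
  have hmap : ∫ y, h y ∂(gaussianReal 0 v.toNNReal) = ∫ y, h (σ * y) ∂(gaussianReal 0 1) := by
    have := gaussianReal_map_const_mul (μ := 0) (v := 1) σ
    rw [show gaussianReal 0 v.toNNReal = (gaussianReal 0 1).map (fun y => σ * y) from by
      rw [this, mul_zero, mul_one]; congr 1; ext; simp [hsq, hv.le]]
    rw [integral_map (by fun_prop) hL.continuous.aestronglyMeasurable]
  rw [hmap, ← hsq]
  refine le_of_forall_pos_le_add fun δ hδ => ?_
  obtain ⟨ε, hε, hεδ⟩ : ∃ ε > 0, 4 * L * ε ≤ δ := by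
    refine ⟨δ / (4 * L + 1), by positivity, ?_⟩
    rw [← mul_div_assoc, div_le_iff₀ (by positivity)]
    nlinarith
  obtain ⟨h1, hd1, hL1, hb1, hc1⟩ := smooth1 L h hL ε hε
  obtain ⟨h2, hd2, hL2, hb2, hc2⟩ := smooth1 L h1 hL1 ε hε
  have dd : ∀ x, HasDerivAt (fun x => (h1 (x + ε) - h1 x) / ε)
      (((h (x + ε + ε) - h (x + ε)) / ε - (h (x + ε) - h x) / ε) / ε) x := fun x =>
    (((hd1 (x + ε)).comp_add_const x ε).sub (hd1 x)).div_const ε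
  have hm := hL.continuous.measurable
  have key := path_bound hF iF iΓ hst σ hσ h2 _ _ hd2 dd (by fun_prop) L (2 * L / ε) hL2 hb2
    (fun x => by
      rw [abs_div, abs_of_pos hε]
      refine div_le_div_of_nonneg_right ((abs_sub _ _).trans ?_) hε.le
      linarith [hb1 x, hb1 (x + ε)])
  have cl : ∀ x, |h2 x - h x| ≤ 2 * L * ε := fun x => by
    have := abs_sub_le (h2 x) (h1 x) (h x)
    linarith [hc1 x, hc2 x]
  have k1 := close_int (lip_int iF hL2) (lip_int iF hL) _ fun x => cl (F x)
  have k2 := close_int (lip_int (gauss_int_id.const_mul σ) hL2)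
    (lip_int (gauss_int_id.const_mul σ) hL) _ fun x => cl (σ * x)
  rw [abs_le] at k1 k2 key ⊢
  constructor <;> linarith [k1.1, k1.2, k2.1, k2.2, key.1, key.2]

end path

section comb

lemma pair_pow (a b : ℝ) (ha : 0 ≤ a) (hb : 0 ≤ b) (s t : ℕ) :
    a ^ s * b ^ t + a ^ t * b ^ s ≤ a ^ (s + t) + b ^ (s + t) := by
  rw [pow_add, pow_add]
  rcases le_total a b with h | h
  · nlinarith [mul_nonneg (sub_nonneg.2 (pow_le_pow_left₀ ha h s))
      (sub_nonneg.2 (pow_le_pow_left₀ ha h t))]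
  · nlinarith [mul_nonneg (sub_nonneg.2 (pow_le_pow_left₀ hb h s))
      (sub_nonneg.2 (pow_le_pow_left₀ hb h t))]

lemma mul_pow_le_add (a b : ℝ) (ha : 0 ≤ a) (hb : 0 ≤ b) (l m : ℕ) :
    a ^ l * b ^ m ≤ a ^ (l + m) + b ^ (l + m) := by
  have := pair_pow a b ha hb l m
  have : 0 ≤ a ^ m * b ^ l := by positivity
  linarith

variable {Ω : Type} [MeasurableSpace Ω] {P : Measure Ω} [IsProbabilityMeasure P]
    {X : ℤ → Ω → ℝ} {R : ℤ → ℤ → ℝ}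

lemma StdG.mom_bound (hS : StdG P X R) (j k j' k' : ℤ) (m : ℕ) :
    |mom P X R j k j' k' m m m m| ≤ ((2 * m).factorial : ℝ) / 2 *
      (|R j j'| ^ m * |R k k'| ^ m + |R j k'| ^ m * |R k j'| ^ m) := by
  rw [hS.mom_diag]
  set w : ℕ → ℝ := fun s => (m.factorial : ℝ) ^ 2 * (m.choose s : ℝ) ^ 2 with hw
  set a := |R j j' * R k k'| with ha
  set b := |R j k' * R k j'| with hb
  have h1 : |∑ s ∈ Finset.range (m + 1), w s *
      ((R j j' * R k k') ^ s * (R j k' * R k j') ^ (m - s))| ≤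
      ∑ s ∈ Finset.range (m + 1), w s * (a ^ s * b ^ (m - s)) := by
    refine (Finset.abs_sum_le_sum_abs _ _).trans (le_of_eq (Finset.sum_congr rfl fun s _ => ?_))
    have hw0 : 0 ≤ w s := by positivity
    rw [abs_mul (w s), abs_of_nonneg hw0, abs_mul (_ ^ s), abs_pow (R j j' * R k k'), abs_pow (R j k' * R k j')]
  have h2 : ∑ s ∈ Finset.range (m + 1), w s * (a ^ s * b ^ (m - s)) =
      ∑ s ∈ Finset.range (m + 1), w s * (a ^ (m - s) * b ^ s) := by
    rw [← Finset.sum_range_reflect]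
    refine Finset.sum_congr rfl fun s hs => ?_
    have hs' : s ≤ m := by simpa [Nat.lt_succ_iff] using hs
    rw [show m + 1 - 1 - s = m - s by lia, show m - (m - s) = s by lia]
    simp only [hw, Nat.choose_symm hs']
  have h3 : ∑ s ∈ Finset.range (m + 1), w s * (a ^ s * b ^ (m - s)) +
      ∑ s ∈ Finset.range (m + 1), w s * (a ^ (m - s) * b ^ s) ≤
      ∑ s ∈ Finset.range (m + 1), w s * (a ^ m + b ^ m) := by
    rw [← Finset.sum_add_distrib]
    refine Finset.sum_le_sum fun s hs => ?_
    have hs' : s ≤ m := by simpa [Nat.lt_succ_iff] using hs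
    rw [← mul_add]
    have := pair_pow a b (abs_nonneg _) (abs_nonneg _) s (m - s)
    rw [show s + (m - s) = m by lia] at this
    exact mul_le_mul_of_nonneg_left this (by positivity)
  rw [← Finset.sum_mul, sum_choose_fact] at h3
  have h4 : a ^ m = |R j j'| ^ m * |R k k'| ^ m := by rw [ha, abs_mul, mul_pow]
  have h5 : b ^ m = |R j k'| ^ m * |R k j'| ^ m := by rw [hb, abs_mul, mul_pow]
  rw [← h4, ← h5]
  linarith

/-- chaos component -/
noncomputable def TT (X : ℤ → Ω → ℝ) (R : ℤ → ℤ → ℝ) (s : Finset ℤ) (l m : ℕ) (ω : Ω) : ℝ :=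
  ∑ k ∈ s, ∑ j ∈ s, R k j ^ l * W (R k j) (X k ω) (X j ω) m m

lemma StdG.mlT (hS : StdG P X R) (s : Finset ℤ) (l m : ℕ) : ML P (TT X R s l m) :=
  ML.sum s fun k _ => ML.sum s fun j _ => ML.const_mul _ (hS.mlW k j m m)

lemma StdG.T_sq (hS : StdG P X R) (s : Finset ℤ) (l m : ℕ) :
    ∫ ω, TT X R s l m ω ^ 2 ∂P ≤ ((2 * m).factorial : ℝ) *
      ∑ k ∈ s, ∑ j ∈ s, ∑ k' ∈ s, ∑ j' ∈ s,
        |R k j| ^ l * |R k' j'| ^ l * (|R k k'| ^ m * |R j j'| ^ m) := by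
  have e1 : ∀ ω, TT X R s l m ω ^ 2 = ∑ k ∈ s, ∑ j ∈ s, ∑ k' ∈ s, ∑ j' ∈ s,
      (R k j ^ l * R k' j' ^ l) * (W (R k j) (X k ω) (X j ω) m m *
        W (R k' j') (X k' ω) (X j' ω) m m) := fun ω => by
    rw [TT, pow_two, Finset.sum_mul]
    refine Finset.sum_congr rfl fun k _ => ?_
    rw [Finset.sum_mul]
    refine Finset.sum_congr rfl fun j _ => ?_
    rw [Finset.mul_sum]
    refine Finset.sum_congr rfl fun k' _ => ?_
    rw [Finset.mul_sum]
    exact Finset.sum_congr rfl fun j' _ => by ring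
  have M : ∀ k j k' j', ML P (fun ω => (R k j ^ l * R k' j' ^ l) * (W (R k j) (X k ω) (X j ω) m m *
        W (R k' j') (X k' ω) (X j' ω) m m)) := fun k j k' j' =>
    ML.const_mul _ ((hS.mlW k j m m).mul (hS.mlW k' j' m m))
  have e2 : ∫ ω, TT X R s l m ω ^ 2 ∂P = ∑ k ∈ s, ∑ j ∈ s, ∑ k' ∈ s, ∑ j' ∈ s,
      (R k j ^ l * R k' j' ^ l) * mom P X R k j k' j' m m m m := by
    simp only [e1]
    rw [integral_finsetSum _ fun k _ => (ML.sum s fun j _ => ML.sum s fun k' _ =>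
      ML.sum s fun j' _ => M k j k' j').integrable]
    refine Finset.sum_congr rfl fun k _ => ?_
    rw [integral_finsetSum _ fun j _ => (ML.sum s fun k' _ =>
      ML.sum s fun j' _ => M k j k' j').integrable]
    refine Finset.sum_congr rfl fun j _ => ?_
    rw [integral_finsetSum _ fun k' _ => (
      ML.sum s fun j' _ => M k j k' j').integrable]
    refine Finset.sum_congr rfl fun k' _ => ?_
    rw [integral_finsetSum _ fun j' _ => (M k j k' j').integrable]
    refine Finset.sum_congr rfl fun j' _ => ?_
    rw [integral_const_mul, mom]
  set f : ℤ → ℤ → ℤ → ℤ → ℝ := fun k j k' j' =>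
    |R k j| ^ l * |R k' j'| ^ l * (|R k k'| ^ m * |R j j'| ^ m) with hf
  have e3 : ∑ k ∈ s, ∑ j ∈ s, ∑ k' ∈ s, ∑ j' ∈ s, f k j j' k' =
      ∑ k ∈ s, ∑ j ∈ s, ∑ k' ∈ s, ∑ j' ∈ s, f k j k' j' :=
    Finset.sum_congr rfl fun k _ => Finset.sum_congr rfl fun j _ => Finset.sum_comm
  have e4 : ∫ ω, TT X R s l m ω ^ 2 ∂P ≤ ∑ k ∈ s, ∑ j ∈ s, ∑ k' ∈ s, ∑ j' ∈ s,
      ((2 * m).factorial : ℝ) / 2 * (f k j k' j' + f k j j' k') := by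
    rw [e2]
    refine Finset.sum_le_sum fun k _ => Finset.sum_le_sum fun j _ => Finset.sum_le_sum fun k' _ =>
      Finset.sum_le_sum fun j' _ => ?_
    have := hS.mom_bound k j k' j' m
    refine (le_abs_self _).trans ?_
    rw [abs_mul, abs_mul, abs_pow, abs_pow]
    refine (mul_le_mul_of_nonneg_left this (by positivity)).trans (le_of_eq ?_)
    simp only [hf]
    rw [hS.symm j' k']; ring
  refine e4.trans (le_of_eq ?_)
  simp only [← Finset.mul_sum, Finset.sum_add_distrib]
  rw [e3]; ring

variable (r : ℤ → ℝ)

lemma row_le (f : ℤ → ℝ) (hf : ∀ d, 0 ≤ f d) (n : ℕ) (j : ℤ) (hj : j ∈ Finset.Icc (1 : ℤ) n) :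
    ∑ k ∈ Finset.Icc (1 : ℤ) n, f (k - j) ≤ ∑ d ∈ Finset.Icc (-(n : ℤ)) n, f d := by
  rw [← Finset.sum_image (f := f) (g := fun k => k - j) (fun a _ b _ h => by simpa using h)]
  refine Finset.sum_le_sum_of_subset_of_nonneg ?_ fun d _ _ => hf d
  intro d hd
  simp only [Finset.mem_image, Finset.mem_Icc] at hd hj ⊢
  obtain ⟨k, hk, rfl⟩ := hd
  lia

lemma row_le_tsum (f : ℤ → ℝ) (hf : ∀ d, 0 ≤ f d) (hs : Summable f) (s : Finset ℤ) (j : ℤ) :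
    ∑ k ∈ s, f (k - j) ≤ ∑' d, f d := by
  rw [← Finset.sum_image (f := f) (g := fun k => k - j) (fun a _ b _ h => by simpa using h)]
  exact hs.sum_le_tsum _ fun d _ => hf d

lemma B_bound (ev : ∀ d, r (-d) = r d) (l m n : ℕ)
    (hs : Summable fun d => |r d| ^ (l + m)) :
    ∑ k ∈ Finset.Icc (1 : ℤ) n, ∑ j ∈ Finset.Icc (1 : ℤ) n, ∑ k' ∈ Finset.Icc (1 : ℤ) n,
      ∑ j' ∈ Finset.Icc (1 : ℤ) n,
        |r (j - k)| ^ l * |r (j' - k')| ^ l * (|r (k' - k)| ^ m * |r (j' - j)| ^ m) ≤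
    n * (2 * theta1 (l + m) r * (∑ d ∈ Finset.Icc (-(n : ℤ)) n, |r d| ^ l) *
      (∑ d ∈ Finset.Icc (-(n : ℤ)) n, |r d| ^ m)) := by
  set s := Finset.Icc (1 : ℤ) n with hsd
  set Sl := ∑ d ∈ Finset.Icc (-(n : ℤ)) n, |r d| ^ l with hSl
  set Sm := ∑ d ∈ Finset.Icc (-(n : ℤ)) n, |r d| ^ m with hSm
  have sw : ∀ a b : ℤ, r (a - b) = r (b - a) := fun a b => by rw [← ev (b - a)]; congr 1; ring
  have hθ : 0 ≤ theta1 (l + m) r := tsum_nonneg fun d => by positivity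
  have h1 : ∀ k j' : ℤ, ∑ k' ∈ s, |r (j' - k')| ^ l * |r (k' - k)| ^ m ≤ 2 * theta1 (l + m) r := by
    intro k j'
    calc ∑ k' ∈ s, |r (j' - k')| ^ l * |r (k' - k)| ^ m
        ≤ ∑ k' ∈ s, (|r (k' - j')| ^ (l + m) + |r (k' - k)| ^ (l + m)) := by
          refine Finset.sum_le_sum fun k' _ => ?_
          rw [sw j' k']
          exact mul_pow_le_add _ _ (abs_nonneg _) (abs_nonneg _) l m
      _ ≤ theta1 (l + m) r + theta1 (l + m) r := by
          rw [Finset.sum_add_distrib]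
          exact add_le_add (row_le_tsum (fun d => |r d| ^ (l + m)) (fun d => by positivity) hs s j')
            (row_le_tsum (fun d => |r d| ^ (l + m)) (fun d => by positivity) hs s k)
      _ = _ := by ring
  calc ∑ k ∈ s, ∑ j ∈ s, ∑ k' ∈ s, ∑ j' ∈ s,
        |r (j - k)| ^ l * |r (j' - k')| ^ l * (|r (k' - k)| ^ m * |r (j' - j)| ^ m)
      = ∑ k ∈ s, ∑ j ∈ s, ∑ j' ∈ s, |r (j - k)| ^ l * |r (j' - j)| ^ m *
          ∑ k' ∈ s, |r (j' - k')| ^ l * |r (k' - k)| ^ m := by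
        refine Finset.sum_congr rfl fun k _ => Finset.sum_congr rfl fun j _ => ?_
        rw [Finset.sum_comm]
        refine Finset.sum_congr rfl fun j' _ => ?_
        rw [Finset.mul_sum]
        exact Finset.sum_congr rfl fun k' _ => by ring
    _ ≤ ∑ k ∈ s, ∑ j ∈ s, ∑ j' ∈ s, |r (j - k)| ^ l * |r (j' - j)| ^ m *
          (2 * theta1 (l + m) r) :=
        Finset.sum_le_sum fun k _ => Finset.sum_le_sum fun j _ => Finset.sum_le_sum fun j' _ =>
          mul_le_mul_of_nonneg_left (h1 k j') (by positivity)
    _ = ∑ j ∈ s, 2 * theta1 (l + m) r *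
          ((∑ k ∈ s, |r (k - j)| ^ l) * ∑ j' ∈ s, |r (j' - j)| ^ m) := by
        rw [Finset.sum_comm]
        refine Finset.sum_congr rfl fun j _ => ?_
        rw [Finset.sum_mul_sum, Finset.mul_sum]
        refine Finset.sum_congr rfl fun k _ => ?_
        rw [Finset.mul_sum]
        refine Finset.sum_congr rfl fun j' _ => ?_
        rw [sw j k]; ring
    _ ≤ ∑ j ∈ s, 2 * theta1 (l + m) r * (Sl * Sm) := by
        refine Finset.sum_le_sum fun j hj => mul_le_mul_of_nonneg_left ?_ (by positivity)
        exact mul_le_mul (row_le (fun d => |r d| ^ l) (fun d => by positivity) n j hj)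
          (row_le (fun d => |r d| ^ m) (fun d => by positivity) n j hj)
          (Finset.sum_nonneg fun _ _ => by positivity) (Finset.sum_nonneg fun _ _ => by positivity)
    _ = _ := by
        have cards : s.card = n := by rw [hsd]; simp
        rw [Finset.sum_const, cards, nsmul_eq_mul]; ring

lemma cnt_bound (n : ℕ) (d : ℤ) :
    (((Finset.Icc (1 : ℤ) n).filter fun k => d + k ∉ Finset.Icc (1 : ℤ) n).card : ℝ) ≤ |(d : ℝ)| := by
  rcases le_total 0 d with h | h
  · have : ((Finset.Icc (1 : ℤ) n).filter fun k => d + k ∉ Finset.Icc (1 : ℤ) n) ⊆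
        Finset.Ioc ((n : ℤ) - d) n := by
      intro k hk
      simp only [Finset.mem_filter, Finset.mem_Icc, Finset.mem_Ioc] at hk ⊢
      lia
    have h2 := Finset.card_le_card this
    rw [Int.card_Ioc] at h2
    rw [abs_of_nonneg (by exact_mod_cast h)]
    have : (((Finset.Icc (1 : ℤ) n).filter fun k => d + k ∉ Finset.Icc (1 : ℤ) n).card : ℤ) ≤ d := by
      lia
    exact_mod_cast this
  · have : ((Finset.Icc (1 : ℤ) n).filter fun k => d + k ∉ Finset.Icc (1 : ℤ) n) ⊆
        Finset.Ioc (0 : ℤ) (-d) := by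
      intro k hk
      simp only [Finset.mem_filter, Finset.mem_Icc, Finset.mem_Ioc] at hk ⊢
      lia
    have h2 := Finset.card_le_card this
    rw [Int.card_Ioc] at h2
    rw [abs_of_nonpos (by exact_mod_cast h)]
    have : (((Finset.Icc (1 : ℤ) n).filter fun k => d + k ∉ Finset.Icc (1 : ℤ) n).card : ℤ) ≤ -d := by
      lia
    exact_mod_cast this

lemma tau_bound (f : ℤ → ℝ) (n : ℕ) (hn : 1 ≤ n) (hs : Summable fun d => |f d|) :
    |(n : ℝ)⁻¹ * (∑ k ∈ Finset.Icc (1 : ℤ) n, ∑ j ∈ Finset.Icc (1 : ℤ) n, f (j - k)) - ∑' d, f d| ≤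
      (∑ d ∈ Finset.Icc (-(n : ℤ)) n, |f d| * |(d : ℝ)| / n) +
        ∑' d : {d : ℤ // (n : ℤ) < |d|}, |f d| := by
  classical
  have hn' : (0 : ℝ) < n := by exact_mod_cast hn
  set s := Finset.Icc (1 : ℤ) n with hsd
  have hsf : Summable f := hs.of_abs
  have e1 : ∀ k, ∑ j ∈ s, f (j - k) = ∑' d, if d + k ∈ s then f d else 0 := fun k => by
    rw [tsum_eq_sum (s := s.image fun j => j - k)]
    · rw [Finset.sum_image (fun a _ b _ h => by simpa using h)]
      refine Finset.sum_congr rfl fun j hj => ?_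
      simp [hj]
    · intro d hd
      rw [if_neg]
      intro h
      exact hd (Finset.mem_image.2 ⟨d + k, h, by ring⟩)
  have sm : ∀ k, Summable fun d => if d + k ∈ s then f d else 0 := fun k => by
    refine Summable.of_norm_bounded hs fun d => ?_
    split_ifs <;> simp
  have sm2 : ∀ k, Summable fun d => if d + k ∉ s then f d else 0 := fun k => by
    refine Summable.of_norm_bounded hs fun d => ?_
    split_ifs <;> simp
  have e2 : ∀ k, ∑ j ∈ s, f (j - k) - ∑' d, f d = - ∑' d, if d + k ∉ s then f d else 0 := fun k => by
    rw [e1, ← (sm k).tsum_sub hsf, ← tsum_neg]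
    congr 1; ext d
    split_ifs <;> simp_all
  have cards : s.card = n := by rw [hsd]; simp
  have e3 : (n : ℝ)⁻¹ * (∑ k ∈ s, ∑ j ∈ s, f (j - k)) - ∑' d, f d =
      - ∑' d, (n : ℝ)⁻¹ * ((s.filter fun k => d + k ∉ s).card * f d) := by
    have : ∑ k ∈ s, (∑ j ∈ s, f (j - k) - ∑' d, f d) =
        - ∑' d, ((s.filter fun k => d + k ∉ s).card * f d) := by
      simp only [e2, Finset.sum_neg_distrib]
      rw [← Summable.tsum_finsetSum fun k _ => sm2 k]
      congr 2; ext d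
      rw [← Finset.sum_filter, Finset.sum_const, nsmul_eq_mul]
    rw [Finset.sum_sub_distrib, Finset.sum_const, cards, nsmul_eq_mul] at this
    rw [tsum_mul_left, ← mul_neg, ← this]
    field_simp
  rw [e3, abs_neg]
  set u : ℤ → ℝ := fun d => (Set.indicator (↑(Finset.Icc (-(n : ℤ)) n)) (fun d : ℤ => |f d| * |(d : ℝ)| / n)) d +
    (Set.indicator {d : ℤ | (n : ℤ) < |d|} (fun d => |f d|)) d with hu
  have su1 : Summable (Set.indicator (↑(Finset.Icc (-(n : ℤ)) n) : Set ℤ)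
      (fun d : ℤ => |f d| * |(d : ℝ)| / n)) :=
    summable_of_hasFiniteSupport ((Finset.finite_toSet _).subset Set.support_indicator_subset)
  have su2 : Summable (Set.indicator {d : ℤ | (n : ℤ) < |d|} (fun d => |f d|)) := hs.indicator _
  have ule : ∀ d, |(n : ℝ)⁻¹ * ((s.filter fun k => d + k ∉ s).card * f d)| ≤ u d := fun d => by
    rw [abs_mul, abs_mul, abs_of_pos (inv_pos.2 hn'), Nat.abs_cast]
    by_cases hd : (n : ℤ) < |d|
    · have hd' : d ∉ (↑(Finset.Icc (-(n : ℤ)) n) : Set ℤ) := by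
        simp only [Finset.coe_Icc, Set.mem_Icc]; rw [← abs_le]; lia
      simp only [hu]
      rw [Set.indicator_of_notMem hd', Set.indicator_of_mem (by exact hd), zero_add]
      have : ((s.filter fun k => d + k ∉ s).card : ℝ) ≤ n := by
        exact_mod_cast (Finset.card_filter_le _ _).trans cards.le
      rw [inv_mul_le_iff₀ hn']
      exact mul_le_mul_of_nonneg_right this (abs_nonneg _)
    · have hd' : d ∈ (↑(Finset.Icc (-(n : ℤ)) n) : Set ℤ) := by
        simp only [Finset.coe_Icc, Set.mem_Icc]; rw [← abs_le]; lia
      simp only [hu]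
      rw [Set.indicator_of_mem hd', Set.indicator_of_notMem (by exact hd), add_zero]
      rw [inv_mul_eq_div]
      refine div_le_div_of_nonneg_right ?_ hn'.le
      rw [mul_comm]
      exact mul_le_mul_of_nonneg_left (cnt_bound n d) (abs_nonneg _)
  have := tsum_of_norm_bounded (f := fun d => (n : ℝ)⁻¹ * ((s.filter fun k => d + k ∉ s).card * f d)) (su1.add su2).hasSum ule
  rw [Real.norm_eq_abs] at this
  refine this.trans (le_of_eq ?_)
  rw [su1.tsum_add su2]
  congr 1
  · rw [tsum_eq_sum (s := Finset.Icc (-(n:ℤ)) n)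
      (fun d hd => Set.indicator_of_notMem (by simpa using hd) _)]
    exact Finset.sum_congr rfl fun d hd => Set.indicator_of_mem (by simpa using hd) _
  · rw [← tsum_subtype]; rfl

end comb

section final
variable {Ω : Type} [MeasurableSpace Ω] {P : Measure Ω} [IsProbabilityMeasure P]
    {X : ℤ → Ω → ℝ} {R : ℤ → ℤ → ℝ}

lemma l1_le_l2 {f : Ω → ℝ} (hf : ML P f) : ∫ ω, |f ω| ∂P ≤ Real.sqrt (∫ ω, f ω ^ 2 ∂P) := by
  refine Real.le_sqrt_of_sq_le ?_
  have i1 : Integrable (fun ω => |f ω|) P := hf.integrable.abs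
  have i2 : Integrable (fun ω => f ω ^ 2) P := by
    have := (hf.mul hf).integrable
    simpa only [pow_two] using this
  set t := ∫ ω, |f ω| ∂P with ht
  have h0 : 0 ≤ ∫ ω, (|f ω| - t) ^ 2 ∂P := integral_nonneg fun ω => sq_nonneg _
  have e : ∫ ω, (|f ω| - t) ^ 2 ∂P = ∫ ω, f ω ^ 2 ∂P - 2 * t * t + t ^ 2 := by
    have : (fun ω => (|f ω| - t) ^ 2) = fun ω => (f ω ^ 2 - 2 * t * |f ω|) + t ^ 2 := by
      ext ω; rw [← sq_abs (f ω)]; ring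
    have i3 : Integrable (fun ω => f ω ^ 2 - 2 * t * |f ω|) P := i2.sub (i1.const_mul _)
    rw [this, integral_add i3 (integrable_const _),
      integral_sub i2 (i1.const_mul _), integral_const_mul, ← ht]
    simp
  rw [e] at h0
  nlinarith

lemma GG_decomp (c : ℝ) (p : ℕ) (s : Finset ℤ) (ω : Ω) : GG X R c p s ω =
    ∑ i ∈ Finset.range p, ((p + 1) * cc p p i) * (c ^ 2 * TT X R s (i + 1) (p - i) ω) +
    ((p + 1).factorial : ℝ) * (c ^ 2 * ∑ k ∈ s, ∑ j ∈ s, R k j ^ (p + 1)) := by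
  have h1 : GG X R c p s ω = ∑ i ∈ Finset.range (p + 1), ((p + 1) * cc p p i) *
      (c ^ 2 * TT X R s (i + 1) (p - i) ω) := by
    have e : ∀ k j, R k j * (Hev p (X k ω) * Hev p (X j ω)) = ∑ i ∈ Finset.range (p + 1),
        cc p p i * (R k j ^ (i + 1) * W (R k j) (X k ω) (X j ω) (p - i) (p - i)) := fun k j => by
      rw [prod_formula (R k j) (X k ω) (X j ω) p p (p + 1) (Nat.lt_succ_self p), Finset.mul_sum]
      refine Finset.sum_congr rfl fun i _ => ?_
      ring
    rw [GG]
    simp only [e]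
    have e2 : ∑ k ∈ s, ∑ j ∈ s, ∑ i ∈ Finset.range (p + 1),
        cc p p i * (R k j ^ (i + 1) * W (R k j) (X k ω) (X j ω) (p - i) (p - i)) =
        ∑ i ∈ Finset.range (p + 1), cc p p i * TT X R s (i + 1) (p - i) ω := by
      simp only [TT, Finset.mul_sum]
      rw [Finset.sum_comm (s := Finset.range (p + 1))]
      refine Finset.sum_congr rfl fun k _ => ?_
      rw [Finset.sum_comm]
    rw [e2, Finset.mul_sum]
    exact Finset.sum_congr rfl fun i _ => by ring
  rw [h1, Finset.sum_range_succ]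
  congr 1
  simp only [Nat.sub_self, TT, W_zero, Hev_zero, mul_one, cc, Nat.choose_self, Nat.factorial_succ]
  push_cast; ring

lemma StdG.E_bound {r : ℤ → ℝ} (hS : StdG P X (fun k j => r (j - k))) (hr0 : r 0 = 1) (p n : ℕ)
    (hn : 1 ≤ n) (hs : Summable fun d => |r d| ^ (p + 1)) :
    ∫ ω, |GG X (fun k j => r (j - k)) (Real.sqrt n)⁻¹ p (Finset.Icc (1 : ℤ) n) ω - sig1 (p + 1) r| ∂P ≤
      2 * (A1one (p + 1) r n + A3one (p + 1) r n) := by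
  have hn' : (0 : ℝ) < n := by exact_mod_cast hn
  set c := (Real.sqrt n)⁻¹ with hc
  have hc2 : c ^ 2 = (n : ℝ)⁻¹ := by rw [hc, inv_pow, Real.sq_sqrt hn'.le]
  set R : ℤ → ℤ → ℝ := fun k j => r (j - k) with hR
  set s := Finset.Icc (1 : ℤ) n with hsd
  have ev : ∀ d, r (-d) = r d := fun d => by simpa [hR] using hS.symm d 0
  set τ := ((p + 1).factorial : ℝ) * (c ^ 2 * ∑ k ∈ s, ∑ j ∈ s, R k j ^ (p + 1)) with hτ
  have mlT : ∀ i, ML P (fun ω => c ^ 2 * TT X R s (i + 1) (p - i) ω) := fun i =>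
    (hS.mlT s (i + 1) (p - i)).const_mul _
  have hcc : ∀ i, 0 ≤ (p + 1 : ℝ) * cc p p i := fun i => by unfold cc; positivity
  -- constant part
  have hA1 : |τ - sig1 (p + 1) r| ≤ 2 * A1one (p + 1) r n := by
    have hs' : Summable fun d => |r d ^ (p + 1)| := by simpa only [abs_pow] using hs
    have := tau_bound (fun d => r d ^ (p + 1)) n hn hs'
    have hθ : 1 ≤ theta1 (p + 1) r := by
      have := hs.le_tsum 0 (fun d _ => by positivity)
      simpa [hr0, theta1] using this
    rw [hτ, sig1, ← mul_sub, abs_mul, Nat.abs_cast, A1one, hc2]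
    simp only [abs_pow] at this
    set Q := (∑ j ∈ Finset.Icc (-(n : ℤ)) n, |r j| ^ (p + 1) * |(j : ℝ)| / n) +
     ∑' j : {j : ℤ // (n : ℤ) < |j|}, |r (j : ℤ)| ^ (p + 1) with hQ
    have hQ0 : 0 ≤ Q := (abs_nonneg _).trans this
    calc _ ≤ ((p + 1).factorial : ℝ) * Q := mul_le_mul_of_nonneg_left this (by positivity)
      _ ≤ ((p + 1).factorial : ℝ) * (theta1 (p + 1) r * Q) :=
          mul_le_mul_of_nonneg_left (le_mul_of_one_le_left hQ0 hθ) (by positivity)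
      _ = _ := by ring
  -- each chaos component
  have hT : ∀ i ∈ Finset.range p, ∫ ω, |c ^ 2 * TT X R s (i + 1) (p - i) ω| ∂P ≤
      Real.sqrt ((2 * (p + 1) - 2 * (i + 1)).factorial) * gamma1 (p + 1) r n (i + 1) := by
    intro i hi
    have hi' : i < p := by simpa using hi
    refine (l1_le_l2 (mlT i)).trans ?_
    rw [gamma1, ← Real.sqrt_mul (by positivity)]
    refine Real.sqrt_le_sqrt ?_
    simp only [mul_pow]
    rw [integral_const_mul, hc2]
    have h1 := hS.T_sq s (i + 1) (p - i)
    have h2 := B_bound r ev (i + 1) (p - i) n (by rwa [show i + 1 + (p - i) = p + 1 by lia])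
    rw [show i + 1 + (p - i) = p + 1 by lia] at h2
    rw [show 2 * (p + 1) - 2 * (i + 1) = 2 * (p - i) by lia, show p + 1 - (i + 1) = p - i by lia]
    calc _ ≤ ((n : ℝ)⁻¹) ^ 2 * (((2 * (p - i)).factorial : ℝ) * (n * (2 * theta1 (p + 1) r *
          (∑ d ∈ Finset.Icc (-(n : ℤ)) n, |r d| ^ (i + 1)) *
          (∑ d ∈ Finset.Icc (-(n : ℤ)) n, |r d| ^ (p - i))))) :=
          mul_le_mul_of_nonneg_left (h1.trans (mul_le_mul_of_nonneg_left h2 (by positivity)))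
            (by positivity)
      _ = _ := by field_simp
  have hA3 : ∑ i ∈ Finset.range p, ((p + 1) * cc p p i) *
      (Real.sqrt ((2 * (p + 1) - 2 * (i + 1)).factorial) * gamma1 (p + 1) r n (i + 1)) =
      2 * A3one (p + 1) r n := by
    rw [A3one, show p + 1 - 1 = p by lia, ← Finset.Ico_succ_right_eq_Icc, Finset.sum_Ico_eq_sum_range,
      Finset.mul_sum, Finset.mul_sum]
    refine Finset.sum_congr (by simp) fun i _ => ?_
    have h := Nat.add_one_mul_choose_eq p i
    have h' : ((p : ℝ) + 1) * p.choose i = (p + 1).choose (i + 1) * (i + 1) := by exact_mod_cast h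
    rw [add_comm 1 i, cc, Nat.factorial_succ i]
    push_cast
    have e : ((p : ℝ) + 1) * (i.factorial * p.choose i * p.choose i) =
      1 / (p + 1) * ((i + 1) * ((i + 1) * i.factorial) * ((p + 1).choose (i + 1)) ^ 2) := by
      field_simp
      linear_combination (((p : ℝ) + 1) * p.choose i +
        ((p + 1).choose (i + 1)) * ((i : ℝ) + 1)) * h'
    rw [e]
    field_simp
  have mlsum : ML P (fun ω => ∑ i ∈ Finset.range p, ((p + 1) * cc p p i) *
      |c ^ 2 * TT X R s (i + 1) (p - i) ω|) := ML.sum _ fun i _ =>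
    ML.const_mul _ fun q => (mlT i q).abs
  calc ∫ ω, |GG X R c p s ω - sig1 (p + 1) r| ∂P
      ≤ ∫ ω, ((∑ i ∈ Finset.range p, ((p + 1) * cc p p i) *
        |c ^ 2 * TT X R s (i + 1) (p - i) ω|) + |τ - sig1 (p + 1) r|) ∂P := by
        refine integral_mono ((hS.mlG c p s).sub (ML.const _)).integrable.abs
          (mlsum.add (ML.const _)).integrable fun ω => ?_
        show |GG X R c p s ω - sig1 (p + 1) r| ≤ _
        rw [GG_decomp, add_sub_assoc]
        refine (abs_add_le _ _).trans (add_le_add ((Finset.abs_sum_le_sum_abs _ _).trans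
          (le_of_eq (Finset.sum_congr rfl fun i _ => ?_))) le_rfl)
        rw [abs_mul, abs_of_nonneg (hcc i)]
    _ = ∑ i ∈ Finset.range p, ((p + 1) * cc p p i) *
        ∫ ω, |c ^ 2 * TT X R s (i + 1) (p - i) ω| ∂P + |τ - sig1 (p + 1) r| := by
        rw [integral_add mlsum.integrable (integrable_const _), integral_finsetSum]
        · simp only [integral_const_mul]; simp
        · intro i _
          exact (mlT i).integrable.abs.const_mul _
    _ ≤ 2 * A3one (p + 1) r n + 2 * A1one (p + 1) r n := by
        rw [← hA3]
        exact add_le_add (Finset.sum_le_sum fun i hi =>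
          mul_le_mul_of_nonneg_left (hT i hi) (hcc i)) hA1
    _ = _ := by ring

end final

/-- Hermite subordination, bound for Lipschitz test functions:
|E[h(S_n)] - E[h(S)]| <= (2 Lip(h) / sigma) (A_{1,n} + A_{3,n}). -/
theorem stmt11
    {Ω : Type} [MeasureSpace Ω] [IsProbabilityMeasure (ℙ : Measure Ω)]
    (X : ℤ → Ω → ℝ) (hXmeas : ∀ k, Measurable (X k))
    (hGauss : ∀ (s : Finset ℤ) (c : ℤ → ℝ), ∃ v : ℝ≥0,
      Measure.map (fun ω => ∑ k ∈ s, c k * X k ω) ℙ = gaussianReal 0 v)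
    (r : ℤ → ℝ) (hr : ∀ k j : ℤ, ∫ ω, X k ω * X (k + j) ω = r j)
    (hr0 : r 0 = 1) (q : ℕ) (hq : 1 ≤ q)
    (hBM : Summable fun j : ℤ => |r j| ^ q)    (hσ : 0 < sig1 q r) :
    ∀ h : ℝ → ℝ, ∀ L : ℝ≥0, LipschitzWith L h → ∀ n : ℕ, 1 ≤ n →
      |(∫ ω, h (S1 q X n ω)) - ∫ x, h x ∂(gaussianReal 0 (sig1 q r).toNNReal)| ≤
        2 * (L : ℝ) / Real.sqrt (sig1 q r) * (A1one q r n + A3one q r n) := by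
  intro h L hL n hn
  obtain ⟨p, rfl⟩ : ∃ p, q = p + 1 := ⟨q - 1, by lia⟩
  have hS : StdG (ℙ : Measure Ω) X (fun k j => r (j - k)) :=
    { meas := hXmeas
      proc := procOf X hXmeas hGauss
      mean := fun k => by
        obtain ⟨v, hv⟩ := hGauss {k} (fun _ => 1)
        simp only [Finset.sum_singleton, one_mul] at hv
        have := integral_id_gaussianReal (μ := 0) (v := v)
        rw [← hv, integral_map (hXmeas k).aemeasurable (by fun_prop)] at this
        exact this
      cov := fun k j => by
        have := hr k (j - k)
        rwa [show k + (j - k) = j by ring] at this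
      var := fun k => by simp [hr0] }
  have key := lip_bound (hS.measF (Real.sqrt n)⁻¹ (p + 1) (Finset.Icc (1 : ℤ) n))
    (hS.mlF (Real.sqrt n)⁻¹ (p + 1) (Finset.Icc (1 : ℤ) n)).integrable
    (hS.mlG (Real.sqrt n)⁻¹ p (Finset.Icc (1 : ℤ) n)).integrable
    (fun g g' hg hg' C C' hC hC' => hS.steinF _ p _ g g' hg hg' C C' hC hC')
    (sig1 (p + 1) r) hσ h L hL
  have e : ∀ ω, S1 (p + 1) X n ω = FF X (Real.sqrt n)⁻¹ (p + 1) (Finset.Icc (1 : ℤ) n) ω :=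
    fun ω => rfl
  simp only [e]
  refine key.trans ?_
  calc _ ≤ L / Real.sqrt (sig1 (p + 1) r) * (2 * (A1one (p + 1) r n + A3one (p + 1) r n)) :=
        mul_le_mul_of_nonneg_left (hS.E_bound hr0 p n hn hBM) (by positivity)
    _ = _ := by ring
end
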